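/- For every θ ∈ [0,1], every α ∈ [−θ/4, θ], and every b > θ/2 there exists a constant C > 0, depending only on ν, μ, θ, α and b, such that for every Schwartz function F on ℝ² one has ‖D_x^{α} P^a F‖_{L^p_x L^q_t} ≤ C ‖F‖_{X_{0,b}}, where 1/p = 1/2 − α/5 − 3θ/10 and 1/q = 1/2 + 2α/5 − 2θ/5. (Interpolation of the Bourgain-space Strichartz estimates with the trivial L² bound, Lemma 2.3.) -/

import Mathlib

open MeasureTheory Real
open scoped ENNReal NNReal Classical

noncomputable section

/-- Phase function of the linear Benjamin equation: `φ(ξ) = -ν ξ|ξ| + μ ξ³`. -/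
def phase (ν μ ξ : ℝ) : ℝ := -ν * ξ * |ξ| + μ * ξ ^ 3

/-- Derivative of the phase: `φ'(ξ) = -2ν|ξ| + 3μξ²`. -/
def dphase (ν μ ξ : ℝ) : ℝ := -2 * ν * |ξ| + 3 * μ * ξ ^ 2

/-- The frequency threshold `a = 2·max(1, |2ν/(3μ)|)`. -/
def aconst (ν μ : ℝ) : ℝ := 2 * max 1 |2 * ν / (3 * μ)|

/-- Fourier transform in the space variable. -/
def FT (f : ℝ → ℂ) (ξ : ℝ) : ℂ := ∫ x : ℝ, Complex.exp (-(Complex.I * ξ * x)) * f x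

/-- Space-time Fourier transform. -/
def FT2 (u : ℝ → ℝ → ℂ) (ξ τ : ℝ) : ℂ :=
  ∫ x : ℝ, ∫ t : ℝ, Complex.exp (-(Complex.I * (ξ * x + τ * t))) * u x t

/-- Mixed norm `‖f‖_{L^p_x L^q_t}` (with exponents in `ℝ≥0∞`). -/
def mixedLpLq (p q : ℝ≥0∞) (f : ℝ → ℝ → ℂ) : ℝ≥0∞ :=
  if p = ∞ then essSup (fun x => eLpNorm (f x) q volume) volume
  else (∫⁻ x : ℝ, eLpNorm (f x) q volume ^ p.toReal) ^ (1 / p.toReal)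

/-- The Bourgain norm `‖u‖_{X_{s,b}}` associated to the Benjamin phase function. -/
def XNorm (ν μ s b : ℝ) (u : ℝ → ℝ → ℂ) : ℝ≥0∞ :=
  (∫⁻ ξ : ℝ, ∫⁻ τ : ℝ,
      ENNReal.ofReal ((1 + ξ ^ 2) ^ s * (1 + (τ - phase ν μ ξ) ^ 2) ^ b) *
        (‖FT2 u ξ τ‖₊ : ℝ≥0∞) ^ 2) ^ (1 / 2 : ℝ)

/-- The free Benjamin group `S(t)` applied to initial data `u₀`, as a function of `(x,t)`. -/
def Sgrp (ν μ : ℝ) (u₀ : ℝ → ℂ) (x t : ℝ) : ℂ :=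
  (2 * π)⁻¹ • ∫ ξ : ℝ, Complex.exp (Complex.I * (ξ * x + phase ν μ ξ * t)) * FT u₀ ξ

/-- `D_x^α S(t) P^a u₀` : the Benjamin group composed with the Fourier restriction
`P^a` to `{|ξ| ≥ a}` and the derivative operator `D_x^α`. -/
def DSgrpPa (ν μ α : ℝ) (u₀ : ℝ → ℂ) (x t : ℝ) : ℂ :=
  (2 * π)⁻¹ • ∫ ξ : ℝ,
    if aconst ν μ ≤ |ξ| then
      (↑(|ξ| ^ α) : ℂ) * Complex.exp (Complex.I * (ξ * x + phase ν μ ξ * t)) * FT u₀ ξ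
    else 0

/-- `D_x^α P^a F` acting in the space variable of a space-time function `F`. -/
def DPa (ν μ α : ℝ) (F : ℝ → ℝ → ℂ) (x t : ℝ) : ℂ :=
  (2 * π)⁻¹ • ∫ ξ : ℝ,
    if aconst ν μ ≤ |ξ| then
      (↑(|ξ| ^ α) : ℂ) * Complex.exp (Complex.I * (ξ * x)) * FT (fun y => F y t) ξ
    else 0

/-- First derivative test for oscillatory integrals, without monotonicity. -/
theorem norm_integral_cexp_le_of_deriv_ne_zero {Ψ Ψ₁ Ψ₂ : ℝ → ℝ} {c d : ℝ} (hcd : c ≤ d)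
    (h1 : ∀ x, HasDerivAt Ψ (Ψ₁ x) x) (h2 : ∀ x, HasDerivAt Ψ₁ (Ψ₂ x) x)
    (hc : Continuous Ψ₂) (h0 : ∀ x ∈ Set.Icc c d, Ψ₁ x ≠ 0) :
    ‖∫ x in c..d, Complex.exp (Complex.I * Ψ x)‖ ≤
      1 / |Ψ₁ c| + 1 / |Ψ₁ d| + ∫ x in c..d, |Ψ₂ x| / Ψ₁ x ^ 2 := by
  have hΨ : Continuous Ψ := continuous_iff_continuousAt.2 fun x => (h1 x).continuousAt
  have hΨ1 : Continuous Ψ₁ := continuous_iff_continuousAt.2 fun x => (h2 x).continuousAt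
  set u : ℝ → ℂ := fun x => (Complex.I * Ψ₁ x)⁻¹ with hu
  set u' : ℝ → ℂ := fun x => -(Complex.I * Ψ₂ x) / (Complex.I * Ψ₁ x) ^ 2 with hu'
  set v : ℝ → ℂ := fun x => Complex.exp (Complex.I * Ψ x) with hv
  set v' : ℝ → ℂ := fun x => Complex.exp (Complex.I * Ψ x) * (Complex.I * Ψ₁ x) with hv'
  have hI : Set.uIcc c d = Set.Icc c d := Set.uIcc_of_le hcd
  have hne : ∀ x ∈ Set.Icc c d, Complex.I * (Ψ₁ x : ℂ) ≠ 0 := fun x hx =>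
    mul_ne_zero Complex.I_ne_zero (Complex.ofReal_ne_zero.2 (h0 x hx))
  have hdu : ∀ x ∈ Set.uIcc c d, HasDerivAt u (u' x) x := by
    intro x hx
    rw [hI] at hx
    exact ((h2 x).ofReal_comp.const_mul Complex.I).inv (hne x hx)
  have hdv : ∀ x ∈ Set.uIcc c d, HasDerivAt v (v' x) x := by
    intro x _
    exact ((h1 x).ofReal_comp.const_mul Complex.I).cexp
  have hu'c : ContinuousOn u' (Set.uIcc c d) := by
    rw [hI]
    apply ContinuousOn.div
    · fun_prop
    · fun_prop
    · intro x hx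
      exact pow_ne_zero _ (hne x hx)
  have hv'c : Continuous v' := by fun_prop
  have key := intervalIntegral.integral_mul_deriv_eq_deriv_mul hdu hdv
    hu'c.intervalIntegrable (hv'c.intervalIntegrable _ _)
  have e1 : ∫ x in c..d, Complex.exp (Complex.I * Ψ x) = ∫ x in c..d, u x * v' x := by
    apply intervalIntegral.integral_congr
    intro x hx
    rw [hI] at hx
    simp only [hu, hv']
    field_simp [hne x hx]
    rw [div_self (Complex.ofReal_ne_zero.2 (h0 x hx))]
  have nv : ∀ x, ‖v x‖ = 1 := by
    intro x
    simp only [hv]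
    rw [mul_comm, Complex.norm_exp_ofReal_mul_I]
  have nu : ∀ x, ‖u x‖ = 1 / |Ψ₁ x| := by
    intro x
    simp [hu]
  have nu' : ∀ x, ‖u' x * v x‖ = |Ψ₂ x| / Ψ₁ x ^ 2 := by
    intro x
    rw [norm_mul, nv, mul_one]
    simp [hu']
  rw [e1, key]
  calc _ ≤ ‖u d * v d‖ + ‖u c * v c‖ + ‖∫ x in c..d, u' x * v x‖ :=
        (norm_sub_le _ _).trans (by gcongr; exact norm_sub_le _ _)
    _ ≤ 1 / |Ψ₁ d| + 1 / |Ψ₁ c| + ∫ x in c..d, |Ψ₂ x| / Ψ₁ x ^ 2 := by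
        rw [norm_mul, norm_mul, nv, nv, nu, nu, mul_one, mul_one]
        gcongr
        refine (intervalIntegral.norm_integral_le_integral_norm hcd).trans ?_
        simp_rw [nu']
        exact le_rfl
    _ = _ := by ring

theorem norm_integral_cexp_le_length {Ψ : ℝ → ℝ} {c d : ℝ} (hcd : c ≤ d) :
    ‖∫ x in c..d, Complex.exp (Complex.I * Ψ x)‖ ≤ d - c := by
  have := intervalIntegral.norm_integral_le_of_norm_le_const (a := c) (b := d) (C := 1)
    (f := fun x => Complex.exp (Complex.I * Ψ x)) (by
      intro x _
      rw [mul_comm, Complex.norm_exp_ofReal_mul_I])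
  rwa [one_mul, abs_of_nonneg (by linarith)] at this

/-- Second derivative test when the first derivative is nonnegative at the left end. -/
theorem norm_integral_cexp_le_of_convex_of_nonneg {Ψ Ψ₁ Ψ₂ : ℝ → ℝ} {c d ρ : ℝ} (hcd : c ≤ d)
    (h1 : ∀ x, HasDerivAt Ψ (Ψ₁ x) x) (h2 : ∀ x, HasDerivAt Ψ₁ (Ψ₂ x) x)
    (hc : Continuous Ψ₂) (hρ : 0 < ρ) (h0 : ∀ x ∈ Set.Icc c d, ρ ≤ Ψ₂ x) (hΨc : 0 ≤ Ψ₁ c) :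
    ‖∫ x in c..d, Complex.exp (Complex.I * Ψ x)‖ ≤ 4 / √ρ := by
  have hs : 0 < √ρ := Real.sqrt_pos.2 hρ
  have hss : √ρ * √ρ = ρ := Real.mul_self_sqrt hρ.le
  have hΨ : Continuous Ψ := continuous_iff_continuousAt.2 fun x => (h1 x).continuousAt
  have hE : Continuous fun x => Complex.exp (Complex.I * Ψ x) := by fun_prop
  have hΨ1 : Continuous Ψ₁ := continuous_iff_continuousAt.2 fun x => (h2 x).continuousAt
  by_cases hd : d ≤ c + 1 / √ρ
  · refine (norm_integral_cexp_le_length hcd).trans ?_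
    calc d - c ≤ 1 / √ρ := by linarith
      _ ≤ 4 / √ρ := by gcongr; norm_num
  push Not at hd
  set m := c + 1 / √ρ with hm
  have hcm : c ≤ m := by rw [hm]; have : 0 < 1 / √ρ := by positivity
                         linarith
  have mono : ∀ x ∈ Set.Icc c d, ρ * (x - c) ≤ Ψ₁ x := by
    intro x hx
    have : ∫ y in c..x, Ψ₂ y = Ψ₁ x - Ψ₁ c :=
      intervalIntegral.integral_eq_sub_of_hasDerivAt (fun y _ => h2 y) (hc.intervalIntegrable _ _)
    have h3 : ∫ y in c..x, ρ ≤ ∫ y in c..x, Ψ₂ y :=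
      intervalIntegral.integral_mono_on hx.1 (by simp) (hc.intervalIntegrable _ _)
        fun y hy => h0 y ⟨hy.1, hy.2.trans hx.2⟩
    rw [this, intervalIntegral.integral_const, smul_eq_mul] at h3
    linarith
  have big : ∀ x ∈ Set.Icc m d, √ρ ≤ Ψ₁ x := by
    intro x hx
    refine le_trans ?_ (mono x ⟨hcm.trans hx.1, hx.2⟩)
    have : 1 / √ρ ≤ x - c := by linarith [hx.1]
    calc √ρ = ρ * (1 / √ρ) := by field_simp; rw [sq, hss]
      _ ≤ _ := by gcongr
  have pos : ∀ x ∈ Set.Icc m d, 0 < Ψ₁ x := fun x hx => hs.trans_le (big x hx)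
  have hmd := hd.le
  have b2 := norm_integral_cexp_le_of_deriv_ne_zero hmd h1 h2 hc (fun x hx => (pos x hx).ne')
  have e3 : ∫ x in m..d, |Ψ₂ x| / Ψ₁ x ^ 2 = 1 / Ψ₁ m - 1 / Ψ₁ d := by
    have : ∀ x ∈ Set.uIcc m d, HasDerivAt (fun x => -(Ψ₁ x)⁻¹) (|Ψ₂ x| / Ψ₁ x ^ 2) x := by
      intro x hx
      rw [Set.uIcc_of_le hmd] at hx
      rw [abs_of_nonneg (hρ.le.trans (h0 x ⟨hcm.trans hx.1, hx.2⟩))]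
      exact ((h2 x).inv (pos x hx).ne').neg.congr_deriv (by ring)
    rw [intervalIntegral.integral_eq_sub_of_hasDerivAt this]
    · simp only [one_div]; ring
    · apply ContinuousOn.intervalIntegrable
      rw [Set.uIcc_of_le hmd]
      apply ContinuousOn.div (by fun_prop) (by fun_prop)
      intro x hx
      exact pow_ne_zero _ (pos x hx).ne'
  have p1 := big m ⟨le_rfl, hmd⟩
  have p2 := big d ⟨hmd, le_rfl⟩
  rw [e3, abs_of_pos (hs.trans_le p1), abs_of_pos (hs.trans_le p2)] at b2
  rw [← intervalIntegral.integral_add_adjacent_intervals (hE.intervalIntegrable c m)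
    (hE.intervalIntegrable m d)]
  have b1 := norm_integral_cexp_le_length (Ψ := Ψ) hcm
  have q1 : 1 / Ψ₁ m ≤ 1 / √ρ := by gcongr
  calc _ ≤ _ := norm_add_le _ _
    _ ≤ (m - c) + (1 / Ψ₁ m + 1 / Ψ₁ d + (1 / Ψ₁ m - 1 / Ψ₁ d)) := add_le_add b1 b2
    _ = 1 / √ρ + 2 * (1 / Ψ₁ m) := by rw [hm]; ring
    _ ≤ 1 / √ρ + 2 * (1 / √ρ) := by gcongr
    _ ≤ 4 / √ρ := by
      have : 0 < 1 / √ρ := by positivity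
      have e : 4 / √ρ = 4 * (1 / √ρ) := by ring
      rw [e]; linarith

theorem norm_integral_cexp_le_of_convex_of_nonpos {Ψ Ψ₁ Ψ₂ : ℝ → ℝ} {c d ρ : ℝ} (hcd : c ≤ d)
    (h1 : ∀ x, HasDerivAt Ψ (Ψ₁ x) x) (h2 : ∀ x, HasDerivAt Ψ₁ (Ψ₂ x) x)
    (hc : Continuous Ψ₂) (hρ : 0 < ρ) (h0 : ∀ x ∈ Set.Icc c d, ρ ≤ Ψ₂ x) (hΨd : Ψ₁ d ≤ 0) :
    ‖∫ x in c..d, Complex.exp (Complex.I * Ψ x)‖ ≤ 4 / √ρ := by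
  have := norm_integral_cexp_le_of_convex_of_nonneg (Ψ := fun x => Ψ (-x))
    (Ψ₁ := fun x => -Ψ₁ (-x)) (Ψ₂ := fun x => Ψ₂ (-x)) (c := -d) (d := -c) (ρ := ρ) (by linarith)
    (fun x => by
      have h := (h1 (-x)).scomp x (hasDerivAt_neg x)
      rw [neg_smul, one_smul] at h
      exact h)
    (fun x => by
      have h := ((h2 (-x)).scomp x (hasDerivAt_neg x)).neg
      rw [neg_smul, one_smul, neg_neg] at h
      exact h) (by fun_prop) hρ
    (fun x hx => h0 _ ⟨by linarith [hx.2], by linarith [hx.1]⟩) (by simpa using hΨd)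
  rw [intervalIntegral.integral_comp_neg (fun x => Complex.exp (Complex.I * Ψ x))] at this
  simpa using this

theorem norm_integral_cexp_le_of_convex {Ψ Ψ₁ Ψ₂ : ℝ → ℝ} {c d ρ : ℝ} (hcd : c ≤ d)
    (h1 : ∀ x, HasDerivAt Ψ (Ψ₁ x) x) (h2 : ∀ x, HasDerivAt Ψ₁ (Ψ₂ x) x)
    (hc : Continuous Ψ₂) (hρ : 0 < ρ) (h0 : ∀ x ∈ Set.Icc c d, ρ ≤ Ψ₂ x) :
    ‖∫ x in c..d, Complex.exp (Complex.I * Ψ x)‖ ≤ 8 / √ρ := by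
  have h48 : 4 / √ρ ≤ 8 / √ρ := by gcongr; norm_num
  by_cases hl : 0 ≤ Ψ₁ c
  · exact (norm_integral_cexp_le_of_convex_of_nonneg hcd h1 h2 hc hρ h0 hl).trans h48
  by_cases hr : Ψ₁ d ≤ 0
  · exact (norm_integral_cexp_le_of_convex_of_nonpos hcd h1 h2 hc hρ h0 hr).trans h48
  push Not at hl hr
  have hΨ : Continuous Ψ := continuous_iff_continuousAt.2 fun x => (h1 x).continuousAt
  have hE : Continuous fun x => Complex.exp (Complex.I * Ψ x) := by fun_prop
  have hΨ1 : Continuous Ψ₁ := continuous_iff_continuousAt.2 fun x => (h2 x).continuousAt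
  obtain ⟨e, he, he0⟩ := intermediate_value_Icc hcd hΨ1.continuousOn ⟨hl.le, hr.le⟩
  rw [← intervalIntegral.integral_add_adjacent_intervals (hE.intervalIntegrable c e)
    (hE.intervalIntegrable e d)]
  have b1 := norm_integral_cexp_le_of_convex_of_nonpos he.1 h1 h2 hc hρ
    (fun x hx => h0 x ⟨hx.1, hx.2.trans he.2⟩) he0.le
  have b2 := norm_integral_cexp_le_of_convex_of_nonneg he.2 h1 h2 hc hρ
    (fun x hx => h0 x ⟨he.1.trans hx.1, hx.2⟩) he0.ge
  calc _ ≤ _ := norm_add_le _ _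
    _ ≤ 4 / √ρ + 4 / √ρ := add_le_add b1 b2
    _ = _ := by ring

/-- Van der Corput's second derivative test. -/
theorem norm_integral_cexp_le_of_concave_or_convex {Ψ Ψ₁ Ψ₂ : ℝ → ℝ} {c d ρ : ℝ} (hcd : c ≤ d)
    (h1 : ∀ x, HasDerivAt Ψ (Ψ₁ x) x) (h2 : ∀ x, HasDerivAt Ψ₁ (Ψ₂ x) x)
    (hc : Continuous Ψ₂) (hρ : 0 < ρ)
    (h0 : (∀ x ∈ Set.Icc c d, ρ ≤ Ψ₂ x) ∨ ∀ x ∈ Set.Icc c d, Ψ₂ x ≤ -ρ) :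
    ‖∫ x in c..d, Complex.exp (Complex.I * Ψ x)‖ ≤ 8 / √ρ := by
  rcases h0 with h0 | h0
  · exact norm_integral_cexp_le_of_convex hcd h1 h2 hc hρ h0
  · have := norm_integral_cexp_le_of_convex hcd (Ψ := fun x => -Ψ x)
      (Ψ₁ := fun x => -Ψ₁ x) (Ψ₂ := fun x => -Ψ₂ x) (ρ := ρ) (fun x => (h1 x).neg)
      (fun x => (h2 x).neg) hc.neg hρ (fun x hx => by linarith [h0 x hx])
    have e : ∫ x in c..d, Complex.exp (Complex.I * Ψ x) =
        starRingEnd ℂ (∫ x in c..d, Complex.exp (Complex.I * ((-Ψ x : ℝ) : ℂ))) := by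
      rw [← intervalIntegral.intervalIntegral_conj]
      congr 1 with x
      rw [← Complex.exp_conj]
      simp
    rw [e, Complex.norm_conj]
    exact this

theorem exists_split_of_antitoneOn {r : ℝ → ℝ} {A B : ℝ} (L : ℝ) (hAB : A ≤ B)
    (hr : AntitoneOn r (Set.Icc A B)) (hc : Continuous r) :
    ∃ e ∈ Set.Icc A B, (A = e ∨ ∀ x ∈ Set.Icc A e, L ≤ r x) ∧
      (e = B ∨ ∀ x ∈ Set.Icc e B, r x ≤ L) := by
  by_cases h1 : r A ≤ L
  · exact ⟨A, ⟨le_rfl, hAB⟩, Or.inl rfl, Or.inr fun x hx =>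
      (hr ⟨le_rfl, hAB⟩ hx hx.1).trans h1⟩
  by_cases h2 : L ≤ r B
  · exact ⟨B, ⟨hAB, le_rfl⟩, Or.inr fun x hx =>
      h2.trans (hr hx ⟨hAB, le_rfl⟩ hx.2), Or.inl rfl⟩
  push Not at h1 h2
  obtain ⟨e, he, hee⟩ := intermediate_value_Icc' hAB hc.continuousOn ⟨h2.le, h1.le⟩
  exact ⟨e, he, Or.inr fun x hx => hee ▸ hr ⟨hx.1, hx.2.trans he.2⟩ he hx.2,
    Or.inr fun x hx => hee ▸ hr he ⟨he.1.trans hx.1, hx.2⟩ hx.1⟩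

/-- The Benjamin phase after the substitution `ξ = η²`, with `s = 3μt` and `w = 2ν/(3μ)`. -/
def sqPhase (x s w η : ℝ) : ℝ := x * η ^ 2 + s * (-(w / 2) * η ^ 4 + η ^ 6 / 3)

def sqPhaseDeriv (x s w η : ℝ) : ℝ := 2 * η * (x + s * (η ^ 2 * (η ^ 2 - w)))

def sqPhaseDeriv2 (x s w η : ℝ) : ℝ :=
  2 * (x + s * (η ^ 2 * (η ^ 2 - w))) + 4 * (s * (η ^ 2 * (2 * η ^ 2 - w)))

theorem hasDerivAt_sqPhase (x s w η : ℝ) :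
    HasDerivAt (sqPhase x s w) (sqPhaseDeriv x s w η) η := by
  have h2 := hasDerivAt_pow 2 η
  have h4 := hasDerivAt_pow 4 η
  have h6 := hasDerivAt_pow 6 η
  have := (h2.const_mul x).add (((h4.const_mul (-(w / 2))).add (h6.div_const 3)).const_mul s)
  refine this.congr_deriv ?_
  simp only [sqPhaseDeriv]
  push_cast
  ring

theorem hasDerivAt_sqPhaseDeriv (x s w η : ℝ) :
    HasDerivAt (sqPhaseDeriv x s w) (sqPhaseDeriv2 x s w η) η := by
  have h1 := hasDerivAt_id' η
  have h2 := hasDerivAt_pow 2 η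
  have := (h1.const_mul 2).mul (((h2.mul (h2.sub_const w)).const_mul s).const_add x)
  refine this.congr_deriv ?_
  simp only [sqPhaseDeriv2, Pi.mul_apply]
  push_cast
  ring

theorem continuous_sqPhaseDeriv2 (x s w : ℝ) : Continuous (sqPhaseDeriv2 x s w) := by
  unfold sqPhaseDeriv2
  fun_prop

theorem norm_integral_cexp_sqPhase_middle {x s w c d : ℝ} (hx : 0 < x) (hs : s < 0)
    (hc : 0 < c) (hcd : c ≤ d) (hw : 2 * |w| ≤ c ^ 2)
    (hl : ∀ η ∈ Set.Icc c d, -(x / 2) ≤ s * (η ^ 2 * (η ^ 2 - w)))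
    (hu : ∀ η ∈ Set.Icc c d, s * (η ^ 2 * (η ^ 2 - w)) ≤ 0) :
    ‖∫ η in c..d, Complex.exp (Complex.I * sqPhase x s w η)‖ ≤ 9 / √x := by
  have hsx : 0 < √x := Real.sqrt_pos.2 hx
  have hsxx : √x * √x = x := Real.mul_self_sqrt hx.le
  by_cases hd : d ≤ 1 / √x
  · refine (norm_integral_cexp_le_length hcd).trans ?_
    calc d - c ≤ 1 / √x := by linarith
      _ ≤ 9 / √x := by gcongr; norm_num
  push Not at hd
  set m := max c (1 / √x) with hm
  have hcm : c ≤ m := le_max_left _ _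
  have hmx : 1 / √x ≤ m := le_max_right _ _
  have hmd : m ≤ d := max_le hcd hd.le
  have hm0 : 0 < m := hc.trans_le hcm
  have hE : Continuous fun η => Complex.exp (Complex.I * sqPhase x s w η) := by
    unfold sqPhase
    fun_prop
  rw [← intervalIntegral.integral_add_adjacent_intervals (hE.intervalIntegrable c m)
    (hE.intervalIntegrable m d)]
  have b1 : ‖∫ η in c..m, Complex.exp (Complex.I * sqPhase x s w η)‖ ≤ 1 / √x := by
    refine (norm_integral_cexp_le_length hcm).trans ?_
    rcases max_cases c (1 / √x) with h | h
    · rw [hm, h.1, sub_self]; positivity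
    · rw [hm, h.1]; linarith
  have low : ∀ η ∈ Set.Icc m d, η * x ≤ sqPhaseDeriv x s w η := by
    intro η hη
    have := hl η ⟨hcm.trans hη.1, hη.2⟩
    have hη0 : 0 < η := hm0.trans_le hη.1
    unfold sqPhaseDeriv
    nlinarith
  have up : ∀ η ∈ Set.Icc m d, |sqPhaseDeriv2 x s w η| ≤ 6 * x := by
    intro η hη
    have h1 := hl η ⟨hcm.trans hη.1, hη.2⟩
    have h2 := hu η ⟨hcm.trans hη.1, hη.2⟩
    have hcη : c ^ 2 ≤ η ^ 2 := by gcongr; exact hcm.trans hη.1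
    have hw1 : 2 * w ≤ η ^ 2 := by linarith [le_abs_self w]
    have hw2 : -(η ^ 2) ≤ 2 * w := by linarith [neg_abs_le w]
    have h3 : 3 * (s * (η ^ 2 * (η ^ 2 - w))) ≤ s * (η ^ 2 * (2 * η ^ 2 - w)) := by
      have : s * (η ^ 2 * (η ^ 2 - 2 * w)) ≤ 0 :=
        mul_nonpos_of_nonpos_of_nonneg hs.le (mul_nonneg (sq_nonneg _) (by linarith))
      nlinarith
    have h4 : s * (η ^ 2 * (2 * η ^ 2 - w)) ≤ 0 :=
      mul_nonpos_of_nonpos_of_nonneg hs.le (mul_nonneg (sq_nonneg _) (by linarith))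
    unfold sqPhaseDeriv2
    rw [abs_le]
    constructor <;> linarith
  have pos : ∀ η ∈ Set.Icc m d, 0 < sqPhaseDeriv x s w η := fun η hη =>
    (mul_pos (hm0.trans_le hη.1) hx).trans_le (low η hη)
  have b2 := norm_integral_cexp_le_of_deriv_ne_zero hmd (hasDerivAt_sqPhase x s w)
    (hasDerivAt_sqPhaseDeriv x s w) (continuous_sqPhaseDeriv2 x s w) (fun η hη => (pos η hη).ne')
  have hcont : Continuous (sqPhaseDeriv x s w) := by unfold sqPhaseDeriv; fun_prop
  have b3 : ∫ η in m..d, |sqPhaseDeriv2 x s w η| / sqPhaseDeriv x s w η ^ 2 ≤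
      ∫ η in m..d, 6 / x * (η ^ 2)⁻¹ := by
    apply intervalIntegral.integral_mono_on hmd
    · apply ContinuousOn.intervalIntegrable
      rw [Set.uIcc_of_le hmd]
      refine ContinuousOn.div (continuous_sqPhaseDeriv2 x s w).abs.continuousOn (by fun_prop) ?_
      intro η hη
      exact pow_ne_zero _ (pos η hη).ne'
    · apply ContinuousOn.intervalIntegrable
      rw [Set.uIcc_of_le hmd]
      refine ContinuousOn.mul continuousOn_const (ContinuousOn.inv₀ (by fun_prop) ?_)
      intro η hη
      exact pow_ne_zero _ (hm0.trans_le hη.1).ne'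
    · intro η hη
      have hη0 : 0 < η := hm0.trans_le hη.1
      calc _ ≤ 6 * x / (η * x) ^ 2 := by gcongr; exacts [up η hη, low η hη]
        _ = _ := by field_simp
  have b4 : ∫ η in m..d, 6 / x * (η ^ 2)⁻¹ = 6 / x * (1 / m - 1 / d) := by
    rw [intervalIntegral.integral_const_mul]
    congr 1
    have : ∀ η ∈ Set.uIcc m d, HasDerivAt (fun η : ℝ => -η⁻¹) ((η ^ 2)⁻¹) η := by
      intro η hη
      rw [Set.uIcc_of_le hmd] at hη
      exact (hasDerivAt_inv (hm0.trans_le hη.1).ne').neg.congr_deriv (neg_neg _)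
    rw [intervalIntegral.integral_eq_sub_of_hasDerivAt this]
    · simp only [one_div]; ring
    · apply ContinuousOn.intervalIntegrable
      rw [Set.uIcc_of_le hmd]
      refine ContinuousOn.inv₀ (by fun_prop) ?_
      intro η hη
      exact pow_ne_zero _ (hm0.trans_le hη.1).ne'
  have hd0 : 0 < d := hm0.trans_le hmd
  have key : ∀ y, m ≤ y → 1 / (y * x) ≤ 1 / √x := by
    intro y hy
    have : √x ≤ y * x := by
      have h : 1 / √x ≤ y := hmx.trans hy
      calc √x = 1 / √x * x := by field_simp; rw [sq, hsxx]
        _ ≤ _ := by gcongr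
    gcongr
  have b5 : 1 / |sqPhaseDeriv x s w m| ≤ 1 / √x := by
    rw [abs_of_pos (pos m ⟨le_rfl, hmd⟩)]
    exact (one_div_le_one_div_of_le (by positivity) (low m ⟨le_rfl, hmd⟩)).trans (key m le_rfl)
  have b6 : 1 / |sqPhaseDeriv x s w d| ≤ 1 / √x := by
    rw [abs_of_pos (pos d ⟨hmd, le_rfl⟩)]
    exact (one_div_le_one_div_of_le (by positivity) (low d ⟨hmd, le_rfl⟩)).trans (key d hmd)
  have b7 : 6 / x * (1 / m - 1 / d) ≤ 6 * (1 / √x) := by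
    have : 0 < 1 / d := by positivity
    calc 6 / x * (1 / m - 1 / d) ≤ 6 / x * (1 / m) := by gcongr; linarith
      _ = 6 * (1 / (m * x)) := by field_simp
      _ ≤ _ := by gcongr 6 * ?_; exact key m le_rfl
  calc _ ≤ _ := norm_add_le _ _
    _ ≤ 1 / √x + (1 / √x + 1 / √x + 6 * (1 / √x)) := by linarith
    _ = 9 / √x := by ring

theorem norm_integral_cexp_sqPhase {x s w A B : ℝ} (hx : 0 < x) (hA : 0 < A) (hAB : A ≤ B)
    (hw : 2 * |w| ≤ A ^ 2) :
    ‖∫ η in A..B, Complex.exp (Complex.I * sqPhase x s w η)‖ ≤ 25 / √x := by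
  have hsx : 0 < √x := Real.sqrt_pos.2 hx
  have wl : ∀ η, A ≤ η → 2 * w ≤ η ^ 2 ∧ -(η ^ 2) ≤ 2 * w := by
    intro η hη
    have hcη : A ^ 2 ≤ η ^ 2 := by gcongr
    exact ⟨by linarith [le_abs_self w], by linarith [neg_abs_le w]⟩
  rcases le_or_gt 0 s with hs | hs
  · refine (norm_integral_cexp_le_of_concave_or_convex (ρ := x) hAB (hasDerivAt_sqPhase x s w)
      (hasDerivAt_sqPhaseDeriv x s w) (continuous_sqPhaseDeriv2 x s w) hx (Or.inl ?_)).trans ?_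
    · intro η hη
      obtain ⟨w1, w2⟩ := wl η hη.1
      have h1 : 0 ≤ s * (η ^ 2 * (η ^ 2 - w)) :=
        mul_nonneg hs (mul_nonneg (sq_nonneg _) (by linarith [sq_nonneg η]))
      have h2 : 0 ≤ s * (η ^ 2 * (2 * η ^ 2 - w)) :=
        mul_nonneg hs (mul_nonneg (sq_nonneg _) (by linarith [sq_nonneg η]))
      unfold sqPhaseDeriv2
      linarith
    · gcongr; norm_num
  set r : ℝ → ℝ := fun η => s * (η ^ 2 * (η ^ 2 - w)) with hr
  have hrc : Continuous r := by fun_prop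
  have hanti : AntitoneOn r (Set.Icc A B) := by
    intro y hy z hz hyz
    have hy0 : 0 < y := hA.trans_le hy.1
    have h2 : y ^ 2 ≤ z ^ 2 := by gcongr
    obtain ⟨w1, w2⟩ := wl y hy.1
    apply mul_le_mul_of_nonpos_left _ hs.le
    apply mul_le_mul h2 (by linarith) (by linarith [sq_nonneg y]) (by positivity)
  have hE : Continuous fun η => Complex.exp (Complex.I * sqPhase x s w η) := by
    unfold sqPhase
    fun_prop
  obtain ⟨e, he, he1, he2⟩ := exists_split_of_antitoneOn (-(x / 14)) hAB hanti hrc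
  obtain ⟨f, hf, hf1, hf2⟩ := exists_split_of_antitoneOn (-(x / 2)) he.2
    (hanti.mono (Set.Icc_subset_Icc_left he.1)) hrc
  have rel : ∀ η, A ≤ η → 3 * r η ≤ s * (η ^ 2 * (2 * η ^ 2 - w)) ∧
      s * (η ^ 2 * (2 * η ^ 2 - w)) ≤ 5 / 3 * r η := by
    intro η hη
    obtain ⟨w1, w2⟩ := wl η hη
    have h1 : s * (η ^ 2 * (η ^ 2 - 2 * w)) ≤ 0 :=
        mul_nonpos_of_nonpos_of_nonneg hs.le (mul_nonneg (sq_nonneg _) (by linarith))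
    have h2 : s * (η ^ 2 * (η ^ 2 + 2 * w)) ≤ 0 :=
        mul_nonpos_of_nonpos_of_nonneg hs.le (mul_nonneg (sq_nonneg _) (by linarith))
    simp only [hr]
    constructor <;> nlinarith
  have b1 : ‖∫ η in A..e, Complex.exp (Complex.I * sqPhase x s w η)‖ ≤ 8 / √x := by
    rcases he1 with h | h
    · rw [h, intervalIntegral.integral_same, norm_zero]; positivity
    refine norm_integral_cexp_le_of_concave_or_convex he.1 (hasDerivAt_sqPhase x s w)
      (hasDerivAt_sqPhaseDeriv x s w) (continuous_sqPhaseDeriv2 x s w) hx (Or.inl ?_)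
    intro η hη
    obtain ⟨r1, r2⟩ := rel η hη.1
    have := h η hη
    change x ≤ 2 * (x + r η) + 4 * (s * (η ^ 2 * (2 * η ^ 2 - w)))
    linarith
  have b3 : ‖∫ η in f..B, Complex.exp (Complex.I * sqPhase x s w η)‖ ≤ 8 / √x := by
    rcases hf2 with h | h
    · rw [h, intervalIntegral.integral_same, norm_zero]; positivity
    refine norm_integral_cexp_le_of_concave_or_convex hf.2 (hasDerivAt_sqPhase x s w)
      (hasDerivAt_sqPhaseDeriv x s w) (continuous_sqPhaseDeriv2 x s w) hx (Or.inr ?_)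
    intro η hη
    obtain ⟨r1, r2⟩ := rel η (he.1.trans (hf.1.trans hη.1))
    have := h η hη
    change 2 * (x + r η) + 4 * (s * (η ^ 2 * (2 * η ^ 2 - w))) ≤ -x
    linarith
  have b2 : ‖∫ η in e..f, Complex.exp (Complex.I * sqPhase x s w η)‖ ≤ 9 / √x := by
    rcases hf1 with h | h
    · rw [h, intervalIntegral.integral_same, norm_zero]; positivity
    rcases he2 with h' | h'
    · have : e = f := le_antisymm hf.1 (h' ▸ hf.2)
      rw [this, intervalIntegral.integral_same, norm_zero]; positivity
    refine norm_integral_cexp_sqPhase_middle hx hs (hA.trans_le he.1) hf.1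
      (hw.trans (by gcongr; exact he.1)) h fun η hη => ?_
    have := h' η ⟨hη.1, hη.2.trans hf.2⟩
    exact this.trans (by linarith)
  rw [← intervalIntegral.integral_add_adjacent_intervals (hE.intervalIntegrable A e)
    (hE.intervalIntegrable e B), ← intervalIntegral.integral_add_adjacent_intervals
    (hE.intervalIntegrable e f) (hE.intervalIntegrable f B)]
  calc _ ≤ _ := (norm_add_le _ _).trans (add_le_add_right (norm_add_le _ _) _)
    _ ≤ 8 / √x + 9 / √x + 8 / √x := by linarith
    _ = 25 / √x := by ring

theorem one_le_aconst (ν μ : ℝ) : 1 ≤ aconst ν μ := by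
  unfold aconst
  have := le_max_left 1 |2 * ν / (3 * μ)|
  linarith

theorem aconst_pos (ν μ : ℝ) : 0 < aconst ν μ := one_pos.trans_le (one_le_aconst ν μ)

theorem two_mul_abs_le_aconst (ν μ : ℝ) : 2 * |2 * ν / (3 * μ)| ≤ aconst ν μ := by
  unfold aconst
  have := le_max_right 1 |2 * ν / (3 * μ)|
  linarith

theorem phase_neg (ν μ ξ : ℝ) : phase ν μ (-ξ) = -phase ν μ ξ := by
  unfold phase
  rw [abs_neg]
  ring

theorem continuous_phase (ν μ : ℝ) : Continuous (phase ν μ) := by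
  unfold phase
  fun_prop

/-- Half of the kernel of `T T*` for the maximal function estimate. -/
def halfKernel (ν μ N x t : ℝ) : ℂ :=
  ∫ ξ in Set.Icc (aconst ν μ) N, ((|ξ| ^ (-(1 / 2) : ℝ) : ℝ) : ℂ) *
    Complex.exp (Complex.I * ((x * ξ + phase ν μ ξ * t : ℝ) : ℂ))

theorem halfKernel_neg (ν μ N x t : ℝ) :
    halfKernel ν μ N (-x) (-t) = starRingEnd ℂ (halfKernel ν μ N x t) := by
  unfold halfKernel
  rw [← integral_conj]
  congr 1 with ξ
  rw [map_mul, ← Complex.exp_conj, map_mul, Complex.conj_I, Complex.conj_ofReal,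
    Complex.conj_ofReal]
  congr 2
  push_cast
  ring

theorem norm_halfKernel_le_of_pos {ν μ : ℝ} (hμ : μ ≠ 0) (N : ℝ) {x : ℝ} (t : ℝ) (hx : 0 < x) :
    ‖halfKernel ν μ N x t‖ ≤ 50 / √x := by
  have ha := aconst_pos ν μ
  set a := aconst ν μ with ha'
  rcases lt_or_ge N a with hN | hN
  · unfold halfKernel
    rw [Set.Icc_eq_empty (not_le.2 hN)]
    simp only [Measure.restrict_empty, integral_zero_measure, norm_zero]
    positivity
  have hsa : 0 < √a := Real.sqrt_pos.2 ha
  have hss : √a ≤ √N := Real.sqrt_le_sqrt hN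
  set g : ℝ → ℂ := fun ξ => ((|ξ| ^ (-(1 / 2) : ℝ) : ℝ) : ℂ) *
    Complex.exp (Complex.I * ((x * ξ + phase ν μ ξ * t : ℝ) : ℂ)) with hg
  have hgc : ContinuousOn g (Set.Ioi 0) := by
    have := continuous_phase ν μ
    apply ContinuousOn.mul
    · apply Complex.continuous_ofReal.comp_continuousOn
      apply ContinuousOn.rpow_const (by fun_prop)
      intro ξ hξ
      left
      exact abs_ne_zero.2 (ne_of_gt hξ)
    · fun_prop
  have e := intervalIntegral.integral_deriv_smul_comp' (a := √a) (b := √N)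
    (f := fun η : ℝ => η ^ 2) (f' := fun η => 2 * η) (g := g)
    (fun η _ => by simpa using hasDerivAt_pow 2 η) (by fun_prop) (hgc.mono (by
      rintro _ ⟨η, hη, rfl⟩
      rw [Set.uIcc_of_le hss] at hη
      have : 0 < η := hsa.trans_le hη.1
      exact pow_pos this 2))
  rw [Real.sq_sqrt ha.le, Real.sq_sqrt (ha.le.trans hN)] at e
  have e2 : halfKernel ν μ N x t = ∫ ξ in a..N, g ξ := by
    rw [intervalIntegral.integral_of_le hN, ← integral_Icc_eq_integral_Ioc]
    rfl
  have e3 : ∫ η in √a..√N, (2 * η) • (g ∘ fun η => η ^ 2) η =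
      ∫ η in √a..√N, 2 * Complex.exp (Complex.I * sqPhase x (3 * μ * t) (2 * ν / (3 * μ)) η) := by
    apply intervalIntegral.integral_congr
    intro η hη
    rw [Set.uIcc_of_le hss] at hη
    have h0 : 0 < η := hsa.trans_le hη.1
    have e4 : |η ^ 2| ^ (-(1 / 2) : ℝ) = η⁻¹ := by
      rw [abs_of_pos (by positivity), ← Real.rpow_natCast, ← Real.rpow_mul h0.le]
      norm_num
      exact Real.rpow_neg_one η
    have e5 : x * η ^ 2 + phase ν μ (η ^ 2) * t =
        sqPhase x (3 * μ * t) (2 * ν / (3 * μ)) η := by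
      unfold phase sqPhase
      rw [abs_of_pos (by positivity)]
      field_simp
    simp only [hg, Function.comp, e4, e5]
    rw [Complex.real_smul]
    push_cast
    have : (η : ℂ) ≠ 0 := Complex.ofReal_ne_zero.2 h0.ne'
    field_simp
  rw [e2, ← e, e3, intervalIntegral.integral_const_mul, norm_mul]
  have := norm_integral_cexp_sqPhase (s := 3 * μ * t) (w := 2 * ν / (3 * μ)) hx hsa hss
    (by rw [Real.sq_sqrt ha.le]; exact two_mul_abs_le_aconst ν μ)
  calc _ ≤ 2 * (25 / √x) := by gcongr; simp
    _ = _ := by ring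

theorem norm_halfKernel_le {ν μ : ℝ} (hμ : μ ≠ 0) (N : ℝ) {x : ℝ} (t : ℝ) (hx : x ≠ 0) :
    ‖halfKernel ν μ N x t‖ ≤ 50 / √|x| := by
  rcases hx.lt_or_gt with h | h
  · have := norm_halfKernel_le_of_pos hμ N (-t) (ν := ν) (neg_pos.2 h)
    rwa [halfKernel_neg, Complex.norm_conj, ← abs_of_neg h] at this
  · have := norm_halfKernel_le_of_pos hμ N t (ν := ν) h
    rwa [abs_of_pos h]

/-- The frequency window `a ≤ |ξ| ≤ N`. -/
def freqWindow (ν μ N : ℝ) : Set ℝ := {ξ | aconst ν μ ≤ |ξ| ∧ |ξ| ≤ N}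

theorem freqWindow_eq (ν μ N : ℝ) :
    freqWindow ν μ N = Set.Icc (aconst ν μ) N ∪ Set.Icc (-N) (-aconst ν μ) := by
  have ha := aconst_pos ν μ
  ext ξ
  simp only [freqWindow, Set.mem_ofPred_eq, Set.mem_union, Set.mem_Icc]
  constructor
  · rintro ⟨h1, h2⟩
    rcases abs_cases ξ with h | h
    · left; constructor <;> linarith
    · right; constructor <;> linarith
  · rintro (⟨h1, h2⟩ | ⟨h1, h2⟩)
    · rw [abs_of_pos (by linarith)]; exact ⟨h1, h2⟩
    · rw [abs_of_neg (by linarith)]; constructor <;> linarith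

theorem measurableSet_freqWindow (ν μ N : ℝ) : MeasurableSet (freqWindow ν μ N) := by
  rw [freqWindow_eq]
  exact measurableSet_Icc.union measurableSet_Icc

/-- The dispersive kernel bound behind the maximal function estimate. -/
theorem norm_kernel_le {ν μ : ℝ} (hμ : μ ≠ 0) (N : ℝ) {x : ℝ} (t : ℝ) (hx : x ≠ 0) :
    ‖∫ ξ in freqWindow ν μ N, ((|ξ| ^ (-(1 / 2) : ℝ) : ℝ) : ℂ) *
      Complex.exp (Complex.I * ((x * ξ + phase ν μ ξ * t : ℝ) : ℂ))‖ ≤ 100 / √|x| := by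
  have ha := aconst_pos ν μ
  set g : ℝ → ℂ := fun ξ => ((|ξ| ^ (-(1 / 2) : ℝ) : ℝ) : ℂ) *
    Complex.exp (Complex.I * ((x * ξ + phase ν μ ξ * t : ℝ) : ℂ)) with hg
  have hgc : ∀ s : Set ℝ, IsCompact s → (∀ ξ ∈ s, ξ ≠ 0) → IntegrableOn g s := by
    intro s hs h0
    apply ContinuousOn.integrableOn_compact hs
    have := continuous_phase ν μ
    apply ContinuousOn.mul
    · apply Complex.continuous_ofReal.comp_continuousOn
      apply ContinuousOn.rpow_const (by fun_prop)
      intro ξ hξ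
      left
      exact abs_ne_zero.2 (h0 ξ hξ)
    · fun_prop
  rw [freqWindow_eq, setIntegral_union ?_ measurableSet_Icc
    (hgc _ isCompact_Icc fun ξ hξ => (ha.trans_le hξ.1).ne')
    (hgc _ isCompact_Icc fun ξ hξ => (by linarith [hξ.2] : ξ < 0).ne)]
  · have e : ∫ ξ in Set.Icc (-N) (-aconst ν μ), g ξ = halfKernel ν μ N (-x) (-t) := by
      unfold halfKernel
      have h1 : Set.Icc (-N) (-aconst ν μ) = Neg.neg ⁻¹' Set.Icc (aconst ν μ) N := by
        ext ξ
        simp only [Set.mem_Icc, Set.mem_preimage]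
        constructor <;> rintro ⟨h1, h2⟩ <;> constructor <;> linarith
      have h2 := (Measure.measurePreserving_neg (volume : Measure ℝ)).setIntegral_preimage_emb
        (MeasurableEquiv.neg ℝ).measurableEmbedding (fun ξ : ℝ => ((|ξ| ^ (-(1 / 2) : ℝ) : ℝ) : ℂ) *
          Complex.exp (Complex.I * ((-x * ξ + phase ν μ ξ * -t : ℝ) : ℂ)))
        (Set.Icc (aconst ν μ) N)
      rw [h1, ← h2]
      congr 1 with ξ
      simp only [hg, abs_neg, phase_neg]
      congr 4
      ring
    rw [e]
    refine (norm_add_le _ _).trans ?_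
    have h1 : ‖∫ ξ in Set.Icc (aconst ν μ) N, g ξ‖ ≤ 50 / √|x| := norm_halfKernel_le hμ N t hx
    have h2 := norm_halfKernel_le (ν := ν) hμ N (-t) (neg_ne_zero.2 hx)
    rw [abs_neg] at h2
    calc _ ≤ 50 / √|x| + 50 / √|x| := add_le_add h1 h2
      _ = _ := by ring
  · rw [Set.disjoint_left]
    rintro ξ ⟨h1, h2⟩ ⟨h3, h4⟩
    linarith

theorem lintegral_comp_abs_eq (g : ℝ → ℝ≥0∞) :
    ∫⁻ u, g |u| = 2 * ∫⁻ u in Set.Ioi 0, g u := by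
  have h1 : ∫⁻ u in Set.Ioi 0, g |u| = ∫⁻ u in Set.Ioi (0 : ℝ), g u :=
    setLIntegral_congr_fun measurableSet_Ioi fun u hu => by rw [abs_of_pos hu]
  have h2 : ∫⁻ u in Set.Iio 0, g |u| = ∫⁻ u in Set.Ioi (0 : ℝ), g u := by
    have h3 : Set.Iio (0 : ℝ) = Neg.neg ⁻¹' Set.Ioi 0 := by
      ext u; simp
    have := (Measure.measurePreserving_neg (volume : Measure ℝ)).setLIntegral_comp_preimage_emb
      (MeasurableEquiv.neg ℝ).measurableEmbedding (fun u => g |u|) (Set.Ioi 0)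
    rw [h3, ← h1, ← this]
    simp
  rw [← lintegral_add_compl _ (measurableSet_Ioi (a := (0 : ℝ))), Set.compl_Ioi,
    setLIntegral_congr Iio_ae_eq_Iic.symm, h1, h2, two_mul]

theorem lintegral_rpow_near {r : ℝ} (hr : 0 < r) :
    ∫⁻ u, (Set.Iio r).indicator (fun v => ENNReal.ofReal (v ^ (-(1 / 2) : ℝ))) |u| =
      ENNReal.ofReal (4 * √r) := by
  rw [lintegral_comp_abs_eq, lintegral_indicator measurableSet_Iio,
    Measure.restrict_restrict measurableSet_Iio, Set.inter_comm, Set.Ioi_inter_Iio,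
    setLIntegral_congr Ioo_ae_eq_Ioc]
  have hi : IntervalIntegrable (fun v : ℝ => v ^ (-(1 / 2) : ℝ)) volume 0 r :=
    intervalIntegral.intervalIntegrable_rpow' (by norm_num)
  rw [← ofReal_integral_eq_lintegral_ofReal, ← intervalIntegral.integral_of_le hr.le,
    integral_rpow (by left; norm_num)]
  · rw [← ENNReal.ofReal_ofNat, ← ENNReal.ofReal_mul (by norm_num), Real.sqrt_eq_rpow]
    congr 1
    norm_num
    ring
  · exact (intervalIntegrable_iff_integrableOn_Ioc_of_le hr.le).1 hi
  · filter_upwards [ae_restrict_mem measurableSet_Ioc] with v hv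
    exact Real.rpow_nonneg hv.1.le _

theorem lintegral_rpow_far {r : ℝ} (hr : 0 < r) :
    ∫⁻ u, (Set.Ici r).indicator (fun v => ENNReal.ofReal (v ^ (-2 : ℝ))) |u| =
      ENNReal.ofReal (2 / r) := by
  rw [lintegral_comp_abs_eq, lintegral_indicator measurableSet_Ici,
    Measure.restrict_restrict measurableSet_Ici, Set.inter_eq_left.2
      (show Set.Ici r ⊆ Set.Ioi (0 : ℝ) from fun u hu => lt_of_lt_of_le hr hu),
    setLIntegral_congr Ioi_ae_eq_Ici.symm]
  rw [← ofReal_integral_eq_lintegral_ofReal, integral_Ioi_rpow_of_lt (by norm_num) hr]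
  · rw [← ENNReal.ofReal_ofNat, ← ENNReal.ofReal_mul (by norm_num)]
    congr 1
    norm_num
    rw [Real.rpow_neg_one]
    ring
  · exact integrableOn_Ioi_rpow_of_lt (by norm_num) hr
  · filter_upwards [ae_restrict_mem measurableSet_Ioi] with v hv
    exact Real.rpow_nonneg (hr.trans hv).le _

/-- The kernel `|u|^{-1/2}` with values in `ℝ≥0∞`. -/
def sqrtKernel (u : ℝ) : ℝ≥0∞ := ENNReal.ofReal (|u| ^ (-(1 / 2) : ℝ))

theorem measurable_sqrtKernel : Measurable sqrtKernel := by
  unfold sqrtKernel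
  fun_prop

theorem lintegral_sqrtKernel_truncated_le {n : ℝ → ℝ≥0∞} (hn : Measurable n)
    (hn1 : ∫⁻ x, n x ≤ 1) {m : ℝ} (hm : 0 < m) (y : ℝ) :
    ∫⁻ x, {x | n x ≤ ENNReal.ofReal m}.indicator (fun x => n x ^ (3 / 4 : ℝ)) x *
      sqrtKernel (x - y) ≤ ENNReal.ofReal (6 * m ^ (1 / 4 : ℝ)) := by
  set r := 1 / m with hr
  have hr0 : 0 < r := by positivity
  set f : ℝ → ℝ≥0∞ := {x | n x ≤ ENNReal.ofReal m}.indicator (fun x => n x ^ (3 / 4 : ℝ)) with hf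
  have hfm : ∀ x, f x ≤ ENNReal.ofReal (m ^ (3 / 4 : ℝ)) := by
    intro x
    apply Set.indicator_apply_le'
    · intro h
      rw [← ENNReal.ofReal_rpow_of_pos hm]
      exact ENNReal.rpow_le_rpow h (by norm_num)
    · intro _; exact zero_le
  have hfn : ∀ x, f x ^ (4 / 3 : ℝ) ≤ n x := by
    intro x
    by_cases h : n x ≤ ENNReal.ofReal m
    · have : f x = n x ^ (3 / 4 : ℝ) := Set.indicator_of_mem (s := {x | n x ≤ ENNReal.ofReal m}) h _
      rw [this, ← ENNReal.rpow_mul]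
      norm_num
    · have : f x = 0 := Set.indicator_of_notMem (s := {x | n x ≤ ENNReal.ofReal m}) h _
      rw [this, ENNReal.zero_rpow_of_pos (by norm_num)]
      exact zero_le
  have hfmeas : Measurable f := by
    apply Measurable.indicator (by fun_prop)
    exact measurableSet_le hn measurable_const
  set k1 : ℝ → ℝ≥0∞ := (Set.Iio r).indicator (fun v => ENNReal.ofReal (v ^ (-(1 / 2) : ℝ))) with hk1
  set k2 : ℝ → ℝ≥0∞ := (Set.Ici r).indicator (fun v => ENNReal.ofReal (v ^ (-(1 / 2) : ℝ))) with hk2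
  have hk1m : Measurable k1 := Measurable.indicator (by fun_prop) measurableSet_Iio
  have hk2m : Measurable k2 := Measurable.indicator (by fun_prop) measurableSet_Ici
  have hk : ∀ u, sqrtKernel u = k1 |u| + k2 |u| := by
    intro u
    simp only [hk1, hk2, sqrtKernel, Set.indicator_apply, Set.mem_Iio, Set.mem_Ici]
    by_cases h : |u| < r
    · simp [h, not_le.2 h]
    · simp [h, not_lt.1 h]
  have near : ∫⁻ x, f x * k1 |x - y| ≤ ENNReal.ofReal (4 * m ^ (1 / 4 : ℝ)) := by
    calc ∫⁻ x, f x * k1 |x - y| ≤ ∫⁻ x, ENNReal.ofReal (m ^ (3 / 4 : ℝ)) * k1 |x - y| := by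
          gcongr with x; exact hfm x
      _ = ENNReal.ofReal (m ^ (3 / 4 : ℝ)) * ENNReal.ofReal (4 * √r) := by
          rw [lintegral_const_mul _ (by fun_prop), lintegral_sub_right_eq_self (fun u => k1 |u|) y,
            hk1, lintegral_rpow_near hr0]
      _ = ENNReal.ofReal (4 * m ^ (1 / 4 : ℝ)) := by
          rw [← ENNReal.ofReal_mul (by positivity)]
          congr 1
          rw [hr, Real.sqrt_eq_rpow, one_div, Real.inv_rpow hm.le, ← Real.rpow_neg hm.le,
            mul_left_comm, ← Real.rpow_add hm]
          norm_num
  have far : ∫⁻ x, f x * k2 |x - y| ≤ ENNReal.ofReal (2 * m ^ (1 / 4 : ℝ)) := by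
    have hpq : (4 / 3 : ℝ).HolderConjugate 4 := by
      rw [Real.holderConjugate_iff]; norm_num
    have h := ENNReal.lintegral_mul_le_Lp_mul_Lq volume hpq (f := f)
      (g := fun x => k2 |x - y|) hfmeas.aemeasurable (by fun_prop)
    have e : ∀ u, k2 u ^ (4 : ℝ) =
        (Set.Ici r).indicator (fun v => ENNReal.ofReal (v ^ (-2 : ℝ))) u := by
      intro u
      simp only [hk2, Set.indicator_apply, Set.mem_Ici]
      split_ifs with h
      · have h0 : 0 < u := hr0.trans_le h
        rw [ENNReal.ofReal_rpow_of_pos (by positivity), ← Real.rpow_mul h0.le]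
        norm_num
      · rw [ENNReal.zero_rpow_of_pos (by norm_num)]
    refine h.trans ?_
    simp only [e]
    rw [lintegral_sub_right_eq_self (fun u => (Set.Ici r).indicator
      (fun v => ENNReal.ofReal (v ^ (-2 : ℝ))) |u|) y, lintegral_rpow_far hr0]
    have h1 : (∫⁻ x, f x ^ (4 / 3 : ℝ)) ^ (1 / (4 / 3) : ℝ) ≤ 1 := by
      apply ENNReal.rpow_le_one _ (by norm_num)
      exact (lintegral_mono hfn).trans hn1
    have h2 : ENNReal.ofReal (2 / r) ^ (1 / 4 : ℝ) ≤ ENNReal.ofReal (2 * m ^ (1 / 4 : ℝ)) := by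
      rw [ENNReal.ofReal_rpow_of_pos (by positivity)]
      apply ENNReal.ofReal_le_ofReal
      rw [hr, div_div_eq_mul_div, div_one, Real.mul_rpow (by norm_num) hm.le]
      gcongr
      calc (2 : ℝ) ^ (1 / 4 : ℝ) ≤ 2 ^ (1 : ℝ) :=
            Real.rpow_le_rpow_of_exponent_le (by norm_num) (by norm_num)
        _ = 2 := by norm_num
    calc _ ≤ 1 * ENNReal.ofReal (2 * m ^ (1 / 4 : ℝ)) := by gcongr
      _ = _ := one_mul _
  calc ∫⁻ x, f x * sqrtKernel (x - y) = ∫⁻ x, (f x * k1 |x - y| + f x * k2 |x - y|) := by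
        simp only [hk, mul_add]
    _ = (∫⁻ x, f x * k1 |x - y|) + ∫⁻ x, f x * k2 |x - y| :=
        lintegral_add_left (by fun_prop) _
    _ ≤ ENNReal.ofReal (4 * m ^ (1 / 4 : ℝ)) + ENNReal.ofReal (2 * m ^ (1 / 4 : ℝ)) :=
        add_le_add near far
    _ = _ := by
        rw [← ENNReal.ofReal_add (by positivity) (by positivity)]
        congr 1
        ring

/-- The diagonal Hardy–Littlewood–Sobolev inequality `L^{4/3} → L^4` for `|x|^{-1/2}`. -/
theorem lintegral_lintegral_sqrtKernel_le {n : ℝ → ℝ≥0∞} (hn : Measurable n)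
    (hn1 : ∫⁻ x, n x ≤ 1) (hfin : ∀ x, n x ≠ ∞) :
    ∫⁻ y, ∫⁻ x, n x ^ (3 / 4 : ℝ) * n y ^ (3 / 4 : ℝ) * sqrtKernel (x - y) ≤ 12 := by
  have hk := measurable_sqrtKernel
  set A : ℝ → ℝ → ℝ≥0∞ := fun y x =>
    {x | n x ≤ n y}.indicator (fun x => n x ^ (3 / 4 : ℝ)) x * sqrtKernel (x - y) with hA
  have hAm : Measurable (Function.uncurry A) := by
    have h1 : Measurable (fun p : ℝ × ℝ => {p : ℝ × ℝ | n p.2 ≤ n p.1}.indicator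
        (fun p => n p.2 ^ (3 / 4 : ℝ)) p) := by
      apply Measurable.indicator (by fun_prop)
      exact measurableSet_le (by fun_prop) (by fun_prop)
    exact h1.mul (by fun_prop)
  have inner : ∀ y, n y ^ (3 / 4 : ℝ) * ∫⁻ x, A y x ≤ 6 * n y := by
    intro y
    rcases eq_or_ne (n y) 0 with h0 | h0
    · rw [h0, ENNReal.zero_rpow_of_pos (by norm_num)]; simp
    have hm : 0 < (n y).toReal := ENNReal.toReal_pos h0 (hfin y)
    have e : ENNReal.ofReal (n y).toReal = n y := ENNReal.ofReal_toReal (hfin y)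
    have := lintegral_sqrtKernel_truncated_le hn hn1 hm y
    rw [e] at this
    calc _ ≤ n y ^ (3 / 4 : ℝ) * ENNReal.ofReal (6 * (n y).toReal ^ (1 / 4 : ℝ)) := by gcongr
      _ = 6 * (n y ^ (3 / 4 : ℝ) * n y ^ (1 / 4 : ℝ)) := by
        rw [ENNReal.ofReal_mul (by norm_num), ← ENNReal.ofReal_rpow_of_pos hm, e]
        rw [ENNReal.ofReal_ofNat]
        ring
      _ = 6 * n y := by
        rw [← ENNReal.rpow_add _ _ h0 (hfin y)]
        norm_num
  have tot : ∫⁻ y, n y ^ (3 / 4 : ℝ) * ∫⁻ x, A y x ≤ 6 := by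
    calc _ ≤ ∫⁻ y, 6 * n y := lintegral_mono inner
      _ = 6 * ∫⁻ y, n y := lintegral_const_mul _ hn
      _ ≤ 6 * 1 := by gcongr
      _ = 6 := mul_one _
  have hpt : ∀ y x, n x ^ (3 / 4 : ℝ) * n y ^ (3 / 4 : ℝ) * sqrtKernel (x - y) ≤
      n y ^ (3 / 4 : ℝ) * A y x + n x ^ (3 / 4 : ℝ) * A x y := by
    intro y x
    have hs : sqrtKernel (y - x) = sqrtKernel (x - y) := by
      unfold sqrtKernel; rw [abs_sub_comm]
    simp only [hA, Set.indicator_apply, Set.mem_ofPred_eq, hs]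
    rcases le_total (n x) (n y) with h | h
    · rw [if_pos h]
      refine le_trans (le_of_eq ?_) le_self_add
      ring
    · rw [if_pos h]
      refine le_trans (le_of_eq ?_) le_add_self
      ring
  have hm1 : Measurable fun p : ℝ × ℝ => n p.1 ^ (3 / 4 : ℝ) * A p.1 p.2 :=
    Measurable.mul (by fun_prop) hAm
  have hm2 : Measurable fun p : ℝ × ℝ => n p.2 ^ (3 / 4 : ℝ) * A p.2 p.1 :=
    hm1.comp measurable_swap
  have e1 : ∫⁻ y, ∫⁻ x, n y ^ (3 / 4 : ℝ) * A y x = ∫⁻ y, n y ^ (3 / 4 : ℝ) * ∫⁻ x, A y x := by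
    congr 1 with y
    exact lintegral_const_mul _ (hAm.comp measurable_prodMk_left)
  calc _ ≤ ∫⁻ y, ∫⁻ x, (n y ^ (3 / 4 : ℝ) * A y x + n x ^ (3 / 4 : ℝ) * A x y) := by
        gcongr with y x; exact hpt y x
    _ = (∫⁻ y, ∫⁻ x, n y ^ (3 / 4 : ℝ) * A y x) + ∫⁻ y, ∫⁻ x, n x ^ (3 / 4 : ℝ) * A x y := by
        rw [← lintegral_add_left hm1.lintegral_prod_right']
        congr 1 with y
        exact lintegral_add_left (hm1.comp measurable_prodMk_left) _
    _ ≤ 6 + 6 := by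
        apply add_le_add
        · rw [e1]; exact tot
        · rw [lintegral_lintegral_swap hm2.aemeasurable, e1]; exact tot
    _ = 12 := by norm_num

/-- The `TT*` inequality for a kernel bounded by one over a finite measure. -/
theorem lintegral_enorm_sq_integral_mul_le {X Ξ : Type*} [MeasurableSpace X]
    [MeasurableSpace Ξ] {m : Measure X} [SFinite m] (ρ : Measure Ξ) [IsFiniteMeasure ρ]
    {h : X → ℂ} (hm : Measurable h) (hh : Integrable h m) {E : X × Ξ → ℂ}
    (hE : Measurable E) (hE1 : ∀ z, ‖E z‖ ≤ 1) :
    ∫⁻ ξ, ‖∫ x, h x * E (x, ξ) ∂m‖ₑ ^ 2 ∂ρ ≤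
      ∫⁻ x, ∫⁻ y, ‖h x‖ₑ * ‖h y‖ₑ *
        ‖∫ ξ, E (x, ξ) * (starRingEnd ℂ) (E (y, ξ)) ∂ρ‖ₑ ∂m ∂m := by
  set G : X × X → Ξ → ℂ := fun z ξ => (h z.1 * E (z.1, ξ)) *
    (starRingEnd ℂ) (h z.2 * E (z.2, ξ)) with hG
  have hcm : Measurable (starRingEnd ℂ) := Complex.continuous_conj.measurable
  have hGm : Measurable (Function.uncurry G) := by
    have h1 : Measurable fun z : (X × X) × Ξ => h z.1.1 * E (z.1.1, z.2) := by fun_prop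
    have h2 : Measurable fun z : (X × X) × Ξ => h z.1.2 * E (z.1.2, z.2) := by fun_prop
    exact h1.mul (hcm.comp h2)
  have hGb : ∀ z ξ, ‖G z ξ‖ ≤ ‖h z.1‖ * ‖h z.2‖ := by
    intro z ξ
    simp only [hG, norm_mul, RCLike.norm_conj]
    have e1 := hE1 (z.1, ξ)
    have e2 := hE1 (z.2, ξ)
    calc _ ≤ ‖h z.1‖ * 1 * (‖h z.2‖ * 1) := by gcongr
      _ = _ := by ring
  have hGi : Integrable (Function.uncurry G) ((m.prod m).prod ρ) := by
    have hi : Integrable (fun z : (X × X) × Ξ => ‖h z.1.1‖ * ‖h z.1.2‖ * 1)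
        ((m.prod m).prod ρ) :=
      (hh.norm.mul_prod hh.norm).mul_prod (integrable_const (1:ℝ))
    refine hi.mono' hGm.aestronglyMeasurable (ae_of_all _ fun z => ?_)
    rw [mul_one]; exact hGb z.1 z.2
  have hpt : ∀ ξ, ((‖∫ x, h x * E (x, ξ) ∂m‖ ^ 2 : ℝ) : ℂ) = ∫ z, G z ξ ∂(m.prod m) := by
    intro ξ
    rw [hG]
    simp only
    rw [integral_prod_mul (fun x => h x * E (x, ξ))
      (fun x => (starRingEnd ℂ) (h x * E (x, ξ))), integral_conj, Complex.mul_conj,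
      Complex.normSq_eq_norm_sq]
  have hswap : ∫ ξ, ∫ z, G z ξ ∂(m.prod m) ∂ρ =
      ∫ z, ∫ ξ, G z ξ ∂ρ ∂(m.prod m) := (integral_integral_swap hGi).symm
  have hint : Integrable (fun ξ => ∫ z, G z ξ ∂(m.prod m)) ρ := hGi.integral_prod_right
  have hint' : Integrable (fun ξ => ‖∫ x, h x * E (x, ξ) ∂m‖ ^ 2) ρ := by
    have := hint.re
    refine this.congr (ae_of_all _ fun ξ => ?_)
    simp only [← hpt]
    simp only [RCLike.re_to_complex, Complex.ofReal_re]
  have hl : ∫⁻ ξ, ‖∫ x, h x * E (x, ξ) ∂m‖ₑ ^ 2 ∂ρ =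
      ‖∫ ξ, ∫ z, G z ξ ∂(m.prod m) ∂ρ‖ₑ := by
    simp only [← hpt]
    rw [integral_complex_ofReal, ← ofReal_norm, Complex.norm_real, Real.norm_of_nonneg
      (integral_nonneg fun _ => by positivity), ofReal_integral_eq_lintegral_ofReal hint'
      (ae_of_all _ fun _ => by positivity)]
    refine lintegral_congr fun ξ => ?_
    rw [ENNReal.ofReal_pow (norm_nonneg _), ofReal_norm]
  have hin : ∀ z : X × X, ‖∫ ξ, G z ξ ∂ρ‖ₑ = ‖h z.1‖ₑ * ‖h z.2‖ₑ *
        ‖∫ ξ, E (z.1, ξ) * (starRingEnd ℂ) (E (z.2, ξ)) ∂ρ‖ₑ := by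
    intro z
    have : ∀ ξ, G z ξ = (h z.1 * (starRingEnd ℂ) (h z.2)) *
        (E (z.1, ξ) * (starRingEnd ℂ) (E (z.2, ξ))) := by
      intro ξ; simp only [hG, map_mul]; ring
    simp only [this]
    rw [integral_const_mul]
    rw [enorm_mul, enorm_mul, RCLike.enorm_conj]
  rw [hl, hswap]
  refine (enorm_integral_le_lintegral_enorm _).trans ?_
  simp only [hin]
  refine (lintegral_prod _ ?_).le
  have : AEStronglyMeasurable (fun z => ∫ ξ, G z ξ ∂ρ) (m.prod m) :=
    hGi.integral_prod_left.aestronglyMeasurable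
  refine this.enorm.congr (ae_of_all _ fun z => hin z)

theorem lintegral_schur_sub_le {g : ℝ → ℝ≥0∞} (hg : Measurable g) {K : ℝ → ℝ≥0∞}
    (hK : Measurable K) {A : ℝ≥0∞} (hA : ∫⁻ u, K u ≤ A) (hsymm : ∀ u, K (-u) = K u) :
    ∫⁻ x, ∫⁻ y, g x * g y * K (x - y) ≤ A * ∫⁻ x, g x ^ 2 := by
  have hamgm : ∀ a b : ℝ≥0∞, a * b ≤ 2⁻¹ * (a ^ 2 + b ^ 2) := by
    intro a b
    induction a with
    | top => simp
    | coe a =>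
      induction b with
      | top => simp
      | coe b =>
        have : (a * b : ℝ≥0) ≤ 2⁻¹ * (a ^ 2 + b ^ 2) := by
          rw [← NNReal.coe_le_coe]; push_cast
          nlinarith [sq_nonneg ((a:ℝ) - b)]
        have h2 := ENNReal.coe_le_coe.2 this
        push_cast at h2
        simpa using h2
  have h1 : ∫⁻ x, ∫⁻ y, g x ^ 2 * K (x - y) ≤ A * ∫⁻ x, g x ^ 2 := by
    rw [← lintegral_const_mul _ (by fun_prop)]
    refine lintegral_mono fun x => ?_
    rw [lintegral_const_mul _ (by fun_prop), mul_comm, lintegral_sub_left_eq_self K x]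
    gcongr
  have h2 : ∫⁻ x, ∫⁻ y, g y ^ 2 * K (x - y) ≤ A * ∫⁻ x, g x ^ 2 := by
    rw [lintegral_lintegral_swap (by fun_prop)]
    refine le_trans (lintegral_mono fun y => lintegral_mono fun x => ?_) h1
    rw [← hsymm, neg_sub]
  calc _ ≤ ∫⁻ x, ∫⁻ y, 2⁻¹ * (g x ^ 2 * K (x - y) + g y ^ 2 * K (x - y)) := by
        refine lintegral_mono fun x => lintegral_mono fun y => ?_
        rw [← add_mul, ← mul_assoc]
        exact mul_le_mul_left (hamgm _ _) _
    _ = 2⁻¹ * ((∫⁻ x, ∫⁻ y, g x ^ 2 * K (x - y)) + ∫⁻ x, ∫⁻ y, g y ^ 2 * K (x - y)) := by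
        rw [← lintegral_add_left (by fun_prop), ← lintegral_const_mul _ (by fun_prop)]
        refine lintegral_congr fun x => ?_
        rw [← lintegral_add_left (by fun_prop), ← lintegral_const_mul _ (by fun_prop)]
    _ ≤ 2⁻¹ * (A * (∫⁻ x, g x ^ 2) + A * ∫⁻ x, g x ^ 2) := by gcongr
    _ = _ := by
        rw [← two_mul, ← mul_assoc, ENNReal.inv_mul_cancel (by norm_num) (by norm_num), one_mul]

theorem integral_cexp_gaussian {ε : ℝ} (hε : 0 < ε) (u : ℝ) :
    ∫ ξ : ℝ, Complex.exp (Complex.I * ((u * ξ : ℝ) : ℂ)) * ((rexp (-ε * ξ ^ 2) : ℝ) : ℂ) =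
      ((√(π / ε) * rexp (-(1 / (4 * ε)) * u ^ 2) : ℝ) : ℂ) := by
  have := fourierIntegral_gaussian (b := (ε : ℂ)) (by simpa using hε) (u : ℂ)
  convert this using 1
  · congr 1; ext ξ; push_cast; ring_nf
  · push_cast
    congr 1
    · rw [Real.sqrt_eq_rpow, Complex.ofReal_cpow (by positivity)]; push_cast; rfl
    · congr 1; ring

theorem lintegral_gaussian_kernel {ε : ℝ} (hε : 0 < ε) :
    ∫⁻ u : ℝ, ENNReal.ofReal (√(π / ε) * rexp (-(1 / (4 * ε)) * u ^ 2)) =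
      ENNReal.ofReal (2 * π) := by
  rw [← ofReal_integral_eq_lintegral_ofReal, integral_const_mul, integral_gaussian]
  · rw [← Real.sqrt_mul (by positivity)]
    congr 1
    rw [show π / ε * (π / (1 / (4 * ε))) = (2 * π) ^ 2 by field_simp; norm_num]
    exact Real.sqrt_sq (by positivity)
  · exact (integrable_exp_neg_mul_sq (by positivity)).const_mul _
  · exact ae_of_all _ fun _ => by positivity

/-- The Plancherel inequality for the non-normalized Fourier integral. -/
theorem lintegral_enorm_sq_fourier_le {h : ℝ → ℂ} (hm : Measurable h) (hh : Integrable h) :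
    ∫⁻ ξ : ℝ, ‖∫ x : ℝ, h x * Complex.exp (Complex.I * ((x * ξ : ℝ) : ℂ))‖ₑ ^ 2 ≤
      ENNReal.ofReal (2 * π) * ∫⁻ x, ‖h x‖ₑ ^ 2 := by
  set f : ℝ → ℝ≥0∞ := fun ξ =>
    ‖∫ x : ℝ, h x * Complex.exp (Complex.I * ((x * ξ : ℝ) : ℂ))‖ₑ ^ 2 with hf
  have hEm : Measurable fun z : ℝ × ℝ => Complex.exp (Complex.I * ((z.1 * z.2 : ℝ) : ℂ)) := by
    fun_prop
  have hE1 : ∀ z : ℝ × ℝ, ‖Complex.exp (Complex.I * ((z.1 * z.2 : ℝ) : ℂ))‖ ≤ 1 := fun z => by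
    rw [Complex.norm_exp_I_mul_ofReal]
  have hfm : Measurable f := by
    have : StronglyMeasurable fun z : ℝ × ℝ =>
        h z.2 * Complex.exp (Complex.I * ((z.2 * z.1 : ℝ) : ℂ)) := by
      apply Measurable.stronglyMeasurable; fun_prop
    exact (this.integral_prod_right (ν := volume)).measurable.enorm.pow_const 2
  have key : ∀ ε : ℝ, 0 < ε → ∫⁻ ξ, f ξ * ENNReal.ofReal (rexp (-ε * ξ ^ 2)) ≤
      ENNReal.ofReal (2 * π) * ∫⁻ x, ‖h x‖ₑ ^ 2 := by
    intro ε hε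
    set ρ : Measure ℝ := volume.withDensity fun ξ => ENNReal.ofReal (rexp (-ε * ξ ^ 2)) with hρ
    have hgi := integrable_exp_neg_mul_sq hε
    have : IsFiniteMeasure ρ := isFiniteMeasure_withDensity_ofReal hgi.2
    have htt := lintegral_enorm_sq_integral_mul_le ρ hm hh hEm hE1
    have hconv : ∀ x y : ℝ, ∫ ξ, Complex.exp (Complex.I * ((x * ξ : ℝ) : ℂ)) *
        (starRingEnd ℂ) (Complex.exp (Complex.I * ((y * ξ : ℝ) : ℂ))) ∂ρ =
        ((√(π / ε) * rexp (-(1 / (4 * ε)) * (x - y) ^ 2) : ℝ) : ℂ) := by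
      intro x y
      rw [← integral_cexp_gaussian hε (x - y), hρ, integral_withDensity_eq_integral_toReal_smul
        (by fun_prop) (by simp)]
      refine integral_congr_ae (ae_of_all _ fun ξ => ?_)
      simp only
      rw [ENNReal.toReal_ofReal (by positivity), ← Complex.exp_conj, ← Complex.exp_add,
        Complex.real_smul, mul_comm]
      congr 2
      simp
      ring
    simp only [hconv] at htt
    rw [hρ, lintegral_withDensity_eq_lintegral_mul _ (by fun_prop) hfm] at htt
    refine le_trans (le_of_eq ?_) (htt.trans ?_)
    · refine lintegral_congr fun ξ => ?_
      simp only [Pi.mul_apply]; rw [mul_comm]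
    · have hs := lintegral_schur_sub_le (g := fun x => ‖h x‖ₑ) hm.enorm
        (K := fun u => ENNReal.ofReal (√(π / ε) * rexp (-(1 / (4 * ε)) * u ^ 2)))
        (by fun_prop) (lintegral_gaussian_kernel hε).le (by simp)
      refine le_trans (le_of_eq ?_) hs
      refine lintegral_congr fun x => lintegral_congr fun y => ?_
      congr 1
      rw [← ofReal_norm, Complex.norm_real, Real.norm_of_nonneg (by positivity)]
  have hlim : ∀ ξ, Filter.Tendsto (fun m : ℕ => f ξ * ENNReal.ofReal
      (rexp (-(1 / ((m : ℝ) + 1)) * ξ ^ 2))) Filter.atTop (nhds (f ξ)) := by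
    intro ξ
    have h1 : Filter.Tendsto (fun m : ℕ => rexp (-(1 / ((m : ℝ) + 1)) * ξ ^ 2))
        Filter.atTop (nhds 1) := by
      have := ((tendsto_one_div_add_atTop_nhds_zero_nat (𝕜 := ℝ)).neg.mul_const (ξ ^ 2)).rexp
      simpa using this
    have h2 := ENNReal.tendsto_ofReal h1
    have := ENNReal.Tendsto.const_mul (a := f ξ) h2 (Or.inl (by simp))
    simpa using this
  calc ∫⁻ ξ, f ξ = ∫⁻ ξ, Filter.liminf (fun m : ℕ => f ξ * ENNReal.ofReal
      (rexp (-(1 / ((m : ℝ) + 1)) * ξ ^ 2))) Filter.atTop :=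
        lintegral_congr fun ξ => (hlim ξ).liminf_eq.symm
    _ ≤ Filter.liminf (fun m : ℕ => ∫⁻ ξ, f ξ * ENNReal.ofReal
      (rexp (-(1 / ((m : ℝ) + 1)) * ξ ^ 2))) Filter.atTop :=
        lintegral_liminf_le fun m => by fun_prop
    _ ≤ _ := by
        refine Filter.liminf_le_of_le (by isBoundedDefault) fun c hc => ?_
        obtain ⟨m, hm⟩ := hc.exists
        exact hm.trans (key _ (by positivity))

theorem lintegral_mul_sq_le {X : Type*} [MeasurableSpace X] (m : Measure X) {f g : X → ℝ≥0∞}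
    (hf : AEMeasurable f m) (hg : AEMeasurable g m) :
    (∫⁻ x, f x * g x ∂m) ^ 2 ≤ (∫⁻ x, f x ^ 2 ∂m) * ∫⁻ x, g x ^ 2 ∂m := by
  have h := ENNReal.lintegral_mul_le_Lp_mul_Lq m Real.HolderConjugate.two_two hf hg
  simp only [Pi.mul_apply, ENNReal.rpow_two] at h
  calc _ ≤ ((∫⁻ x, f x ^ 2 ∂m) ^ (1 / 2 : ℝ) * (∫⁻ x, g x ^ 2 ∂m) ^ (1 / 2 : ℝ)) ^ 2 := by
        gcongr
    _ = _ := by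
        rw [mul_pow, ← ENNReal.rpow_two, ← ENNReal.rpow_two, ← ENNReal.rpow_mul,
          ← ENNReal.rpow_mul]
        norm_num

theorem abs_le_of_aconst_le {ν μ : ℝ} (hμ : μ ≠ 0) {ξ : ℝ} (hξ : aconst ν μ ≤ |ξ|) :
    |ν| ≤ 3 / 4 * |μ| * |ξ| := by
  have h := (two_mul_abs_le_aconst ν μ).trans hξ
  have hm : 0 < |μ| := abs_pos.2 hμ
  rw [abs_div, abs_mul, abs_mul, abs_two, abs_of_pos (by norm_num : (0:ℝ) < 3)] at h
  have : 2 * (2 * |ν| / (3 * |μ|)) = |ν| * (4 / (3 * |μ|)) := by ring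
  rw [this, ← le_div_iff₀ (by positivity)] at h
  calc |ν| ≤ _ := h
    _ = _ := by field_simp

theorem sq_le_abs_dphase {ν μ : ℝ} (hμ : μ ≠ 0) {ξ : ℝ} (hξ : aconst ν μ ≤ |ξ|) :
    3 / 2 * |μ| * ξ ^ 2 ≤ |dphase ν μ ξ| := by
  have h := abs_le_of_aconst_le hμ hξ
  have h1 : |3 * μ * ξ ^ 2| - |2 * ν * (|ξ|)| ≤ |dphase ν μ ξ| := by
    have := abs_sub_abs_le_abs_sub (3 * μ * ξ ^ 2) (2 * ν * |ξ|)
    unfold dphase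
    refine this.trans (le_of_eq ?_)
    congr 1; ring
  rw [abs_mul, abs_mul, abs_mul, abs_mul, abs_abs, abs_two, abs_of_pos (by norm_num : (0:ℝ) < 3),
    abs_of_nonneg (sq_nonneg ξ)] at h1
  have h2 : |ν| * |ξ| ≤ 3 / 4 * |μ| * |ξ| * |ξ| := by gcongr
  have h3 : |ξ| * |ξ| = ξ ^ 2 := by rw [← sq, sq_abs]
  rw [mul_assoc, h3] at h2
  linarith

theorem phase_sub_ne_zero_of_lt {ν μ : ℝ} (hμ : μ ≠ 0) {x y : ℝ} (hx : aconst ν μ ≤ x)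
    (hxy : x < y) : phase ν μ x ≠ phase ν μ y := by
  have hx0 := (aconst_pos ν μ).trans_le hx
  have hy0 := hx0.trans hxy
  have h1 := abs_le_of_aconst_le hμ (ξ := x) (by rwa [abs_of_pos hx0])
  rw [abs_of_pos hx0] at h1
  have hm : 0 < |μ| := abs_pos.2 hμ
  intro h
  have h2 : (y - x) * (-ν * (x + y) + μ * (x ^ 2 + x * y + y ^ 2)) = 0 := by
    unfold phase at h
    rw [abs_of_pos hx0, abs_of_pos hy0] at h
    linear_combination -h
  have h3 : μ * (x ^ 2 + x * y + y ^ 2) = ν * (x + y) := by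
    rcases mul_eq_zero.1 h2 with h | h
    · linarith
    · linarith
  have h4 := congrArg abs h3
  rw [abs_mul, abs_mul, abs_of_pos (by positivity : 0 < x ^ 2 + x * y + y ^ 2),
    abs_of_pos (by positivity : 0 < x + y)] at h4
  have h5 : |ν| * (x + y) ≤ 3 / 4 * |μ| * x * (x + y) := by gcongr
  have h6 : |μ| * (x ^ 2 + x * y + y ^ 2) ≤ |μ| * (3 / 4 * x * (x + y)) := by linarith
  have h7 := le_of_mul_le_mul_left h6 hm
  nlinarith

theorem injOn_phase {ν μ : ℝ} (hμ : μ ≠ 0) :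
    Set.InjOn (phase ν μ) {ξ | aconst ν μ ≤ |ξ|} := by
  have ha := aconst_pos ν μ
  have hinj : ∀ x y, aconst ν μ ≤ x → aconst ν μ ≤ y → phase ν μ x = phase ν μ y → x = y := by
    intro x y hx hy h
    rcases lt_trichotomy x y with h1 | h1 | h1
    · exact absurd h (phase_sub_ne_zero_of_lt hμ hx h1)
    · exact h1
    · exact absurd h.symm (phase_sub_ne_zero_of_lt hμ hy h1)
  have hsign : ∀ x, aconst ν μ ≤ x → 0 < μ * phase ν μ x := by
    intro x hx
    have hx0 := ha.trans_le hx
    have h1 := abs_le_of_aconst_le hμ (ξ := x) (by rwa [abs_of_pos hx0])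
    rw [abs_of_pos hx0] at h1
    have hm : 0 < |μ| := abs_pos.2 hμ
    have h2 : μ * phase ν μ x = x ^ 2 * (|μ| ^ 2 * x - μ * ν) := by
      unfold phase; rw [abs_of_pos hx0, sq_abs]; ring
    rw [h2]
    have h3 : μ * ν ≤ |μ| * |ν| := by rw [← abs_mul]; exact le_abs_self _
    have h4 : |μ| * |ν| ≤ |μ| * (3 / 4 * |μ| * x) := by gcongr
    have h5 : 0 < |μ| ^ 2 * x := by positivity
    have : 0 < |μ| ^ 2 * x - μ * ν := by nlinarith
    positivity
  intro x hx y hy h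
  simp only [Set.mem_ofPred_eq] at hx hy
  rcases abs_cases x with ⟨h1, h1'⟩ | ⟨h1, h1'⟩ <;>
    rcases abs_cases y with ⟨h2, h2'⟩ | ⟨h2, h2'⟩ <;>
    rw [h1] at hx <;> rw [h2] at hy
  · exact hinj x y hx hy h
  · have e1 := hsign x hx
    have e2 := hsign (-y) hy
    rw [phase_neg, ← h] at e2
    linarith
  · have e1 := hsign (-x) hx
    have e2 := hsign y hy
    rw [phase_neg, h] at e1
    linarith
  · have := hinj (-x) (-y) hx hy (by rw [phase_neg, phase_neg, h])
    linarith

theorem hasDerivAt_phase (ν μ : ℝ) {ξ : ℝ} (hξ : ξ ≠ 0) :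
    HasDerivAt (phase ν μ) (dphase ν μ ξ) ξ := by
  have h1 := ((hasDerivAt_id ξ).const_mul (-ν)).mul (hasDerivAt_abs hξ)
  have h2 := (hasDerivAt_pow 3 ξ).const_mul μ
  refine (h1.add h2).congr_deriv ?_
  unfold dphase
  have : ξ * (SignType.sign ξ : ℝ) = |ξ| := self_mul_sign ξ
  simp only [id]
  linear_combination (-ν) * this

theorem lintegral_sq_mul_phase_le {ν μ : ℝ} (hμ : μ ≠ 0) {g : ℝ → ℝ≥0∞} :
    ∫⁻ ξ in {ξ | aconst ν μ ≤ |ξ|}, ENNReal.ofReal (ξ ^ 2) * g (phase ν μ ξ) ≤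
      ENNReal.ofReal (2 / (3 * |μ|)) * ∫⁻ u, g u := by
  have hm : 0 < |μ| := abs_pos.2 hμ
  have hS : MeasurableSet {ξ | aconst ν μ ≤ |ξ|} :=
    measurableSet_le measurable_const (by fun_prop)
  have h := lintegral_image_eq_lintegral_abs_deriv_mul hS
    (fun ξ hξ => (hasDerivAt_phase ν μ (ξ := ξ) (by
      intro h0
      have : aconst ν μ ≤ |ξ| := hξ
      rw [h0, abs_zero] at this
      linarith [aconst_pos ν μ])).hasDerivWithinAt) (injOn_phase (ν := ν) hμ) g
  calc _ ≤ ∫⁻ ξ in {ξ | aconst ν μ ≤ |ξ|}, ENNReal.ofReal (2 / (3 * |μ|)) *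
        (ENNReal.ofReal |dphase ν μ ξ| * g (phase ν μ ξ)) := by
        refine setLIntegral_mono' hS fun ξ hξ => ?_
        rw [← mul_assoc, ← ENNReal.ofReal_mul (by positivity)]
        gcongr
        rw [div_mul_eq_mul_div, le_div_iff₀ (by positivity)]
        have := sq_le_abs_dphase hμ hξ
        linarith
    _ = ENNReal.ofReal (2 / (3 * |μ|)) * ∫⁻ u in phase ν μ '' {ξ | aconst ν μ ≤ |ξ|}, g u := by
        rw [h, lintegral_const_mul' _ _ ENNReal.ofReal_ne_top]
    _ ≤ _ := by gcongr; exact Measure.restrict_le_self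

theorem lintegral_bracket_ne_top {b : ℝ} (hb : 1 / 2 < b) :
    ∫⁻ σ : ℝ, ENNReal.ofReal ((1 + σ ^ 2) ^ (-b)) ≠ ∞ := by
  have h := integrable_rpow_neg_one_add_norm_sq (E := ℝ) (μ := volume) (r := 2 * b)
    (by simp; linarith)
  have h2 : Integrable (fun σ : ℝ => (1 + σ ^ 2) ^ (-b)) := by
    refine h.congr (ae_of_all _ fun σ => ?_)
    simp only [Real.norm_eq_abs, sq_abs]
    congr 1; ring
  exact (h2.lintegral_lt_top).ne

/-- Data generating the bounded, compactly supported functions `e k^Q n^P` of unit size in the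
mixed-norm spaces dual to the target spaces. -/
structure IsDualDatum (R M : ℝ) (e : ℝ × ℝ → ℂ) (k : ℝ × ℝ → ℝ) (n : ℝ → ℝ) : Prop where
  measurable_e : Measurable e
  norm_e_le : ∀ z, ‖e z‖ ≤ 1
  support_e : ∀ z, e z ≠ 0 → |z.1| ≤ R ∧ |z.2| ≤ R
  measurable_k : Measurable k
  k_nonneg : ∀ z, 0 ≤ k z
  k_le : ∀ z, k z ≤ M
  lintegral_k : ∀ x, ∫⁻ t, ENNReal.ofReal (k (x, t)) ≤ 1
  measurable_n : Measurable n
  n_nonneg : ∀ x, 0 ≤ n x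
  n_le : ∀ x, n x ≤ M
  lintegral_n : ∫⁻ x, ENNReal.ofReal (n x) ≤ 1

/-- Bounded measurable functions supported in `a ≤ |ξ| ≤ N`, `|τ| ≤ N`. -/
structure IsTest (ν μ N B : ℝ) (ψ : ℝ × ℝ → ℂ) : Prop where
  measurable : Measurable ψ
  norm_le : ∀ w, ‖ψ w‖ ≤ B
  support : ∀ w, ψ w ≠ 0 → aconst ν μ ≤ |w.1| ∧ |w.1| ≤ N ∧ |w.2| ≤ N

/-- The weight `|ξ|^α ⟨τ - φ(ξ)⟩^{-b}`. -/
def wt (ν μ α b : ℝ) (w : ℝ × ℝ) : ℝ :=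
  |w.1| ^ α * (1 + (w.2 - phase ν μ w.1) ^ 2) ^ (-(b / 2))

/-- The function `e k^Q n^P`. -/
def dualFun (P Q : ℝ) (e : ℝ × ℝ → ℂ) (k : ℝ × ℝ → ℝ) (n : ℝ → ℝ) (z : ℝ × ℝ) : ℂ :=
  e z * ((k z ^ Q * n z.1 ^ P : ℝ) : ℂ)

/-- The character `exp(i(xξ + tτ))`. -/
def char2 (z w : ℝ × ℝ) : ℂ := Complex.exp (Complex.I * ((z.1 * w.1 + z.2 * w.2 : ℝ) : ℂ))

/-- The bilinear form pairing `ψ` with the weighted Fourier transform of `e k^Q n^P`. -/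
def dualForm (ν μ α b P Q : ℝ) (e : ℝ × ℝ → ℂ) (k : ℝ × ℝ → ℝ) (n : ℝ → ℝ) (ψ : ℝ × ℝ → ℂ) : ℂ :=
  ∫ v : (ℝ × ℝ) × (ℝ × ℝ), ψ v.2 * (wt ν μ α b v.2 : ℂ) * dualFun P Q e k n v.1 * char2 v.1 v.2

/-- The dual form of the weighted mixed-norm estimate. -/
def DualBound (ν μ α b P Q : ℝ) : Prop :=
  ∃ C : ℝ, 0 ≤ C ∧ ∀ R M N B e k n ψ X, IsDualDatum R M e k n → IsTest ν μ N B ψ → 0 ≤ X →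
    ∫⁻ w, ‖ψ w‖ₑ ^ 2 ≤ ENNReal.ofReal (X ^ 2) → ‖dualForm ν μ α b P Q e k n ψ‖ ≤ C * X

@[fun_prop]
theorem measurable_phase (ν μ : ℝ) : Measurable (phase ν μ) := (continuous_phase ν μ).measurable

@[fun_prop]
theorem measurable_wt (ν μ α b : ℝ) : Measurable (wt ν μ α b) := by
  unfold wt
  fun_prop

theorem wt_nonneg (ν μ α b : ℝ) (w : ℝ × ℝ) : 0 ≤ wt ν μ α b w := by
  unfold wt
  positivity

@[fun_prop]
theorem measurable_char2 : Measurable (fun v : (ℝ × ℝ) × (ℝ × ℝ) => char2 v.1 v.2) := by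
  unfold char2
  fun_prop

theorem norm_char2 (z w : ℝ × ℝ) : ‖char2 z w‖ = 1 := by
  unfold char2
  rw [Complex.norm_exp_I_mul_ofReal]

theorem char2_eq_mul (z w : ℝ × ℝ) : char2 z w =
    Complex.exp (Complex.I * ((z.1 * w.1 : ℝ) : ℂ)) *
      Complex.exp (Complex.I * ((z.2 * w.2 : ℝ) : ℂ)) := by
  unfold char2
  rw [← Complex.exp_add]
  congr 1
  push_cast
  ring

namespace IsDualDatum

variable {R M P Q : ℝ} {e : ℝ × ℝ → ℂ} {k : ℝ × ℝ → ℝ} {n : ℝ → ℝ}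

theorem measurable_dualFun (h : IsDualDatum R M e k n) (P Q : ℝ) :
    Measurable (dualFun P Q e k n) := by
  have h1 := h.measurable_e
  have h2 := h.measurable_k
  have h3 := h.measurable_n
  unfold dualFun
  fun_prop

theorem norm_dualFun_le (h : IsDualDatum R M e k n) (P Q : ℝ) (z : ℝ × ℝ) :
    ‖dualFun P Q e k n z‖ ≤ k z ^ Q * n z.1 ^ P := by
  have hk := h.k_nonneg z
  have hn := h.n_nonneg z.1
  unfold dualFun
  rw [norm_mul, Complex.norm_real, Real.norm_of_nonneg (by positivity)]
  calc _ ≤ 1 * (k z ^ Q * n z.1 ^ P) := by gcongr; exact h.norm_e_le z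
    _ = _ := one_mul _

theorem integrable_dualFun (h : IsDualDatum R M e k n) (hP : 0 ≤ P) (hQ : 0 ≤ Q) :
    Integrable (dualFun P Q e k n) := by
  have hs : Function.support (dualFun P Q e k n) ⊆ Set.Icc (-R) R ×ˢ Set.Icc (-R) R := by
    intro z hz
    have : e z ≠ 0 := by
      intro h0
      exact hz (by simp [dualFun, h0])
    have := h.support_e z this
    exact ⟨abs_le.1 this.1, abs_le.1 this.2⟩
  rw [← integrableOn_iff_integrable_of_support_subset hs]
  refine Measure.integrableOn_of_bounded (M := M ^ Q * M ^ P) ?_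
    (h.measurable_dualFun P Q).aestronglyMeasurable (ae_of_all _ fun z => ?_)
  · exact (isCompact_Icc.prod isCompact_Icc).measure_lt_top.ne
  · refine (h.norm_dualFun_le P Q z).trans ?_
    have := h.k_le z
    have := h.n_le z.1
    have := h.k_nonneg z
    have := h.n_nonneg z.1
    have hM : 0 ≤ M := by linarith
    gcongr

end IsDualDatum

namespace IsTest

variable {ν μ N B : ℝ} {ψ : ℝ × ℝ → ℂ}

theorem eq_zero (h : IsTest ν μ N B ψ) {w : ℝ × ℝ}
    (hw : ¬(aconst ν μ ≤ |w.1| ∧ |w.1| ≤ N ∧ |w.2| ≤ N)) : ψ w = 0 := by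
  by_contra h0
  exact hw (h.support w h0)

theorem integrable_mul_wt (h : IsTest ν μ N B ψ) (α b : ℝ) :
    Integrable fun w => ψ w * (wt ν μ α b w : ℂ) := by
  have ha := aconst_pos ν μ
  set K : Set (ℝ × ℝ) := {w | aconst ν μ ≤ |w.1| ∧ |w.1| ≤ N ∧ |w.2| ≤ N} with hK
  have hKc : IsCompact K := by
    refine (isCompact_Icc (a := -N) (b := N)).prod (isCompact_Icc (a := -N) (b := N))
      |>.of_isClosed_subset ?_ ?_
    · exact (isClosed_le (f := fun _ => aconst ν μ) (g := fun w : ℝ × ℝ => |w.1|)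
        (by fun_prop) (by fun_prop)).inter
        ((isClosed_le (f := fun w : ℝ × ℝ => |w.1|) (g := fun _ => N)
          (by fun_prop) (by fun_prop)).inter
          (isClosed_le (f := fun w : ℝ × ℝ => |w.2|) (g := fun _ => N)
            (by fun_prop) (by fun_prop)))
    · intro w hw
      exact ⟨abs_le.1 hw.2.1, abs_le.1 hw.2.2⟩
  have hcont : ContinuousOn (wt ν μ α b) K := by
    unfold wt
    have hp := continuous_phase ν μ
    refine ContinuousOn.mul (ContinuousOn.rpow_const (by fun_prop) fun w hw => Or.inl ?_)
      (Continuous.continuousOn (Continuous.rpow_const (by fun_prop) fun w => Or.inl ?_))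
    · exact (ha.trans_le hw.1).ne'
    · positivity
  obtain ⟨D, hD⟩ := hKc.exists_bound_of_continuousOn hcont
  have hs : Function.support (fun w => ψ w * (wt ν μ α b w : ℂ)) ⊆ K := by
    intro w hw
    refine h.support w fun h0 => hw ?_
    simp [h0]
  rw [← integrableOn_iff_integrable_of_support_subset hs]
  refine Measure.integrableOn_of_bounded (M := B * D) hKc.measure_lt_top.ne ?_ ?_
  · have := h.measurable
    exact Measurable.aestronglyMeasurable (by fun_prop)
  · refine (ae_restrict_iff' hKc.measurableSet).2 (ae_of_all _ fun w hw => ?_)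
    rw [norm_mul, Complex.norm_real]
    exact mul_le_mul (h.norm_le w) (hD w hw) (norm_nonneg _) ((norm_nonneg _).trans (h.norm_le w))

end IsTest

theorem integrable_dualForm {ν μ R M N B P Q : ℝ} {e : ℝ × ℝ → ℂ} {k : ℝ × ℝ → ℝ} {n : ℝ → ℝ}
    {ψ : ℝ × ℝ → ℂ} (h : IsDualDatum R M e k n) (hψ : IsTest ν μ N B ψ) (hP : 0 ≤ P) (hQ : 0 ≤ Q)
    (α b : ℝ) : Integrable fun v : (ℝ × ℝ) × (ℝ × ℝ) =>
      ψ v.2 * (wt ν μ α b v.2 : ℂ) * dualFun P Q e k n v.1 * char2 v.1 v.2 := by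
  have h1 := (h.integrable_dualFun hP hQ).mul_prod (hψ.integrable_mul_wt α b)
  refine h1.mono ?_ (ae_of_all _ fun v => ?_)
  · have := h.measurable_dualFun P Q
    have := hψ.measurable
    exact Measurable.aestronglyMeasurable (by fun_prop)
  · rw [norm_mul, norm_char2, mul_one, mul_comm]

/-- The transform `∬ e k^Q n^P exp(i(xξ + tτ))`. -/
def dualTransform (P Q : ℝ) (e : ℝ × ℝ → ℂ) (k : ℝ × ℝ → ℝ) (n : ℝ → ℝ) (w : ℝ × ℝ) : ℂ :=
  ∫ z, dualFun P Q e k n z * char2 z w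

theorem measurable_dualTransform {R M : ℝ} {e : ℝ × ℝ → ℂ} {k : ℝ × ℝ → ℝ} {n : ℝ → ℝ}
    (h : IsDualDatum R M e k n) (P Q : ℝ) : Measurable (dualTransform P Q e k n) := by
  have h1 := h.measurable_dualFun P Q
  have : StronglyMeasurable fun v : (ℝ × ℝ) × (ℝ × ℝ) =>
      dualFun P Q e k n v.2 * char2 v.2 v.1 := by
    apply Measurable.stronglyMeasurable
    have := measurable_char2.comp measurable_swap (α := (ℝ × ℝ) × (ℝ × ℝ))
    have h2 : Measurable fun v : (ℝ × ℝ) × (ℝ × ℝ) => char2 v.2 v.1 := this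
    fun_prop
  exact (this.integral_prod_right (ν := volume)).measurable

/-- A weighted `L²` bound for the transform, uniform in the frequency cutoff, yields the dual
bound. -/
theorem dualBound_of_lintegral_le {ν μ α b P Q : ℝ} (hP : 0 ≤ P) (hQ : 0 ≤ Q) {C : ℝ} (hC : 0 ≤ C)
    (H : ∀ R M N e k n, IsDualDatum R M e k n →
      ∫⁻ ξ in freqWindow ν μ N, ∫⁻ τ, ENNReal.ofReal (wt ν μ α b (ξ, τ)) ^ 2 *
        ‖dualTransform P Q e k n (ξ, τ)‖ₑ ^ 2 ≤ ENNReal.ofReal (C ^ 2)) :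
    DualBound ν μ α b P Q := by
  refine ⟨C, hC, fun R M N B e k n ψ X hd hψ hX hψX => ?_⟩
  have hTm := measurable_dualTransform hd P Q
  have hψm := hψ.measurable
  have h1 : dualForm ν μ α b P Q e k n ψ =
      ∫ w, ψ w * (wt ν μ α b w : ℂ) * dualTransform P Q e k n w := by
    unfold dualForm
    rw [Measure.volume_eq_prod (ℝ × ℝ) (ℝ × ℝ), integral_prod_symm _
      (by rw [← Measure.volume_eq_prod]; exact integrable_dualForm hd hψ hP hQ α b)]
    refine integral_congr_ae (ae_of_all _ fun w => ?_)
    simp only [dualTransform, ← integral_const_mul]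
    refine integral_congr_ae (ae_of_all _ fun z => ?_)
    simp only
    ring
  set S : Set (ℝ × ℝ) := freqWindow ν μ N ×ˢ Set.univ with hS
  have hSm : MeasurableSet S := (measurableSet_freqWindow ν μ N).prod MeasurableSet.univ
  have h2 : ‖dualForm ν μ α b P Q e k n ψ‖ₑ ≤ ∫⁻ w in S, ‖ψ w‖ₑ *
      (ENNReal.ofReal (wt ν μ α b w) * ‖dualTransform P Q e k n w‖ₑ) := by
    rw [h1]
    refine (enorm_integral_le_lintegral_enorm _).trans ?_
    rw [← lintegral_indicator hSm]
    refine lintegral_mono fun w => ?_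
    by_cases hw : w ∈ S
    · rw [Set.indicator_of_mem hw, enorm_mul, enorm_mul, mul_assoc]
      gcongr
      rw [← ofReal_norm, Complex.norm_real, Real.norm_of_nonneg (wt_nonneg ..)]
    · rw [hψ.eq_zero (fun h => hw ⟨⟨h.1, h.2.1⟩, trivial⟩)]
      simp
  have h3 : ‖dualForm ν μ α b P Q e k n ψ‖ₑ ^ 2 ≤ ENNReal.ofReal ((C * X) ^ 2) := by
    calc _ ≤ (∫⁻ w in S, ‖ψ w‖ₑ *
      (ENNReal.ofReal (wt ν μ α b w) * ‖dualTransform P Q e k n w‖ₑ)) ^ 2 := by gcongr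
      _ ≤ (∫⁻ w in S, ‖ψ w‖ₑ ^ 2) * ∫⁻ w in S,
          (ENNReal.ofReal (wt ν μ α b w) * ‖dualTransform P Q e k n w‖ₑ) ^ 2 :=
        lintegral_mul_sq_le _ (by fun_prop) (by fun_prop)
      _ ≤ ENNReal.ofReal (X ^ 2) * ENNReal.ofReal (C ^ 2) := by
        gcongr
        · exact (lintegral_mono' Measure.restrict_le_self le_rfl).trans hψX
        · refine le_trans (le_of_eq ?_) (H R M N e k n hd)
          rw [hS, Measure.volume_eq_prod ℝ ℝ, ← Measure.prod_restrict, Measure.restrict_univ,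
            lintegral_prod _ (by fun_prop)]
          simp only [mul_pow]
      _ = _ := by
        rw [← ENNReal.ofReal_mul (by positivity)]
        congr 1; ring
  rw [← ofReal_norm, ← ENNReal.ofReal_pow (norm_nonneg _),
    ENNReal.ofReal_le_ofReal_iff (by positivity)] at h3
  exact le_of_sq_le_sq h3 (by positivity)

/-- The Fourier integral in the second variable. -/
def timeTransform (d : ℝ × ℝ → ℂ) (x τ : ℝ) : ℂ :=
  ∫ t, d (x, t) * Complex.exp (Complex.I * ((t * τ : ℝ) : ℂ))

theorem measurable_timeTransform {d : ℝ × ℝ → ℂ} (hd : Measurable d) :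
    Measurable fun v : ℝ × ℝ => timeTransform d v.1 v.2 := by
  have : StronglyMeasurable fun v : (ℝ × ℝ) × ℝ =>
      d (v.1.1, v.2) * Complex.exp (Complex.I * ((v.2 * v.1.2 : ℝ) : ℂ)) := by
    apply Measurable.stronglyMeasurable
    fun_prop
  exact (this.integral_prod_right (ν := volume)).measurable

theorem integrable_mul_cexp_snd {d : ℝ × ℝ → ℂ} (hd : Measurable d) (hi : Integrable d) (τ : ℝ) :
    Integrable fun z : ℝ × ℝ => d z * Complex.exp (Complex.I * ((z.2 * τ : ℝ) : ℂ)) := by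
  refine hi.mono (Measurable.aestronglyMeasurable (by fun_prop)) (ae_of_all _ fun z => ?_)
  rw [norm_mul, Complex.norm_exp_I_mul_ofReal, mul_one]

theorem integrable_timeTransform {d : ℝ × ℝ → ℂ} (hd : Measurable d) (hi : Integrable d) (τ : ℝ) :
    Integrable fun x => timeTransform d x τ :=
  (integrable_mul_cexp_snd hd hi τ).integral_prod_left

theorem integral_mul_char2_eq {d : ℝ × ℝ → ℂ} (hd : Measurable d) (hi : Integrable d) (ξ τ : ℝ) :
    ∫ z, d z * char2 z (ξ, τ) =
      ∫ x, timeTransform d x τ * Complex.exp (Complex.I * ((x * ξ : ℝ) : ℂ)) := by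
  rw [Measure.volume_eq_prod, integral_prod]
  · refine integral_congr_ae (ae_of_all _ fun x => ?_)
    simp only [timeTransform]
    rw [← integral_mul_const]
    refine integral_congr_ae (ae_of_all _ fun t => ?_)
    simp only [char2_eq_mul]
    ring
  · rw [← Measure.volume_eq_prod]
    have hc : Measurable fun z : ℝ × ℝ => char2 z (ξ, τ) := by unfold char2; fun_prop
    refine hi.mono (Measurable.aestronglyMeasurable (by fun_prop)) (ae_of_all _ fun z => ?_)
    rw [norm_mul, norm_char2, mul_one]

theorem ofReal_wt_sq (ν μ α b : ℝ) (w : ℝ × ℝ) : ENNReal.ofReal (wt ν μ α b w) ^ 2 =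
    ENNReal.ofReal (|w.1| ^ (2 * α)) *
      ENNReal.ofReal ((1 + (w.2 - phase ν μ w.1) ^ 2) ^ (-b)) := by
  rw [← ENNReal.ofReal_pow (wt_nonneg ..), ← ENNReal.ofReal_mul (by positivity)]
  congr 1
  unfold wt
  rw [mul_pow, ← Real.rpow_two, ← Real.rpow_two, ← Real.rpow_mul (abs_nonneg _),
    ← Real.rpow_mul (by positivity)]
  congr 2 <;> ring

/-- The trivial `L²` bound. -/
theorem dualBound_zero {ν μ b : ℝ} (hb : 0 ≤ b) : DualBound ν μ 0 b (1 / 2) (1 / 2) := by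
  refine dualBound_of_lintegral_le (by norm_num) (by norm_num) (C := 2 * π) (by positivity) ?_
  intro R M N e k n h
  set d := dualFun (1 / 2) (1 / 2) e k n with hd
  have hdm : Measurable d := h.measurable_dualFun _ _
  have hdi : Integrable d := h.integrable_dualFun (by norm_num) (by norm_num)
  have htm := measurable_timeTransform hdm
  have hTm := measurable_dualTransform h (1 / 2) (1 / 2)
  have hwt : ∀ w, ENNReal.ofReal (wt ν μ 0 b w) ^ 2 ≤ 1 := by
    intro w
    rw [ofReal_wt_sq, mul_zero, Real.rpow_zero, ENNReal.ofReal_one, one_mul]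
    refine ENNReal.ofReal_le_one.2 (Real.rpow_le_one_of_one_le_of_nonpos ?_ (by linarith))
    nlinarith [sq_nonneg (w.2 - phase ν μ w.1)]
  calc _ ≤ ∫⁻ ξ in freqWindow ν μ N, ∫⁻ τ, ‖dualTransform (1 / 2) (1 / 2) e k n (ξ, τ)‖ₑ ^ 2 := by
        refine lintegral_mono fun ξ => lintegral_mono fun τ => ?_
        calc _ ≤ 1 * ‖dualTransform (1 / 2) (1 / 2) e k n (ξ, τ)‖ₑ ^ 2 := by gcongr; exact hwt _
          _ = _ := one_mul _
    _ ≤ ∫⁻ ξ, ∫⁻ τ, ‖dualTransform (1 / 2) (1 / 2) e k n (ξ, τ)‖ₑ ^ 2 :=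
        lintegral_mono' Measure.restrict_le_self le_rfl
    _ = ∫⁻ τ, ∫⁻ ξ, ‖dualTransform (1 / 2) (1 / 2) e k n (ξ, τ)‖ₑ ^ 2 :=
        lintegral_lintegral_swap (by fun_prop)
    _ ≤ ∫⁻ τ, ENNReal.ofReal (2 * π) * ∫⁻ x, ‖timeTransform d x τ‖ₑ ^ 2 := by
        refine lintegral_mono fun τ => ?_
        have := lintegral_enorm_sq_fourier_le (h := fun x => timeTransform d x τ)
          (htm.comp (by fun_prop : Measurable fun x : ℝ => (x, τ)))
          (integrable_timeTransform hdm hdi τ)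
        refine le_trans (le_of_eq ?_) this
        refine lintegral_congr fun ξ => ?_
        rw [dualTransform, integral_mul_char2_eq hdm hdi]
    _ = ENNReal.ofReal (2 * π) * ∫⁻ x, ∫⁻ τ, ‖timeTransform d x τ‖ₑ ^ 2 := by
        rw [lintegral_const_mul' _ _ ENNReal.ofReal_ne_top]
        congr 1
        refine lintegral_lintegral_swap ?_
        have : Measurable fun v : ℝ × ℝ => timeTransform d v.2 v.1 := htm.comp measurable_swap
        exact (this.enorm.pow_const 2).aemeasurable
    _ ≤ ENNReal.ofReal (2 * π) * ∫⁻ x, ENNReal.ofReal (2 * π) * ∫⁻ t, ‖d (x, t)‖ₑ ^ 2 := by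
        gcongr 1
        have hae := Integrable.prod_right_ae (μ := volume) (ν := volume) (f := d)
          (by rwa [← Measure.volume_eq_prod])
        refine lintegral_mono_ae (hae.mono fun x hx => ?_)
        exact lintegral_enorm_sq_fourier_le (h := fun t => d (x, t)) (by fun_prop) hx
    _ ≤ ENNReal.ofReal (2 * π) * ∫⁻ x, ENNReal.ofReal (2 * π) * ENNReal.ofReal (n x) := by
        gcongr with x
        calc ∫⁻ t, ‖d (x, t)‖ₑ ^ 2 ≤ ∫⁻ t, ENNReal.ofReal (n x) * ENNReal.ofReal (k (x, t)) := by
              refine lintegral_mono fun t => ?_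
              have hk := h.k_nonneg (x, t)
              have hn := h.n_nonneg x
              rw [← ofReal_norm, ← ENNReal.ofReal_pow (norm_nonneg _), ← ENNReal.ofReal_mul hn]
              refine ENNReal.ofReal_le_ofReal ?_
              have := h.norm_dualFun_le (1 / 2) (1 / 2) (x, t)
              calc _ ≤ (k (x, t) ^ (1 / 2 : ℝ) * n x ^ (1 / 2 : ℝ)) ^ 2 := by gcongr
                _ = n x * k (x, t) := by
                  rw [mul_pow, ← Real.sqrt_eq_rpow, ← Real.sqrt_eq_rpow, Real.sq_sqrt hk,
                    Real.sq_sqrt hn, mul_comm]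
          _ = ENNReal.ofReal (n x) * ∫⁻ t, ENNReal.ofReal (k (x, t)) :=
              lintegral_const_mul' _ _ ENNReal.ofReal_ne_top
          _ ≤ ENNReal.ofReal (n x) * 1 := by gcongr; exact h.lintegral_k x
          _ = _ := mul_one _
    _ ≤ ENNReal.ofReal (2 * π) * (ENNReal.ofReal (2 * π) * 1) := by
        rw [lintegral_const_mul' _ _ ENNReal.ofReal_ne_top]
        gcongr
        exact h.lintegral_n
    _ = _ := by rw [mul_one, ← ENNReal.ofReal_mul (by positivity), sq]

/-- The local smoothing endpoint. -/
theorem dualBound_one {ν μ b : ℝ} (hμ : μ ≠ 0) (hb : 1 / 2 < b) :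
    DualBound ν μ 1 b 1 (1 / 2) := by
  set I₀ : ℝ≥0∞ := ∫⁻ σ : ℝ, ENNReal.ofReal ((1 + σ ^ 2) ^ (-b)) with hI
  have hItop : I₀ ≠ ∞ := lintegral_bracket_ne_top hb
  set A : ℝ≥0∞ := ENNReal.ofReal (2 / (3 * |μ|)) * I₀ * ENNReal.ofReal (2 * π) with hA
  have hAtop : A ≠ ∞ := by finiteness
  refine dualBound_of_lintegral_le (by norm_num) (by norm_num) (C := √A.toReal)
    (Real.sqrt_nonneg _) ?_
  intro R M N e k n h
  rw [Real.sq_sqrt ENNReal.toReal_nonneg, ENNReal.ofReal_toReal hAtop]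
  set d := dualFun 1 (1 / 2) e k n with hd
  set d' := dualFun 0 (1 / 2) e k n with hd'
  have hdm : Measurable d := h.measurable_dualFun _ _
  have hdi : Integrable d := h.integrable_dualFun (by norm_num) (by norm_num)
  have hdm' : Measurable d' := h.measurable_dualFun _ _
  have hdi' : Integrable d' := h.integrable_dualFun (by norm_num) (by norm_num)
  have htm := measurable_timeTransform hdm
  have htm' := measurable_timeTransform hdm'
  have hTm := measurable_dualTransform h 1 (1 / 2)
  have hnm := h.measurable_n
  set G : ℝ → ℝ≥0∞ := fun τ => ∫⁻ x, ENNReal.ofReal (n x) * ‖timeTransform d' x τ‖ₑ ^ 2 with hG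
  have hTG : ∀ ξ τ, ‖dualTransform 1 (1 / 2) e k n (ξ, τ)‖ₑ ^ 2 ≤ G τ := by
    intro ξ τ
    have htτ : Measurable fun x => timeTransform d' x τ :=
      htm'.comp (by fun_prop : Measurable fun x : ℝ => (x, τ))
    have hfac : ∀ x, ‖timeTransform d x τ‖ₑ = ENNReal.ofReal (√(n x)) *
        (ENNReal.ofReal (√(n x)) * ‖timeTransform d' x τ‖ₑ) := by
      intro x
      rw [← mul_assoc, ← ENNReal.ofReal_mul (Real.sqrt_nonneg _),
        Real.mul_self_sqrt (h.n_nonneg x)]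
      have : timeTransform d x τ = (n x : ℂ) * timeTransform d' x τ := by
        simp only [timeTransform, ← integral_const_mul]
        refine integral_congr_ae (ae_of_all _ fun t => ?_)
        simp only [hd, hd', dualFun, Real.rpow_one, Real.rpow_zero]
        push_cast
        ring
      rw [this, enorm_mul]
      congr 1
      rw [← ofReal_norm, Complex.norm_real, Real.norm_of_nonneg (h.n_nonneg x)]
    calc _ ≤ (∫⁻ x, ‖timeTransform d x τ‖ₑ) ^ 2 := by
          rw [dualTransform, integral_mul_char2_eq hdm hdi]
          gcongr
          refine (enorm_integral_le_lintegral_enorm _).trans (le_of_eq ?_)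
          refine lintegral_congr fun x => ?_
          rw [enorm_mul, ← ofReal_norm (Complex.exp _), Complex.norm_exp_I_mul_ofReal,
            ENNReal.ofReal_one, mul_one]
      _ ≤ (∫⁻ x, ENNReal.ofReal (√(n x)) ^ 2) *
          ∫⁻ x, (ENNReal.ofReal (√(n x)) * ‖timeTransform d' x τ‖ₑ) ^ 2 := by
          simp only [hfac]
          exact lintegral_mul_sq_le _ (by fun_prop) (by fun_prop)
      _ ≤ 1 * G τ := by
          have hs : ∀ x, ENNReal.ofReal (√(n x)) ^ 2 = ENNReal.ofReal (n x) := fun x => by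
            rw [← ENNReal.ofReal_pow (Real.sqrt_nonneg _), Real.sq_sqrt (h.n_nonneg x)]
          simp only [mul_pow, hs]
          gcongr
          exact h.lintegral_n
      _ = _ := one_mul _
  have hGint : ∫⁻ τ, G τ ≤ ENNReal.ofReal (2 * π) := by
    have hmeas : Measurable fun v : ℝ × ℝ =>
        ENNReal.ofReal (n v.2) * ‖timeTransform d' v.2 v.1‖ₑ ^ 2 := by
      have : Measurable fun v : ℝ × ℝ => timeTransform d' v.2 v.1 := htm'.comp measurable_swap
      fun_prop
    calc ∫⁻ τ, G τ = ∫⁻ x, ∫⁻ τ, ENNReal.ofReal (n x) * ‖timeTransform d' x τ‖ₑ ^ 2 :=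
          lintegral_lintegral_swap hmeas.aemeasurable
      _ ≤ ∫⁻ x, ENNReal.ofReal (n x) * ENNReal.ofReal (2 * π) := by
          have hae := Integrable.prod_right_ae (μ := volume) (ν := volume) (f := d')
            (by rwa [← Measure.volume_eq_prod])
          refine lintegral_mono_ae (hae.mono fun x hx => ?_)
          rw [lintegral_const_mul' _ _ ENNReal.ofReal_ne_top]
          gcongr
          refine (lintegral_enorm_sq_fourier_le (h := fun t => d' (x, t)) (by fun_prop) hx).trans ?_
          calc _ ≤ ENNReal.ofReal (2 * π) * ∫⁻ t, ENNReal.ofReal (k (x, t)) := by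
                gcongr with t
                have hk := h.k_nonneg (x, t)
                rw [← ofReal_norm, ← ENNReal.ofReal_pow (norm_nonneg _)]
                refine ENNReal.ofReal_le_ofReal ?_
                have := h.norm_dualFun_le 0 (1 / 2) (x, t)
                rw [Real.rpow_zero, mul_one, ← Real.sqrt_eq_rpow] at this
                calc _ ≤ √(k (x, t)) ^ 2 := by gcongr
                  _ = _ := Real.sq_sqrt hk
            _ ≤ ENNReal.ofReal (2 * π) * 1 := by gcongr; exact h.lintegral_k x
            _ = _ := mul_one _
      _ = (∫⁻ x, ENNReal.ofReal (n x)) * ENNReal.ofReal (2 * π) :=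
          lintegral_mul_const' _ _ ENNReal.ofReal_ne_top
      _ ≤ 1 * ENNReal.ofReal (2 * π) := by gcongr; exact h.lintegral_n
      _ = _ := one_mul _
  have hwt : ∀ τ, ∫⁻ ξ in freqWindow ν μ N, ENNReal.ofReal (wt ν μ 1 b (ξ, τ)) ^ 2 ≤
      ENNReal.ofReal (2 / (3 * |μ|)) * I₀ := by
    intro τ
    have := lintegral_sq_mul_phase_le (ν := ν) hμ
      (g := fun u => ENNReal.ofReal ((1 + (τ - u) ^ 2) ^ (-b)))
    rw [lintegral_sub_left_eq_self (fun u => ENNReal.ofReal ((1 + u ^ 2) ^ (-b))) τ] at this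
    refine le_trans ?_ this
    refine (lintegral_mono_set (t := {ξ | aconst ν μ ≤ |ξ|}) fun ξ hξ => hξ.1).trans
      (le_of_eq ?_)
    refine lintegral_congr fun ξ => ?_
    rw [ofReal_wt_sq, mul_one, Real.rpow_two, sq_abs]
  have hGm : Measurable G := by
    have hmeas : Measurable fun v : ℝ × ℝ =>
        ENNReal.ofReal (n v.2) * ‖timeTransform d' v.2 v.1‖ₑ ^ 2 := by
      have : Measurable fun v : ℝ × ℝ => timeTransform d' v.2 v.1 := htm'.comp measurable_swap
      fun_prop
    exact hmeas.lintegral_prod_right'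
  calc _ ≤ ∫⁻ ξ in freqWindow ν μ N, ∫⁻ τ, ENNReal.ofReal (wt ν μ 1 b (ξ, τ)) ^ 2 * G τ := by
        gcongr with ξ τ
        exact hTG ξ τ
    _ = ∫⁻ τ, ∫⁻ ξ in freqWindow ν μ N, ENNReal.ofReal (wt ν μ 1 b (ξ, τ)) ^ 2 * G τ :=
        lintegral_lintegral_swap (by fun_prop)
    _ ≤ ∫⁻ τ, ENNReal.ofReal (2 / (3 * |μ|)) * I₀ * G τ := by
        refine lintegral_mono fun τ => ?_
        rw [lintegral_mul_const _ (by fun_prop)]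
        gcongr
        exact hwt τ
    _ ≤ A := by
        rw [lintegral_const_mul _ hGm, hA]
        gcongr

theorem IsDualDatum.lintegral_enorm_mul_le {R M : ℝ} {e : ℝ × ℝ → ℂ} {k : ℝ × ℝ → ℝ} {n : ℝ → ℝ}
    (h : IsDualDatum R M e k n) {g : ℝ → ℝ≥0∞} (hg : Measurable g) {P : ℝ} (hP : 0 ≤ P) :
    ∫⁻ z, ‖dualFun P 1 e k n z‖ₑ * g z.1 ≤ ∫⁻ x, ENNReal.ofReal (n x) ^ P * g x := by
  have hm := h.measurable_dualFun P 1
  rw [Measure.volume_eq_prod, lintegral_prod _ (by fun_prop)]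
  refine lintegral_mono fun x => ?_
  calc ∫⁻ t, ‖dualFun P 1 e k n (x, t)‖ₑ * g x
      ≤ ∫⁻ t, ENNReal.ofReal (k (x, t)) * (ENNReal.ofReal (n x) ^ P * g x) := by
        refine lintegral_mono fun t => ?_
        rw [← mul_assoc]
        gcongr
        have := h.norm_dualFun_le P 1 (x, t)
        rw [Real.rpow_one] at this
        rw [← ofReal_norm, ENNReal.ofReal_rpow_of_nonneg (h.n_nonneg x) hP,
          ← ENNReal.ofReal_mul (h.k_nonneg _)]
        exact ENNReal.ofReal_le_ofReal this
    _ = (∫⁻ t, ENNReal.ofReal (k (x, t))) * (ENNReal.ofReal (n x) ^ P * g x) := by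
        have := h.measurable_k
        exact lintegral_mul_const _ (by fun_prop)
    _ ≤ 1 * (ENNReal.ofReal (n x) ^ P * g x) := by gcongr; exact h.lintegral_k x
    _ = _ := one_mul _

/-- The density `|ξ|^{-1/2}` on a frequency window. -/
def windowMeasure (ν μ N : ℝ) : Measure ℝ :=
  (volume.restrict (freqWindow ν μ N)).withDensity fun ξ => ENNReal.ofReal (|ξ| ^ (-(1 / 2) : ℝ))

instance (ν μ N : ℝ) : IsFiniteMeasure (windowMeasure ν μ N) := by
  unfold windowMeasure
  refine isFiniteMeasure_withDensity_ofReal ?_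
  refine (Measure.integrableOn_of_bounded (s := freqWindow ν μ N) (M := 1) ?_
    (Measurable.aestronglyMeasurable (by fun_prop)) ?_).2
  · refine ((measure_mono fun ξ hξ => ?_).trans_lt (measure_Icc_lt_top (a := -N) (b := N))).ne
    exact abs_le.1 hξ.2
  · refine (ae_restrict_iff' (measurableSet_freqWindow ν μ N)).2 (ae_of_all _ fun ξ hξ => ?_)
    rw [Real.norm_of_nonneg (by positivity)]
    exact Real.rpow_le_one_of_one_le_of_nonpos ((one_le_aconst ν μ).trans hξ.1) (by norm_num)

theorem enorm_integral_windowMeasure_le {ν μ : ℝ} (hμ : μ ≠ 0) (N : ℝ) {z w : ℝ × ℝ}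
    (hzw : z.1 ≠ w.1) :
    ‖∫ ξ, char2 z (ξ, phase ν μ ξ) * (starRingEnd ℂ) (char2 w (ξ, phase ν μ ξ))
      ∂windowMeasure ν μ N‖ₑ ≤ 100 * sqrtKernel (z.1 - w.1) := by
  have h := norm_kernel_le (ν := ν) hμ N (x := z.1 - w.1) (z.2 - w.2) (sub_ne_zero.2 hzw)
  have heq : ∫ ξ, char2 z (ξ, phase ν μ ξ) * (starRingEnd ℂ) (char2 w (ξ, phase ν μ ξ))
      ∂windowMeasure ν μ N = ∫ ξ in freqWindow ν μ N, ((|ξ| ^ (-(1 / 2) : ℝ) : ℝ) : ℂ) *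
      Complex.exp (Complex.I * (((z.1 - w.1) * ξ + phase ν μ ξ * (z.2 - w.2) : ℝ) : ℂ)) := by
    rw [windowMeasure, integral_withDensity_eq_integral_toReal_smul (by fun_prop) (by simp)]
    refine integral_congr_ae (ae_of_all _ fun ξ => ?_)
    simp only
    rw [ENNReal.toReal_ofReal (by positivity), Complex.real_smul, char2, char2,
      ← Complex.exp_conj, ← Complex.exp_add]
    congr 2
    simp
    ring
  rw [heq, ← ofReal_norm, sqrtKernel]
  refine (ENNReal.ofReal_le_ofReal h).trans (le_of_eq ?_)
  rw [← ENNReal.ofReal_ofNat, ← ENNReal.ofReal_mul (by norm_num), Real.rpow_neg (abs_nonneg _),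
    ← Real.sqrt_eq_rpow, div_eq_mul_inv]

theorem lintegral_windowMeasure_le {ν μ : ℝ} (hμ : μ ≠ 0) (N : ℝ) {R M : ℝ} {e : ℝ × ℝ → ℂ}
    {k : ℝ × ℝ → ℝ} {n : ℝ → ℝ} (h : IsDualDatum R M e k n) (σ : ℝ) :
    ∫⁻ ξ, ‖dualTransform (3 / 4) 1 e k n (ξ, phase ν μ ξ + σ)‖ₑ ^ 2 ∂windowMeasure ν μ N ≤
      1200 := by
  set d := dualFun (3 / 4) 1 e k n with hd
  have hdm : Measurable d := h.measurable_dualFun _ _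
  have hdi : Integrable d := h.integrable_dualFun (by norm_num) (by norm_num)
  have hnm := h.measurable_n
  have hkm := measurable_sqrtKernel
  set dσ : ℝ × ℝ → ℂ := fun z => d z * Complex.exp (Complex.I * ((z.2 * σ : ℝ) : ℂ)) with hdσ
  have hEm : Measurable fun v : (ℝ × ℝ) × ℝ => char2 v.1 (v.2, phase ν μ v.2) :=
    measurable_char2.comp (by fun_prop :
      Measurable fun v : (ℝ × ℝ) × ℝ => (v.1, (v.2, phase ν μ v.2)))
  have htt := lintegral_enorm_sq_integral_mul_le (m := volume) (windowMeasure ν μ N) (h := dσ)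
    (by fun_prop) (integrable_mul_cexp_snd hdm hdi σ) hEm (fun v => (norm_char2 _ _).le)
  have hnorm : ∀ z, ‖dσ z‖ₑ = ‖d z‖ₑ := by
    intro z
    rw [hdσ, enorm_mul, ← ofReal_norm (Complex.exp _), Complex.norm_exp_I_mul_ofReal,
      ENNReal.ofReal_one, mul_one]
  have hT : ∀ ξ, dualTransform (3 / 4) 1 e k n (ξ, phase ν μ ξ + σ) =
      ∫ z, dσ z * char2 z (ξ, phase ν μ ξ) := by
    intro ξ
    rw [dualTransform]
    refine integral_congr_ae (ae_of_all _ fun z => ?_)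
    simp only [hdσ, ← hd, mul_assoc]
    congr 1
    rw [char2, char2, ← Complex.exp_add]
    congr 1
    push_cast
    ring
  simp only [hT]
  refine htt.trans ?_
  have hnull : ∀ x : ℝ, ∀ᵐ w : ℝ × ℝ, x ≠ w.1 := by
    intro x
    rw [ae_iff]
    have : {w : ℝ × ℝ | ¬ x ≠ w.1} = {x} ×ˢ Set.univ := by
      ext w
      simp [eq_comm]
    rw [this, Measure.volume_eq_prod, Measure.prod_prod]
    simp
  set g : ℝ → ℝ≥0∞ := fun x => ∫⁻ y, ENNReal.ofReal (n y) ^ (3 / 4 : ℝ) * sqrtKernel (x - y)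
    with hg
  have hgm : Measurable g := by
    have : Measurable fun v : ℝ × ℝ =>
      ENNReal.ofReal (n v.2) ^ (3 / 4 : ℝ) * sqrtKernel (v.1 - v.2) := by fun_prop
    exact this.lintegral_prod_right'
  calc _ ≤ ∫⁻ z : ℝ × ℝ, ∫⁻ w : ℝ × ℝ, ‖d z‖ₑ * ‖d w‖ₑ * (100 * sqrtKernel (z.1 - w.1)) := by
        refine lintegral_mono fun z => lintegral_mono_ae ((hnull z.1).mono fun w hw => ?_)
        rw [hnorm, hnorm]
        gcongr
        exact enorm_integral_windowMeasure_le hμ N hw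
    _ = ∫⁻ z : ℝ × ℝ, 100 * (‖d z‖ₑ * ∫⁻ w : ℝ × ℝ, ‖d w‖ₑ * sqrtKernel (z.1 - w.1)) := by
        refine lintegral_congr fun z => ?_
        rw [← lintegral_const_mul _ (by fun_prop), ← lintegral_const_mul _ (by fun_prop)]
        refine lintegral_congr fun w => ?_
        ring
    _ ≤ ∫⁻ z : ℝ × ℝ, 100 * (‖d z‖ₑ * g z.1) := by
        gcongr with z
        exact h.lintegral_enorm_mul_le (g := fun y => sqrtKernel (z.1 - y)) (by fun_prop)
          (by norm_num)
    _ = 100 * ∫⁻ z : ℝ × ℝ, ‖d z‖ₑ * g z.1 := lintegral_const_mul _ (by fun_prop)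
    _ ≤ 100 * ∫⁻ x, ENNReal.ofReal (n x) ^ (3 / 4 : ℝ) * g x := by
        gcongr
        exact h.lintegral_enorm_mul_le hgm (by norm_num)
    _ ≤ 100 * 12 := by
        gcongr
        have hHLS := lintegral_lintegral_sqrtKernel_le (n := fun x => ENNReal.ofReal (n x))
          (by fun_prop) h.lintegral_n (by simp)
        refine le_trans (le_of_eq ?_) hHLS
        refine lintegral_congr fun x => ?_
        rw [← lintegral_const_mul _ (by fun_prop)]
        refine lintegral_congr fun y => ?_
        have : sqrtKernel (x - y) = sqrtKernel (y - x) := by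
          unfold sqrtKernel
          rw [abs_sub_comm]
        rw [this]
        ring
    _ = _ := by norm_num

/-- The maximal function endpoint. -/
theorem dualBound_neg_quarter {ν μ b : ℝ} (hμ : μ ≠ 0) (hb : 1 / 2 < b) :
    DualBound ν μ (-(1 / 4)) b (3 / 4) 1 := by
  set I₀ : ℝ≥0∞ := ∫⁻ σ : ℝ, ENNReal.ofReal ((1 + σ ^ 2) ^ (-b)) with hI
  have hItop : I₀ ≠ ∞ := lintegral_bracket_ne_top hb
  have hAtop : I₀ * 1200 ≠ ∞ := by finiteness
  refine dualBound_of_lintegral_le (by norm_num) (by norm_num) (C := √(I₀ * 1200).toReal)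
    (Real.sqrt_nonneg _) ?_
  intro R M N e k n h
  rw [Real.sq_sqrt ENNReal.toReal_nonneg, ENNReal.ofReal_toReal hAtop]
  have hTm := measurable_dualTransform h (3 / 4) 1
  set T := dualTransform (3 / 4) 1 e k n with hT
  calc ∫⁻ ξ in freqWindow ν μ N, ∫⁻ τ, ENNReal.ofReal (wt ν μ (-(1 / 4)) b (ξ, τ)) ^ 2 *
        ‖T (ξ, τ)‖ₑ ^ 2
      = ∫⁻ ξ in freqWindow ν μ N, ∫⁻ σ, ENNReal.ofReal ((1 + σ ^ 2) ^ (-b)) *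
        (ENNReal.ofReal (|ξ| ^ (-(1 / 2) : ℝ)) * ‖T (ξ, phase ν μ ξ + σ)‖ₑ ^ 2) := by
        refine lintegral_congr fun ξ => ?_
        rw [← lintegral_add_left_eq_self _ (phase ν μ ξ)]
        refine lintegral_congr fun σ => ?_
        rw [ofReal_wt_sq]
        simp only [add_sub_cancel_left]
        rw [show (2 * -(1 / 4) : ℝ) = -(1 / 2) by norm_num]
        ring
    _ = ∫⁻ σ, ∫⁻ ξ in freqWindow ν μ N, ENNReal.ofReal ((1 + σ ^ 2) ^ (-b)) *
        (ENNReal.ofReal (|ξ| ^ (-(1 / 2) : ℝ)) * ‖T (ξ, phase ν μ ξ + σ)‖ₑ ^ 2) :=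
        lintegral_lintegral_swap (by fun_prop)
    _ ≤ ∫⁻ σ, ENNReal.ofReal ((1 + σ ^ 2) ^ (-b)) * 1200 := by
        refine lintegral_mono fun σ => ?_
        rw [lintegral_const_mul _ (by fun_prop)]
        gcongr
        refine le_trans (le_of_eq ?_) (lintegral_windowMeasure_le (ν := ν) hμ N h σ)
        rw [windowMeasure, lintegral_withDensity_eq_lintegral_mul _ (by fun_prop)
          (by simp only [← hT]; fun_prop)]
        rfl
    _ = I₀ * 1200 := lintegral_mul_const _ (by fun_prop)

theorem rexp_mul_le_one_add {x B : ℝ} (h0 : 0 ≤ x) (h1 : x ≤ 1) : rexp (x * B) ≤ 1 + rexp B := by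
  rcases le_total 0 B with hB | hB
  · have : rexp (x * B) ≤ rexp B := Real.exp_le_exp.2 (by nlinarith)
    linarith
  · have : rexp (x * B) ≤ 1 := Real.exp_le_one_iff.2 (mul_nonpos_of_nonneg_of_nonpos h0 hB)
    have := Real.exp_pos B
    linarith

theorem abs_mul_rexp_mul_le {δ x B : ℝ} (hδ : 0 < δ) (h0 : δ ≤ x) (h1 : x ≤ 1 - δ) :
    |B| * rexp (x * B) ≤ δ⁻¹ * (1 + rexp B) := by
  rw [le_inv_mul_iff₀ hδ, ← mul_assoc]
  rcases le_total 0 B with hB | hB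
  · rw [abs_of_nonneg hB]
    have e1 : δ * B ≤ rexp (δ * B) := by linarith [Real.add_one_le_exp (δ * B)]
    calc _ ≤ rexp (δ * B) * rexp ((1 - δ) * B) := by gcongr
      _ = rexp B := by rw [← Real.exp_add]; congr 1; ring
      _ ≤ _ := by linarith
  · rw [abs_of_nonpos hB]
    have e1 : δ * -B ≤ rexp (δ * -B) := by linarith [Real.add_one_le_exp (δ * -B)]
    have e2 : x * B ≤ δ * B := mul_le_mul_of_nonpos_right h0 hB
    calc _ ≤ rexp (δ * -B) * rexp (δ * B) := by gcongr
      _ = 1 := by rw [← Real.exp_add]; simp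
      _ ≤ _ := by linarith [Real.exp_pos B]

/-- The three lines theorem for the analytic family `z ↦ ∫ A exp(zB)`. -/
theorem norm_integral_mul_cexp_le {Ω : Type*} [MeasurableSpace Ω] {m : Measure Ω} {A : Ω → ℂ}
    {B : Ω → ℝ} (hA : Integrable A m) (hB : Measurable B)
    (hAB : Integrable (fun v => A v * (rexp (B v) : ℂ)) m) {K : ℝ} (hK : 0 ≤ K)
    (h0 : ∀ z : ℂ, z.re = 0 → ‖∫ v, A v * Complex.exp (z * B v) ∂m‖ ≤ K)
    (h1 : ∀ z : ℂ, z.re = 1 → ‖∫ v, A v * Complex.exp (z * B v) ∂m‖ ≤ K) {l : ℝ}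
    (hl : l ∈ Set.Icc (0 : ℝ) 1) : ‖∫ v, A v * Complex.exp ((l : ℂ) * B v) ∂m‖ ≤ K := by
  set f : ℂ → ℂ := fun z => ∫ v, A v * Complex.exp (z * B v) ∂m with hf
  have hbd : Integrable (fun v => ‖A v‖ * (1 + rexp (B v))) m := by
    refine (hA.norm.add hAB.norm).congr (ae_of_all _ fun v => ?_)
    simp only [Pi.add_apply, norm_mul, Complex.norm_real, Real.norm_eq_abs, Real.abs_exp]
    ring
  have hnorm : ∀ (z : ℂ) v, ‖Complex.exp (z * B v)‖ = rexp (z.re * B v) := by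
    intro z v
    rw [Complex.norm_exp]
    congr 1
    simp
  have hmeas : ∀ z : ℂ, AEStronglyMeasurable (fun v => A v * Complex.exp (z * B v)) m := by
    intro z
    exact hA.aestronglyMeasurable.mul (Measurable.aestronglyMeasurable (by fun_prop))
  have hle : ∀ z : ℂ, 0 ≤ z.re → z.re ≤ 1 → ∀ v,
      ‖A v * Complex.exp (z * B v)‖ ≤ ‖A v‖ * (1 + rexp (B v)) := by
    intro z hz0 hz1 v
    rw [norm_mul, hnorm]
    gcongr
    exact rexp_mul_le_one_add hz0 hz1
  have hcl : closure (Complex.HadamardThreeLines.verticalStrip 0 1) ⊆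
      Complex.HadamardThreeLines.verticalClosedStrip 0 1 :=
    closure_minimal (Set.preimage_mono Set.Ioo_subset_Icc_self)
      (isClosed_Icc.preimage Complex.continuous_re)
  have hcont : ContinuousOn f (Complex.HadamardThreeLines.verticalClosedStrip 0 1) := by
    refine continuousOn_of_dominated (bound := fun v => ‖A v‖ * (1 + rexp (B v)))
      (fun z _ => hmeas z) (fun z hz => ae_of_all _ (hle z hz.1 hz.2)) hbd
      (ae_of_all _ fun v => Continuous.continuousOn (by fun_prop))
  have hdiff : DifferentiableOn ℂ f (Complex.HadamardThreeLines.verticalStrip 0 1) := by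
    intro z hz
    obtain ⟨hz0, hz1⟩ := hz
    set δ : ℝ := min z.re (1 - z.re) / 2 with hδ
    have hδ0 : 0 < δ := by
      have : 0 < min z.re (1 - z.re) := lt_min hz0 (by linarith)
      positivity
    have hδ1 : 2 * δ ≤ z.re := by rw [hδ]; linarith [min_le_left z.re (1 - z.re)]
    have hδ2 : 2 * δ ≤ 1 - z.re := by rw [hδ]; linarith [min_le_right z.re (1 - z.re)]
    have hre : ∀ w ∈ Metric.ball z δ, δ ≤ w.re ∧ w.re ≤ 1 - δ := by
      intro w hw
      rw [Metric.mem_ball, dist_eq_norm] at hw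
      have := (Complex.abs_re_le_norm (w - z)).trans_lt hw
      rw [Complex.sub_re, abs_lt] at this
      constructor <;> linarith
    have := hasDerivAt_integral_of_dominated_loc_of_deriv_le (μ := m) (x₀ := z)
      (F := fun w v => A v * Complex.exp (w * B v))
      (F' := fun w v => A v * (Complex.exp (w * B v) * B v))
      (bound := fun v => δ⁻¹ * (‖A v‖ * (1 + rexp (B v)))) (s := Metric.ball z δ)
      (Metric.ball_mem_nhds z hδ0) (Filter.Eventually.of_forall hmeas)
      (hbd.mono' (hmeas z) (ae_of_all _ (hle z hz0.le hz1.le)))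
      (hA.aestronglyMeasurable.mul (Measurable.aestronglyMeasurable (by fun_prop)))
      (ae_of_all _ fun v w hw => ?_) (hbd.const_mul _) (ae_of_all _ fun v w hw => ?_)
    · exact this.2.differentiableAt.differentiableWithinAt
    · rw [norm_mul, norm_mul, hnorm, Complex.norm_real, Real.norm_eq_abs, mul_comm (rexp _)]
      calc _ ≤ ‖A v‖ * (δ⁻¹ * (1 + rexp (B v))) := by
            exact mul_le_mul_of_nonneg_left
              (abs_mul_rexp_mul_le hδ0 (hre w hw).1 (hre w hw).2) (norm_nonneg _)
        _ = _ := by ring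
    · exact (((hasDerivAt_id w).mul_const (B v : ℂ)).cexp.const_mul (A v)).congr_deriv (by simp)
  have hbdd : BddAbove ((norm ∘ f) '' Complex.HadamardThreeLines.verticalClosedStrip 0 1) := by
    refine ⟨∫ v, ‖A v‖ * (1 + rexp (B v)) ∂m, ?_⟩
    rintro _ ⟨z, hz, rfl⟩
    exact norm_integral_le_of_norm_le hbd (ae_of_all _ (hle z hz.1 hz.2))
  have := Complex.HadamardThreeLines.norm_le_interp_of_mem_verticalClosedStrip'
    (f := f) (z := (l : ℂ)) (a := K) (b := K) (l := 0) (u := 1) zero_lt_one (by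
      simpa [Complex.HadamardThreeLines.verticalClosedStrip] using hl)
    ⟨hdiff, hcont.mono hcl⟩ hbdd (fun z hz => h0 z hz) (fun z hz => h1 z hz)
  refine this.trans (le_of_eq ?_)
  rw [← Real.rpow_add_of_nonneg hK]
  · simp
  · simpa using hl.2
  · simpa using hl.1

/-- Multiplication by the unimodular factor `exp(iyL)`. -/
def rotate (y : ℝ) (L : ℝ × ℝ → ℝ) (e : ℝ × ℝ → ℂ) (z : ℝ × ℝ) : ℂ :=
  e z * Complex.exp (Complex.I * ((y * L z : ℝ) : ℂ))

theorem norm_rotate (y : ℝ) (L : ℝ × ℝ → ℝ) (e : ℝ × ℝ → ℂ) (z : ℝ × ℝ) :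
    ‖rotate y L e z‖ = ‖e z‖ := by
  rw [rotate, norm_mul, Complex.norm_exp_I_mul_ofReal, mul_one]

theorem rotate_ne_zero {y : ℝ} {L : ℝ × ℝ → ℝ} {e : ℝ × ℝ → ℂ} {z : ℝ × ℝ}
    (h : rotate y L e z ≠ 0) : e z ≠ 0 := by
  intro h0
  exact h (by rw [rotate, h0, zero_mul])

theorem measurable_rotate (y : ℝ) {L : ℝ × ℝ → ℝ} (hL : Measurable L) {e : ℝ × ℝ → ℂ}
    (he : Measurable e) : Measurable (rotate y L e) := by
  unfold rotate
  fun_prop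

theorem IsDualDatum.rotate {R M : ℝ} {e : ℝ × ℝ → ℂ} {k : ℝ × ℝ → ℝ} {n : ℝ → ℝ}
    (h : IsDualDatum R M e k n) (y : ℝ) {L : ℝ × ℝ → ℝ} (hL : Measurable L) :
    IsDualDatum R M (rotate y L e) k n :=
  { h with
    measurable_e := measurable_rotate y hL h.measurable_e
    norm_e_le := fun z => by rw [norm_rotate]; exact h.norm_e_le z
    support_e := fun z hz => h.support_e z (rotate_ne_zero hz) }

theorem IsTest.rotate {ν μ N B : ℝ} {ψ : ℝ × ℝ → ℂ} (h : IsTest ν μ N B ψ) (y : ℝ)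
    {L : ℝ × ℝ → ℝ} (hL : Measurable L) : IsTest ν μ N B (rotate y L ψ) where
  measurable := measurable_rotate y hL h.measurable
  norm_le w := by rw [norm_rotate]; exact h.norm_le w
  support w hw := h.support w (rotate_ne_zero hw)

theorem rpow_mul_exp_log {x : ℝ} (hx : 0 < x) (p q l : ℝ) :
    x ^ p * rexp (l * ((q - p) * Real.log x)) = x ^ ((1 - l) * p + l * q) := by
  rw [Real.rpow_def_of_pos hx, Real.rpow_def_of_pos hx, ← Real.exp_add]
  congr 1
  ring

theorem convexComb_pos {p q l : ℝ} (hp : 0 < p) (hq : 0 < q) (hl : l ∈ Set.Icc (0 : ℝ) 1) :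
    0 < (1 - l) * p + l * q := by
  rcases hl.1.eq_or_lt with h | h
  · rw [← h]; simpa using hp
  · have := mul_nonneg (sub_nonneg.2 hl.2) hp.le
    have := mul_pos h hq
    linarith

/-- Interpolation of dual bounds along a segment of parameters. -/
theorem DualBound.interpolate {ν μ α₀ b₀ P₀ Q₀ α₁ b₁ P₁ Q₁ : ℝ}
    (h₀ : DualBound ν μ α₀ b₀ P₀ Q₀) (h₁ : DualBound ν μ α₁ b₁ P₁ Q₁)
    (hP₀ : 0 < P₀) (hQ₀ : 0 < Q₀) (hP₁ : 0 < P₁) (hQ₁ : 0 < Q₁) {l : ℝ}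
    (hl : l ∈ Set.Icc (0 : ℝ) 1) :
    DualBound ν μ ((1 - l) * α₀ + l * α₁) ((1 - l) * b₀ + l * b₁) ((1 - l) * P₀ + l * P₁)
      ((1 - l) * Q₀ + l * Q₁) := by
  obtain ⟨C₀, hC₀, h₀⟩ := h₀
  obtain ⟨C₁, hC₁, h₁⟩ := h₁
  refine ⟨max C₀ C₁, le_max_of_le_left hC₀, fun R M N D e k n ψ X hd hψ hX hψX => ?_⟩
  have hkm := hd.measurable_k
  have hnm := hd.measurable_n
  set L₁ : ℝ × ℝ → ℝ := fun z => (Q₁ - Q₀) * Real.log (k z) + (P₁ - P₀) * Real.log (n z.1) with hL₁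
  set L₂ : ℝ × ℝ → ℝ := fun w => (α₁ - α₀) * Real.log |w.1| +
    (-(b₁ / 2) - -(b₀ / 2)) * Real.log (1 + (w.2 - phase ν μ w.1) ^ 2) with hL₂
  have hL₁m : Measurable L₁ := by fun_prop
  have hL₂m : Measurable L₂ := by fun_prop
  set I : ℝ → ℝ → (ℝ × ℝ) × (ℝ × ℝ) → ℂ := fun l y v =>
    rotate y L₂ ψ v.2 * (wt ν μ ((1 - l) * α₀ + l * α₁) ((1 - l) * b₀ + l * b₁) v.2 : ℂ) *
      dualFun ((1 - l) * P₀ + l * P₁) ((1 - l) * Q₀ + l * Q₁) (rotate y L₁ e) k n v.1 *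
      char2 v.1 v.2 with hI
  have hIint : ∀ l ∈ Set.Icc (0 : ℝ) 1, ∀ y, Integrable (I l y) := fun l hl y =>
    integrable_dualForm (hd.rotate y hL₁m) (hψ.rotate y hL₂m) (convexComb_pos hP₀ hP₁ hl).le
      (convexComb_pos hQ₀ hQ₁ hl).le _ _
  have hkey : ∀ z : ℂ, z.re ∈ Set.Icc (0 : ℝ) 1 → ∀ v,
      I 0 0 v * Complex.exp (z * ((L₁ v.1 + L₂ v.2 : ℝ) : ℂ)) = I z.re z.im v := by
    intro z hz v
    by_cases hψ0 : ψ v.2 = 0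
    · simp [hI, rotate, hψ0]
    by_cases hk0 : k v.1 = 0
    · have h1 := (convexComb_pos hQ₀ hQ₁ hz).ne'
      have h2 := (convexComb_pos hQ₀ hQ₁ (Set.left_mem_Icc.2 zero_le_one)).ne'
      simp only [hI, dualFun, hk0, Real.zero_rpow h1, Real.zero_rpow h2]
      simp
    by_cases hn0 : n v.1.1 = 0
    · have h1 := (convexComb_pos hP₀ hP₁ hz).ne'
      have h2 := (convexComb_pos hP₀ hP₁ (Set.left_mem_Icc.2 zero_le_one)).ne'
      simp only [hI, dualFun, hn0, Real.zero_rpow h1, Real.zero_rpow h2]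
      simp
    have hk : 0 < k v.1 := lt_of_le_of_ne (hd.k_nonneg _) (Ne.symm hk0)
    have hn : 0 < n v.1.1 := lt_of_le_of_ne (hd.n_nonneg _) (Ne.symm hn0)
    have hξ : 0 < |v.2.1| := (aconst_pos ν μ).trans_le (hψ.support _ hψ0).1
    have hbr : 0 < 1 + (v.2.2 - phase ν μ v.2.1) ^ 2 := by positivity
    have hexp : Complex.exp (z * ((L₁ v.1 + L₂ v.2 : ℝ) : ℂ)) =
        ((rexp (z.re * L₁ v.1) * rexp (z.re * L₂ v.2) : ℝ) : ℂ) *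
          (Complex.exp (Complex.I * ((z.im * L₁ v.1 : ℝ) : ℂ)) *
            Complex.exp (Complex.I * ((z.im * L₂ v.2 : ℝ) : ℂ))) := by
      push_cast
      rw [← Complex.exp_add, ← Complex.exp_add, ← Complex.exp_add]
      congr 1
      nth_rewrite 1 [← Complex.re_add_im z]
      ring
    have e1 : wt ν μ ((1 - z.re) * α₀ + z.re * α₁) ((1 - z.re) * b₀ + z.re * b₁) v.2 =
        wt ν μ α₀ b₀ v.2 * rexp (z.re * L₂ v.2) := by
      rw [hL₂, mul_add, Real.exp_add, wt, wt, ← rpow_mul_exp_log hξ]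
      rw [show -(((1 - z.re) * b₀ + z.re * b₁) / 2) =
        (1 - z.re) * -(b₀ / 2) + z.re * -(b₁ / 2) by ring, ← rpow_mul_exp_log hbr]
      ring
    have e2 : k v.1 ^ ((1 - z.re) * Q₀ + z.re * Q₁) * n v.1.1 ^ ((1 - z.re) * P₀ + z.re * P₁) =
        (k v.1 ^ Q₀ * n v.1.1 ^ P₀) * rexp (z.re * L₁ v.1) := by
      rw [hL₁, mul_add, Real.exp_add, ← rpow_mul_exp_log hk, ← rpow_mul_exp_log hn]
      ring
    rw [hexp]
    simp only [hI, dualFun, e1, e2, rotate]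
    simp only [sub_zero, one_mul, zero_mul, add_zero, Complex.ofReal_zero, mul_zero,
      Complex.exp_zero, mul_one]
    push_cast
    ring
  have hmem0 : (0 : ℝ) ∈ Set.Icc (0 : ℝ) 1 := Set.left_mem_Icc.2 zero_le_one
  have hmem1 : (1 : ℝ) ∈ Set.Icc (0 : ℝ) 1 := Set.right_mem_Icc.2 zero_le_one
  have hrot : ∀ y, ∫⁻ w, ‖rotate y L₂ ψ w‖ₑ ^ 2 ≤ ENNReal.ofReal (X ^ 2) := by
    intro y
    refine le_trans (le_of_eq ?_) hψX
    refine lintegral_congr fun w => ?_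
    rw [← ofReal_norm, norm_rotate, ofReal_norm]
  have hmain := norm_integral_mul_cexp_le (m := volume) (A := I 0 0)
    (B := fun v => L₁ v.1 + L₂ v.2) (hIint 0 hmem0 0) (by fun_prop) (by
      refine (hIint 1 hmem1 0).congr (ae_of_all _ fun v => ?_)
      have := hkey 1 (by simp) v
      rw [one_mul, Complex.one_re, Complex.one_im] at this
      rw [← this, ← Complex.ofReal_exp])
    (K := max C₀ C₁ * X) (mul_nonneg (le_max_of_le_left hC₀) hX)
    (fun z hz => ?_) (fun z hz => ?_) hl
  · have : ∀ v, I 0 0 v * Complex.exp ((l : ℂ) * ((L₁ v.1 + L₂ v.2 : ℝ) : ℂ)) = I l 0 v := by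
      intro v
      have := hkey (l : ℂ) (by simpa using hl) v
      simpa using this
    simp only [this] at hmain
    refine le_trans (le_of_eq ?_) hmain
    simp [dualForm, hI, rotate, dualFun]
  · simp only [hkey z (by rw [hz]; exact hmem0), hz]
    have := h₀ R M N D _ k n _ X (hd.rotate z.im hL₁m) (hψ.rotate z.im hL₂m) hX (hrot _)
    refine le_trans (le_of_eq ?_) (this.trans (mul_le_mul_of_nonneg_right (le_max_left _ _) hX))
    simp [dualForm, hI]
  · simp only [hkey z (by rw [hz]; exact hmem1), hz]
    have := h₁ R M N D _ k n _ X (hd.rotate z.im hL₁m) (hψ.rotate z.im hL₂m) hX (hrot _)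
    refine le_trans (le_of_eq ?_) (this.trans (mul_le_mul_of_nonneg_right (le_max_right _ _) hX))
    simp [dualForm, hI]

/-- The dual bound for the full range of parameters. -/
theorem dualBound_of_mem_Icc {ν μ : ℝ} (hμ : μ ≠ 0) {θ α b : ℝ} (hθ : θ ∈ Set.Icc (0 : ℝ) 1)
    (hα : α ∈ Set.Icc (-(θ / 4)) θ) (hb : θ / 2 < b) :
    DualBound ν μ α b (1 - (1 / 2 - α / 5 - 3 * θ / 10)) (1 - (1 / 2 + 2 * α / 5 - 2 * θ / 5)) := by
  rcases hθ.1.eq_or_lt with h0 | h0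
  · have hα0 : α = 0 := by
      have h1 := hα.1
      have h2 := hα.2
      rw [← h0] at h1 h2
      linarith
    rw [← h0, hα0]
    rw [← h0] at hb
    convert dualBound_zero (ν := ν) (μ := μ) (b := b) (by linarith) using 1 <;> norm_num
  · have hb1 : 1 / 2 < b / θ := by
      rw [lt_div_iff₀ h0]; linarith
    have hα1 : α / θ ≤ 1 := (div_le_one h0).2 hα.2
    have hα2 : -(1 / 4) ≤ α / θ := by
      rw [le_div_iff₀ h0]
      linarith [hα.1]
    set l : ℝ := (1 - α / θ) * (4 / 5) with hl
    have hlm : l ∈ Set.Icc (0 : ℝ) 1 := ⟨by linarith, by linarith⟩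
    have hBC := (dualBound_one (ν := ν) hμ hb1).interpolate (dualBound_neg_quarter (ν := ν) hμ hb1)
      (by norm_num) (by norm_num) (by norm_num) (by norm_num) hlm
    have hA := dualBound_zero (ν := ν) (μ := μ) (b := 0) le_rfl
    have := hA.interpolate hBC (by norm_num) (by norm_num) (convexComb_pos (by norm_num)
      (by norm_num) hlm) (convexComb_pos (by norm_num) (by norm_num) hlm) hθ
    have hαθ : α = α / θ * θ := by field_simp
    convert this using 1
    · rw [hl]; field_simp; ring
    · field_simp; ring
    · rw [hl]; field_simp; ring
    · rw [hl]; field_simp; ring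

theorem ENNReal.mul_rpow_rpow_one_sub {a : ℝ≥0∞} {p : ℝ} (hp : 0 < p) (ha : a ≠ ∞) :
    a * (a ^ p) ^ (1 - 1 / p) = a ^ p := by
  by_cases h0 : a = 0
  · rw [h0, ENNReal.zero_rpow_of_pos hp, zero_mul]
  nth_rewrite 1 [← ENNReal.rpow_one a]
  rw [← ENNReal.rpow_mul, ← ENNReal.rpow_add _ _ h0 ha]
  congr 1
  field_simp
  ring

theorem ENNReal.mul_inv_rpow_one_sub {S : ℝ≥0∞} (p : ℝ) (h0 : S ≠ 0) (ht : S ≠ ∞) :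
    S * S⁻¹ ^ (1 - 1 / p) = S ^ (1 / p) := by
  nth_rewrite 1 [← ENNReal.rpow_one S]
  rw [ENNReal.inv_rpow, ← ENNReal.rpow_neg, ← ENNReal.rpow_add _ _ h0 ht]
  congr 1
  ring

theorem lintegral_le_of_tendsto {Z : Type*} [MeasureSpace Z]
    {F : ℕ → Z → ℝ≥0∞} {f : Z → ℝ≥0∞} {C : ℝ≥0∞}
    (hF : ∀ m, Measurable (F m))
    (hlim : ∀ x, Filter.Tendsto (fun m => F m x) Filter.atTop (nhds (f x)))
    (hle : ∀ m, ∫⁻ x, F m x ≤ C) : ∫⁻ x, f x ≤ C :=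
  calc _ = ∫⁻ x, Filter.liminf (fun m => F m x) Filter.atTop :=
        lintegral_congr fun x => (hlim x).liminf_eq.symm
    _ ≤ Filter.liminf (fun m => ∫⁻ x, F m x) Filter.atTop := lintegral_liminf_le hF
    _ ≤ _ := Filter.liminf_le_of_le (by isBoundedDefault) fun c hc => by
        obtain ⟨m, hm⟩ := hc.exists
        exact hm.trans (hle m)

/-- From bounded compactly supported dual data to arbitrary finite-valued ones. -/
theorem lintegral_enorm_mul_le_of_pairing {G : ℝ × ℝ → ℂ} (hG : Continuous G) {P Q C : ℝ}
    (hP : 0 ≤ P) (hQ : 0 ≤ Q)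
    (H : ∀ R M e k n, IsDualDatum R M e k n → ‖∫ z, G z * dualFun P Q e k n z‖ ≤ C)
    {K : ℝ × ℝ → ℝ≥0∞} (hK : Measurable K) (hK1 : ∀ x, ∫⁻ t, K (x, t) ≤ 1) (hKt : ∀ z, K z ≠ ∞)
    {n : ℝ → ℝ≥0∞} (hn : Measurable n) (hn1 : ∫⁻ x, n x ≤ 1) (hnt : ∀ x, n x ≠ ∞) :
    ∫⁻ z, ‖G z‖ₑ * (K z ^ Q * n z.1 ^ P) ≤ ENNReal.ofReal C := by
  have hGm := hG.measurable
  set box : ℕ → Set (ℝ × ℝ) := fun m => Set.Icc (-(m : ℝ)) m ×ˢ Set.Icc (-(m : ℝ)) m with hbox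
  have hboxm : ∀ m, MeasurableSet (box m) := fun m => measurableSet_Icc.prod measurableSet_Icc
  set F : ℕ → ℝ × ℝ → ℝ≥0∞ := fun m => (box m).indicator fun z =>
    ‖G z‖ₑ * ((min (K z) m) ^ Q * (min (n z.1) m) ^ P) with hF
  have hFm : ∀ m, Measurable (F m) := fun m =>
    Measurable.indicator (by fun_prop) (hboxm m)
  have hle : ∀ m, ∫⁻ z, F m z ≤ ENNReal.ofReal C := by
    intro m
    have htop : ∀ a : ℝ≥0∞, min a (m : ℝ≥0∞) ≠ ∞ := fun a =>
      ((min_le_right _ _).trans_lt (ENNReal.natCast_lt_top m)).ne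
    have hmin : ∀ a : ℝ≥0∞, (min a (m : ℝ≥0∞)).toReal ≤ m := fun a =>
      ENNReal.toReal_le_of_le_ofReal (by positivity) (by simp)
    set e : ℝ × ℝ → ℂ := (box m).indicator fun z => (starRingEnd ℂ) (G z) / (‖G z‖ : ℂ) with he
    set k' : ℝ × ℝ → ℝ := fun z => (min (K z) m).toReal with hk'
    set n' : ℝ → ℝ := fun x => (min (n x) m).toReal with hn'
    have hd : IsDualDatum m m e k' n' :=
      { measurable_e := by
          have := Complex.continuous_conj.measurable.comp hGm
          exact Measurable.indicator (by fun_prop) (hboxm m)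
        norm_e_le := by
          intro z
          refine (norm_indicator_le_norm_self _ _).trans ?_
          rw [norm_div, RCLike.norm_conj, Complex.norm_real, norm_norm]
          exact div_self_le_one _
        support_e := by
          intro z hz
          have : z ∈ box m := Set.mem_of_indicator_ne_zero hz
          exact ⟨abs_le.2 this.1, abs_le.2 this.2⟩
        measurable_k := by fun_prop
        k_nonneg := fun z => ENNReal.toReal_nonneg
        k_le := fun z => hmin _
        lintegral_k := by
          intro x
          refine le_trans (lintegral_mono fun t => ?_) (hK1 x)
          rw [hk', ENNReal.ofReal_toReal (htop _)]
          exact min_le_left _ _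
        measurable_n := by fun_prop
        n_nonneg := fun z => ENNReal.toReal_nonneg
        n_le := fun z => hmin _
        lintegral_n := by
          refine le_trans (lintegral_mono fun t => ?_) hn1
          rw [hn', ENNReal.ofReal_toReal (htop _)]
          exact min_le_left _ _ }
    have h := H m m e k' n' hd
    set r : ℝ × ℝ → ℝ := (box m).indicator fun z => ‖G z‖ * (k' z ^ Q * n' z.1 ^ P) with hr
    have hr0 : ∀ z, 0 ≤ r z := fun z => Set.indicator_nonneg (fun z _ => by positivity) z
    have hrm : Measurable r := by
      have := hd.measurable_k
      have := hd.measurable_n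
      exact Measurable.indicator (by fun_prop) (hboxm m)
    have hrG : ∀ z, G z * dualFun P Q e k' n' z = (r z : ℂ) := by
      intro z
      by_cases hz : z ∈ box m
      · rw [hr, dualFun, he, Set.indicator_of_mem hz, Set.indicator_of_mem hz]
        by_cases hG0 : G z = 0
        · simp [hG0]
        · have : (‖G z‖ : ℂ) ≠ 0 := by simpa using hG0
          push_cast
          rw [← mul_assoc, mul_div_assoc', Complex.mul_conj, Complex.normSq_eq_norm_sq]
          push_cast
          field_simp
      · rw [hr, dualFun, he, Set.indicator_of_notMem hz, Set.indicator_of_notMem hz]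
        simp
    have hri : Integrable r := by
      have hGi : IntegrableOn G (box m) :=
        hG.continuousOn.integrableOn_compact (isCompact_Icc.prod isCompact_Icc)
      have := ((integrable_indicator_iff (hboxm m)).2 hGi.norm).mul_const
        ((m : ℝ) ^ Q * (m : ℝ) ^ P)
      refine this.mono' hrm.aestronglyMeasurable (ae_of_all _ fun z => ?_)
      rw [Real.norm_of_nonneg (hr0 z), hr, ← Set.indicator_mul_const]
      refine Set.indicator_le_indicator ?_
      have h1 := hd.k_le z
      have h2 := hd.n_le z.1
      have h3 := hd.k_nonneg z
      have h4 := hd.n_nonneg z.1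
      gcongr
    simp only [hrG] at h
    rw [integral_complex_ofReal, Complex.norm_real,
      Real.norm_of_nonneg (integral_nonneg hr0)] at h
    have h' := ENNReal.ofReal_le_ofReal h
    rw [ofReal_integral_eq_lintegral_ofReal hri (ae_of_all _ hr0)] at h'
    refine le_trans (le_of_eq ?_) h'
    refine lintegral_congr fun z => ?_
    by_cases hz : z ∈ box m
    · rw [hF, hr]
      simp only
      rw [Set.indicator_of_mem hz, Set.indicator_of_mem hz,
        ENNReal.ofReal_mul (norm_nonneg _), ofReal_norm,
        ENNReal.ofReal_mul (Real.rpow_nonneg ENNReal.toReal_nonneg _),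
        ← ENNReal.ofReal_rpow_of_nonneg ENNReal.toReal_nonneg hQ,
        ← ENNReal.ofReal_rpow_of_nonneg ENNReal.toReal_nonneg hP,
        ENNReal.ofReal_toReal (htop _), ENNReal.ofReal_toReal (htop _)]
    · rw [hF, hr]
      simp only
      rw [Set.indicator_of_notMem hz, Set.indicator_of_notMem hz, ENNReal.ofReal_zero]
  refine lintegral_le_of_tendsto hFm (fun z => tendsto_const_nhds.congr' ?_) hle
  filter_upwards [Filter.eventually_ge_atTop ⌈|z.1|⌉₊, Filter.eventually_ge_atTop ⌈|z.2|⌉₊,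
    Filter.eventually_ge_atTop ⌈(K z).toReal⌉₊,
    Filter.eventually_ge_atTop ⌈(n z.1).toReal⌉₊] with m h1 h2 h3 h4
  have hz : z ∈ box m := ⟨abs_le.1 (Nat.ceil_le.1 h1), abs_le.1 (Nat.ceil_le.1 h2)⟩
  have hto : ∀ a : ℝ≥0∞, a ≠ ∞ → ⌈a.toReal⌉₊ ≤ m → a ≤ m := by
    intro a ha h
    rw [← ENNReal.ofReal_toReal ha, ← ENNReal.ofReal_natCast]
    exact ENNReal.ofReal_le_ofReal (Nat.ceil_le.1 h)
  rw [hF]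
  simp only
  rw [Set.indicator_of_mem hz, min_eq_left (hto _ (hKt z) h3), min_eq_left (hto _ (hnt _) h4)]

/-- Converse Hölder inequality for finite exponents. -/
theorem lintegral_rpow_le_of_forall_dual {g : ℝ → ℝ≥0∞} (hg : Measurable g) {p P : ℝ} (hp : 1 ≤ p)
    (hP : P = 1 - 1 / p) {C : ℝ≥0∞}
    (H : ∀ n : ℝ → ℝ≥0∞, Measurable n → ∫⁻ x, n x ≤ 1 → (∀ x, n x ≠ ∞) →
      ∫⁻ x, g x * n x ^ P ≤ C) :
    (∫⁻ x, g x ^ p) ^ (1 / p) ≤ C := by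
  have hp0 : 0 < p := by linarith
  have hP0 : 0 ≤ P := by
    rw [hP, sub_nonneg, div_le_one hp0]; exact hp
  set gm : ℕ → ℝ → ℝ≥0∞ := fun m => (Set.Icc (-(m : ℝ)) m).indicator fun x => min (g x) m with hgm
  have hgmm : ∀ m, Measurable (gm m) := fun m =>
    Measurable.indicator (by fun_prop) measurableSet_Icc
  have hgb : ∀ m x, gm m x ≤ min (g x) m := fun m x =>
    Set.indicator_apply_le' (fun _ => le_rfl) (fun _ => zero_le)
  have hgle : ∀ m x, gm m x ≤ g x := fun m x => (hgb m x).trans (min_le_left _ _)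
  have hgt : ∀ m x, gm m x ≠ ∞ := fun m x =>
    (((hgb m x).trans (min_le_right _ _)).trans_lt (ENNReal.natCast_lt_top m)).ne
  have hle : ∀ m, (∫⁻ x, gm m x ^ p) ≤ C ^ p := by
    intro m
    set S := ∫⁻ x, gm m x ^ p with hS
    by_cases hS0 : S = 0
    · rw [hS0]; exact zero_le
    have hSt : S ≠ ∞ := by
      have : S ≤ ∫⁻ x, (Set.Icc (-(m : ℝ)) m).indicator (fun _ => (m : ℝ≥0∞) ^ p) x := by
        refine lintegral_mono fun x => ?_
        by_cases hx : x ∈ Set.Icc (-(m : ℝ)) m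
        · rw [hgm]
          simp only
          rw [Set.indicator_of_mem hx, Set.indicator_of_mem hx]
          gcongr
          exact min_le_right _ _
        · rw [hgm]
          simp only
          rw [Set.indicator_of_notMem hx, Set.indicator_of_notMem hx,
            ENNReal.zero_rpow_of_pos hp0]
      refine (this.trans_lt ?_).ne
      rw [lintegral_indicator measurableSet_Icc, setLIntegral_const, Real.volume_Icc]
      exact ENNReal.mul_lt_top (ENNReal.rpow_lt_top_of_nonneg hp0.le (ENNReal.natCast_ne_top m))
        ENNReal.ofReal_lt_top
    have hn := H (fun x => gm m x ^ p * S⁻¹) (by fun_prop) (by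
      rw [lintegral_mul_const _ (by fun_prop)]
      exact ENNReal.mul_inv_le_one S) (fun x => ENNReal.mul_ne_top
        (ENNReal.rpow_ne_top_of_nonneg hp0.le (hgt m x)) (ENNReal.inv_ne_top.2 hS0))
    have h1 : S ^ (1 / p) ≤ C := by
      refine le_trans ?_ hn
      calc S ^ (1 / p) = S * S⁻¹ ^ P := by
            rw [hP, ENNReal.mul_inv_rpow_one_sub p hS0 hSt]
        _ = ∫⁻ x, gm m x ^ p * S⁻¹ ^ P := by
            rw [lintegral_mul_const _ (by fun_prop)]
        _ ≤ ∫⁻ x, g x * (gm m x ^ p * S⁻¹) ^ P := by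
            refine lintegral_mono fun x => ?_
            rw [ENNReal.mul_rpow_of_nonneg _ _ hP0, ← mul_assoc]
            gcongr
            calc gm m x ^ p = gm m x * (gm m x ^ p) ^ P := by
                  rw [hP, ENNReal.mul_rpow_rpow_one_sub hp0 (hgt m x)]
              _ ≤ _ := by gcongr; exact hgle m x
    calc S = (S ^ (1 / p)) ^ p := by
          rw [← ENNReal.rpow_mul, one_div_mul_cancel hp0.ne', ENNReal.rpow_one]
      _ ≤ _ := by gcongr
  have hfin : ∫⁻ x, g x ^ p ≤ C ^ p := by
    refine lintegral_le_of_tendsto (F := fun m x => gm m x ^ p) (fun m => by fun_prop)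
      (fun x => ?_) hle
    refine (ENNReal.continuous_rpow_const.tendsto _).comp ?_
    have h1 : Filter.Tendsto (fun m : ℕ => min (g x) (m : ℝ≥0∞)) Filter.atTop (nhds (g x)) := by
      have := (tendsto_const_nhds (x := g x)).min ENNReal.tendsto_nat_nhds_top
      simpa using this
    refine h1.congr' ?_
    filter_upwards [Filter.eventually_ge_atTop ⌈|x|⌉₊] with m hm
    rw [hgm]
    simp only
    rw [Set.indicator_of_mem (show x ∈ Set.Icc (-(m : ℝ)) m from abs_le.1 (Nat.ceil_le.1 hm))]
  calc _ ≤ (C ^ p) ^ (1 / p) := by gcongr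
    _ = C := by rw [← ENNReal.rpow_mul, mul_one_div_cancel hp0.ne', ENNReal.rpow_one]

theorem lintegral_gaussian_lt_top (A : Set ℝ) :
    ∫⁻ t in A, ENNReal.ofReal (rexp (-t ^ 2)) < ∞ := by
  refine (setLIntegral_le_lintegral _ _).trans_lt ?_
  have h := (integrable_exp_neg_mul_sq (b := 1) one_pos).lintegral_lt_top
  simpa using h

theorem lintegral_gaussian_ne_zero {A : Set ℝ} (hA : volume A ≠ 0) :
    ∫⁻ t in A, ENNReal.ofReal (rexp (-t ^ 2)) ≠ 0 := by
  rw [← pos_iff_ne_zero, lintegral_pos_iff_support (by fun_prop)]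
  have : Function.support (fun t : ℝ => ENNReal.ofReal (rexp (-t ^ 2))) = Set.univ := by
    ext t
    simp [Real.exp_pos]
  rw [this, Measure.restrict_apply_univ, pos_iff_ne_zero]
  exact hA

/-- Converse Hölder inequality for the essential supremum. -/
theorem essSup_le_of_forall_dual {g : ℝ → ℝ≥0∞} (hg : Measurable g) {C : ℝ≥0∞}
    (H : ∀ n : ℝ → ℝ≥0∞, Measurable n → ∫⁻ x, n x ≤ 1 → (∀ x, n x ≠ ∞) →
      ∫⁻ x, g x * n x ^ (1 : ℝ) ≤ C) : essSup g volume ≤ C := by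
  by_contra! hlt
  obtain ⟨c, hCc, hcg⟩ := exists_between hlt
  set A : Set ℝ := {x | c < g x} with hA
  have hAm : MeasurableSet A := measurableSet_lt measurable_const hg
  have hA0 : volume A ≠ 0 := by
    intro h0
    refine hcg.not_ge (essSup_le_of_ae_le c ?_)
    rw [Filter.EventuallyLE, ae_iff]
    simpa [hA] using h0
  set W := ∫⁻ t in A, ENNReal.ofReal (rexp (-t ^ 2)) with hW
  have hW0 : W ≠ 0 := lintegral_gaussian_ne_zero hA0
  have hWt : W ≠ ∞ := (lintegral_gaussian_lt_top A).ne
  have hint : ∫⁻ x, A.indicator (fun t => ENNReal.ofReal (rexp (-t ^ 2))) x * W⁻¹ = 1 := by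
    rw [lintegral_mul_const _ (Measurable.indicator (by fun_prop) hAm), lintegral_indicator hAm,
      ← hW, ENNReal.mul_inv_cancel hW0 hWt]
  have hm : Measurable fun x => A.indicator (fun t => ENNReal.ofReal (rexp (-t ^ 2))) x * W⁻¹ :=
    (Measurable.indicator (by fun_prop) hAm).mul_const _
  have h := H _ hm hint.le fun x => ENNReal.mul_ne_top (by
      by_cases hx : x ∈ A
      · rw [Set.indicator_of_mem hx]; exact ENNReal.ofReal_ne_top
      · rw [Set.indicator_of_notMem hx]; exact ENNReal.zero_ne_top) (ENNReal.inv_ne_top.2 hW0)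
  refine hCc.not_ge (le_trans ?_ h)
  calc c = c * 1 := (mul_one c).symm
    _ = ∫⁻ x, c * (A.indicator (fun t => ENNReal.ofReal (rexp (-t ^ 2))) x * W⁻¹) := by
        rw [lintegral_const_mul _ hm, hint]
    _ ≤ _ := by
        refine lintegral_mono fun x => ?_
        rw [ENNReal.rpow_one]
        by_cases hx : x ∈ A
        · have : c ≤ g x := le_of_lt hx
          gcongr
        · rw [Set.indicator_of_notMem hx]; simp

/-- Inner converse Hölder inequality for a finite exponent. -/
theorem lintegral_lintegral_rpow_mul_le {G : ℝ × ℝ → ℂ} (hG : Continuous G) {q P : ℝ} (hq : 1 ≤ q)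
    (hP : 0 ≤ P) {C : ℝ≥0∞}
    (H : ∀ (K : ℝ × ℝ → ℝ≥0∞) (n : ℝ → ℝ≥0∞), Measurable K → (∀ x, ∫⁻ t, K (x, t) ≤ 1) →
      (∀ z, K z ≠ ∞) → Measurable n → ∫⁻ x, n x ≤ 1 → (∀ x, n x ≠ ∞) →
      ∫⁻ z, ‖G z‖ₑ * (K z ^ (1 - 1 / q) * n z.1 ^ P) ≤ C)
    {n : ℝ → ℝ≥0∞} (hn : Measurable n) (hn1 : ∫⁻ x, n x ≤ 1) (hnt : ∀ x, n x ≠ ∞) :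
    ∫⁻ x, (∫⁻ t, ‖G (x, t)‖ₑ ^ q) ^ (1 / q) * n x ^ P ≤ C := by
  have hq0 : 0 < q := by linarith
  have hQ : 0 ≤ 1 - 1 / q := by
    rw [sub_nonneg, div_le_one hq0]; exact hq
  have hGm := hG.measurable
  set N : ℕ → ℝ → ℝ≥0∞ := fun m x => ∫⁻ t in Set.Icc (-(m : ℝ)) m, ‖G (x, t)‖ₑ ^ q with hN
  have hNm : ∀ m, Measurable (N m) := fun m =>
    Measurable.lintegral_prod_right' (f := fun z : ℝ × ℝ => ‖G z‖ₑ ^ q) (by fun_prop)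
  have hNt : ∀ m x, N m x ≠ ∞ := by
    intro m x
    obtain ⟨B, hB⟩ := (isCompact_Icc (a := -(m : ℝ)) (b := m)).exists_bound_of_continuousOn
      (f := fun t => G (x, t)) (by fun_prop)
    have h1 : N m x ≤ ∫⁻ t in Set.Icc (-(m : ℝ)) m, ENNReal.ofReal B ^ q := by
      refine setLIntegral_mono measurable_const fun t ht => ?_
      gcongr
      rw [← ofReal_norm]
      exact ENNReal.ofReal_le_ofReal (hB t ht)
    refine (h1.trans_lt ?_).ne
    rw [setLIntegral_const, Real.volume_Icc]
    exact ENNReal.mul_lt_top (ENNReal.rpow_lt_top_of_nonneg hq0.le ENNReal.ofReal_ne_top)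
      ENNReal.ofReal_lt_top
  refine lintegral_le_of_tendsto (F := fun m x => N m x ^ (1 / q) * n x ^ P)
    (fun m => by have := hNm m; fun_prop) (fun x => ?_) (fun m => ?_)
  · refine ENNReal.Tendsto.mul_const ?_
      (Or.inr (ENNReal.rpow_ne_top_of_nonneg hP (hnt x)))
    refine (ENNReal.continuous_rpow_const.tendsto _).comp ?_
    refine AECover.lintegral_tendsto_of_countably_generated (aecover_Icc ?_ ?_) ?_
    · exact Filter.tendsto_neg_atTop_atBot.comp tendsto_natCast_atTop_atTop
    · exact tendsto_natCast_atTop_atTop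
    · fun_prop
  have hIm : MeasurableSet {z : ℝ × ℝ | z.2 ∈ Set.Icc (-(m : ℝ)) m} :=
    measurable_snd measurableSet_Icc
  set K : ℝ × ℝ → ℝ≥0∞ := fun z => if N m z.1 = 0 then 0 else
    {z : ℝ × ℝ | z.2 ∈ Set.Icc (-(m : ℝ)) m}.indicator (fun z => ‖G z‖ₑ ^ q) z * (N m z.1)⁻¹ with hK
  have hKm : Measurable K := by
    have h1 : Measurable fun z : ℝ × ℝ => N m z.1 := (hNm m).comp measurable_fst
    refine Measurable.ite (h1 (measurableSet_singleton 0)) measurable_const ?_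
    exact (Measurable.indicator (by fun_prop) hIm).mul h1.inv
  have hKx : ∀ x, N m x ≠ 0 → ∀ t, K (x, t) =
      (Set.Icc (-(m : ℝ)) m).indicator (fun t => ‖G (x, t)‖ₑ ^ q) t * (N m x)⁻¹ := by
    intro x hx t
    rw [hK]
    simp only [if_neg hx]
    rfl
  have hindm : ∀ x, Measurable ((Set.Icc (-(m : ℝ)) m).indicator (fun t => ‖G (x, t)‖ₑ ^ q)) :=
    fun x => Measurable.indicator (by fun_prop) measurableSet_Icc
  have hind : ∀ x, ∫⁻ t, (Set.Icc (-(m : ℝ)) m).indicator (fun t => ‖G (x, t)‖ₑ ^ q) t = N m x :=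
    fun x => lintegral_indicator measurableSet_Icc _
  refine le_trans ?_ (H K n hKm (fun x => ?_) (fun z => ?_) hn hn1 hnt)
  · rw [Measure.volume_eq_prod, lintegral_prod _ (by fun_prop)]
    refine lintegral_mono fun x => ?_
    simp only [← mul_assoc]
    rw [lintegral_mul_const _ (by fun_prop)]
    gcongr
    by_cases hx : N m x = 0
    · rw [hx, ENNReal.zero_rpow_of_pos (by positivity)]; exact zero_le
    rw [← ENNReal.mul_inv_rpow_one_sub q hx (hNt m x), ← hind x,
      ← lintegral_mul_const _ (hindm x), hind x]
    refine lintegral_mono fun t => ?_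
    rw [hKx x hx, ENNReal.mul_rpow_of_nonneg _ _ hQ, ← mul_assoc]
    gcongr
    by_cases ht : t ∈ Set.Icc (-(m : ℝ)) m
    · rw [Set.indicator_of_mem ht, ENNReal.mul_rpow_rpow_one_sub hq0 enorm_ne_top]
    · rw [Set.indicator_of_notMem ht]; exact zero_le
  · by_cases hx : N m x = 0
    · have : ∀ t, K (x, t) = 0 := fun t => if_pos hx
      simp [this]
    · simp only [hKx x hx]
      rw [lintegral_mul_const _ (hindm x), hind x]
      exact ENNReal.mul_inv_le_one _
  · by_cases hx : N m z.1 = 0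
    · have : K z = 0 := if_pos hx
      simp [this]
    · rw [show z = (z.1, z.2) from rfl, hKx _ hx]
      refine ENNReal.mul_ne_top ?_ (ENNReal.inv_ne_top.2 hx)
      refine ((Set.indicator_le_self _ _ _).trans_lt ?_).ne
      exact ENNReal.rpow_lt_top_of_nonneg hq0.le enorm_ne_top

/-- Inner converse Hölder inequality for the supremum norm. -/
theorem lintegral_iSup_mul_le {G : ℝ × ℝ → ℂ} (hG : Continuous G) {P : ℝ}
    (hP : 0 ≤ P) {C : ℝ≥0∞}
    (H : ∀ (K : ℝ × ℝ → ℝ≥0∞) (n : ℝ → ℝ≥0∞), Measurable K → (∀ x, ∫⁻ t, K (x, t) ≤ 1) →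
      (∀ z, K z ≠ ∞) → Measurable n → ∫⁻ x, n x ≤ 1 → (∀ x, n x ≠ ∞) →
      ∫⁻ z, ‖G z‖ₑ * (K z ^ (1 : ℝ) * n z.1 ^ P) ≤ C)
    {n : ℝ → ℝ≥0∞} (hn : Measurable n) (hn1 : ∫⁻ x, n x ≤ 1) (hnt : ∀ x, n x ≠ ∞) :
    ∫⁻ x, (⨆ r : ℚ, ‖G (x, r)‖ₑ) * n x ^ P ≤ C := by
  have hGm := hG.measurable
  set S : ℝ → ℝ≥0∞ := fun x => ⨆ r : ℚ, ‖G (x, r)‖ₑ with hS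
  have hSm : Measurable S := Measurable.iSup fun r => by fun_prop
  set δ : ℕ → ℝ≥0∞ := fun m => ENNReal.ofReal (1 - 1 / ((m : ℝ) + 1)) with hδ
  have hδ1 : ∀ m, δ m < 1 := by
    intro m
    rw [hδ, ← ENNReal.ofReal_one]
    refine (ENNReal.ofReal_lt_ofReal_iff one_pos).2 ?_
    have : (0 : ℝ) < 1 / ((m : ℝ) + 1) := by positivity
    linarith
  set L : ℕ → ℝ → ℝ≥0∞ := fun m x => δ m * min (S x) m with hL
  have hLm : ∀ m, Measurable (L m) := fun m => by fun_prop
  have hLS : ∀ m x, S x ≠ 0 → L m x < S x := by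
    intro m x hx
    by_cases hm : min (S x) (m : ℝ≥0∞) = 0
    · rw [hL]
      simp only [hm, mul_zero]
      exact pos_iff_ne_zero.2 hx
    refine lt_of_lt_of_le ?_ (min_le_left (S x) (m : ℝ≥0∞))
    have hmt : min (S x) (m : ℝ≥0∞) ≠ ∞ :=
      ((min_le_right _ _).trans_lt (ENNReal.natCast_lt_top m)).ne
    calc L m x < 1 * min (S x) m := (ENNReal.mul_lt_mul_iff_left hm hmt).2 (hδ1 m)
      _ = _ := one_mul _
  refine lintegral_le_of_tendsto (F := fun m x => L m x * n x ^ P)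
    (fun m => by have := hLm m; fun_prop) (fun x => ?_) (fun m => ?_)
  · refine ENNReal.Tendsto.mul_const ?_
      (Or.inr (ENNReal.rpow_ne_top_of_nonneg hP (hnt x)))
    have h1 : Filter.Tendsto (fun m : ℕ => min (S x) (m : ℝ≥0∞)) Filter.atTop (nhds (S x)) := by
      have := (tendsto_const_nhds (x := S x)).min ENNReal.tendsto_nat_nhds_top
      simpa using this
    have h2 : Filter.Tendsto δ Filter.atTop (nhds 1) := by
      have := (tendsto_const_nhds (x := (1 : ℝ))).sub
        (tendsto_one_div_add_atTop_nhds_zero_nat (𝕜 := ℝ))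
      have := (ENNReal.continuous_ofReal.tendsto _).comp this
      rwa [sub_zero, ENNReal.ofReal_one] at this
    have := ENNReal.Tendsto.mul h2 (Or.inl one_ne_zero) h1 (Or.inr ENNReal.one_ne_top)
    rwa [one_mul] at this
  set E : Set (ℝ × ℝ) := {z | L m z.1 < ‖G z‖ₑ} with hE
  have hEm : MeasurableSet E :=
    measurableSet_lt ((hLm m).comp measurable_fst) (by fun_prop)
  have hExm : ∀ x, MeasurableSet (Prod.mk x ⁻¹' E) := fun x => measurable_prodMk_left hEm
  set k : ℝ × ℝ → ℝ≥0∞ := E.indicator fun z => ENNReal.ofReal (rexp (-z.2 ^ 2)) with hk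
  have hkm : Measurable k := Measurable.indicator (by fun_prop) hEm
  set W : ℝ → ℝ≥0∞ := fun x => ∫⁻ t, k (x, t) with hW
  have hWm : Measurable W := hkm.lintegral_prod_right'
  have hWx : ∀ x, W x = ∫⁻ t in Prod.mk x ⁻¹' E, ENNReal.ofReal (rexp (-t ^ 2)) := by
    intro x
    rw [hW, ← lintegral_indicator (hExm x)]
    rfl
  have hWt : ∀ x, W x ≠ ∞ := fun x => by
    rw [hWx]
    exact (lintegral_gaussian_lt_top _).ne
  have hW0 : ∀ x, S x ≠ 0 → W x ≠ 0 := by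
    intro x hx
    rw [hWx]
    refine lintegral_gaussian_ne_zero ?_
    obtain ⟨r, hr⟩ := lt_iSup_iff.1 (hLS m x hx)
    have ho : IsOpen (Prod.mk x ⁻¹' E) := by
      have : Prod.mk x ⁻¹' E = {t | L m x < ‖G (x, t)‖ₑ} := rfl
      rw [this]
      exact isOpen_lt continuous_const (by fun_prop)
    exact (ho.measure_pos volume ⟨(r : ℝ), hr⟩).ne'
  set K : ℝ × ℝ → ℝ≥0∞ := fun z => if W z.1 = 0 then 0 else k z * (W z.1)⁻¹ with hK
  have hKm : Measurable K := by
    have h1 : Measurable fun z : ℝ × ℝ => W z.1 := hWm.comp measurable_fst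
    exact Measurable.ite (h1 (measurableSet_singleton 0)) measurable_const (hkm.mul h1.inv)
  have hKx : ∀ x, W x ≠ 0 → ∀ t, K (x, t) = k (x, t) * (W x)⁻¹ := fun x hx t => if_neg hx
  refine le_trans ?_ (H K n hKm (fun x => ?_) (fun z => ?_) hn hn1 hnt)
  · rw [Measure.volume_eq_prod, lintegral_prod _ (by fun_prop)]
    refine lintegral_mono fun x => ?_
    simp only [← mul_assoc, ENNReal.rpow_one]
    rw [lintegral_mul_const _ (by fun_prop)]
    gcongr
    by_cases hx : W x = 0
    · have : S x = 0 := by_contra fun h => hW0 x h hx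
      rw [hL]
      simp [this]
    calc L m x = L m x * (W x * (W x)⁻¹) := by
          rw [ENNReal.mul_inv_cancel hx (hWt x), mul_one]
      _ = ∫⁻ t, L m x * (k (x, t) * (W x)⁻¹) := by
          rw [lintegral_const_mul _ (by fun_prop), lintegral_mul_const _ (by fun_prop)]
      _ ≤ _ := by
          refine lintegral_mono fun t => ?_
          rw [hKx x hx]
          by_cases ht : (x, t) ∈ E
          · have : L m x ≤ ‖G (x, t)‖ₑ := le_of_lt ht
            gcongr
          · rw [hk, Set.indicator_of_notMem ht]; simp
  · by_cases hx : W x = 0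
    · have : ∀ t, K (x, t) = 0 := fun t => if_pos hx
      simp [this]
    · simp only [hKx x hx]
      rw [lintegral_mul_const _ (by fun_prop)]
      exact ENNReal.mul_inv_le_one _
  · by_cases hx : W z.1 = 0
    · have : K z = 0 := if_pos hx
      simp [this]
    · rw [show z = (z.1, z.2) from rfl, hKx _ hx]
      refine ENNReal.mul_ne_top ?_ (ENNReal.inv_ne_top.2 hx)
      exact ((Set.indicator_le_self E
        (fun z : ℝ × ℝ => ENNReal.ofReal (rexp (-z.2 ^ 2))) _).trans_lt ENNReal.ofReal_lt_top).ne

theorem eLpNorm_top_le_iSup_rat {f : ℝ → ℂ} (hf : Continuous f) :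
    eLpNorm f ∞ volume ≤ ⨆ r : ℚ, ‖f r‖ₑ := by
  rw [eLpNorm_exponent_top]
  refine essSup_le_of_ae_le _ (ae_of_all _ fun t => ?_)
  have hc : IsClosed {t : ℝ | ‖f t‖ₑ ≤ ⨆ r : ℚ, ‖f r‖ₑ} :=
    isClosed_le (by fun_prop) continuous_const
  exact isClosed_property Rat.denseRange_cast hc (fun r => le_iSup (fun r : ℚ => ‖f r‖ₑ) r) t

/-- Converse Hölder inequality in mixed-norm spaces. -/
theorem mixedLpLq_le_of_pairing {G : ℝ → ℝ → ℂ} (hG : Continuous fun z : ℝ × ℝ => G z.1 z.2)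
    {r s C : ℝ} (hr : r ∈ Set.Icc (0 : ℝ) 1) (hs : s ∈ Set.Icc (0 : ℝ) 1)
    (H : ∀ R M e k n, IsDualDatum R M e k n →
      ‖∫ z : ℝ × ℝ, G z.1 z.2 * dualFun (1 - r) (1 - s) e k n z‖ ≤ C) :
    mixedLpLq (ENNReal.ofReal r)⁻¹ (ENNReal.ofReal s)⁻¹ G ≤ ENNReal.ofReal C := by
  have hP : 0 ≤ 1 - r := by linarith [hr.2]
  have hQ : 0 ≤ 1 - s := by linarith [hs.2]
  have hGm := hG.measurable
  have H1 := fun (K : ℝ × ℝ → ℝ≥0∞) (n : ℝ → ℝ≥0∞) (hK : Measurable K)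
    (hK1 : ∀ x, ∫⁻ t, K (x, t) ≤ 1) (hKt : ∀ z, K z ≠ ∞) (hn : Measurable n)
    (hn1 : ∫⁻ x, n x ≤ 1) (hnt : ∀ x, n x ≠ ∞) =>
    lintegral_enorm_mul_le_of_pairing hG hP hQ H hK hK1 hKt hn hn1 hnt
  obtain ⟨g, hg, hGg, hgn⟩ : ∃ g : ℝ → ℝ≥0∞, Measurable g ∧
      (∀ x, eLpNorm (G x) (ENNReal.ofReal s)⁻¹ volume ≤ g x) ∧
      ∀ n : ℝ → ℝ≥0∞, Measurable n → ∫⁻ x, n x ≤ 1 → (∀ x, n x ≠ ∞) →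
        ∫⁻ x, g x * n x ^ (1 - r) ≤ ENNReal.ofReal C := by
    rcases hs.1.eq_or_lt with h0 | h0
    · subst h0
      rw [sub_zero] at H1
      refine ⟨fun x => ⨆ r : ℚ, ‖G x r‖ₑ, Measurable.iSup fun r => ?_, fun x => ?_,
        fun n hn hn1 hnt => lintegral_iSup_mul_le hG hP H1 hn hn1 hnt⟩
      · have : Measurable fun x => G x r := hGm.comp (measurable_id.prodMk measurable_const)
        fun_prop
      · rw [ENNReal.ofReal_zero, ENNReal.inv_zero]
        exact eLpNorm_top_le_iSup_rat (hG.comp (Continuous.prodMk_right x))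
    · have hsi : s = 1 / (1 / s) := by field_simp
      rw [hsi] at H1
      have hs1 : 1 ≤ 1 / s := by rw [le_div_iff₀ h0]; linarith [hs.2]
      refine ⟨fun x => (∫⁻ t, ‖G x t‖ₑ ^ (1 / s)) ^ (1 / (1 / s)), ?_, fun x => ?_,
        fun n hn hn1 hnt => lintegral_lintegral_rpow_mul_le hG hs1 hP H1 hn hn1 hnt⟩
      · have : Measurable fun x => ∫⁻ t, ‖G x t‖ₑ ^ (1 / s) :=
          Measurable.lintegral_prod_right' (f := fun z : ℝ × ℝ => ‖G z.1 z.2‖ₑ ^ (1 / s))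
            (by fun_prop)
        fun_prop
      · rw [← ENNReal.ofReal_inv_of_pos h0, eLpNorm_eq_lintegral_rpow_enorm_toReal
          (by simpa using h0) ENNReal.ofReal_ne_top, ENNReal.toReal_ofReal (by positivity)]
        simp
  rcases hr.1.eq_or_lt with h0 | h0
  · subst h0
    rw [sub_zero] at hgn
    rw [mixedLpLq, ENNReal.ofReal_zero, ENNReal.inv_zero, if_pos rfl]
    exact (essSup_mono_ae (ae_of_all _ hGg)).trans (essSup_le_of_forall_dual hg hgn)
  · have hr1 : 1 ≤ r⁻¹ := (one_le_inv₀ h0).2 hr.2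
    have hr2 : 0 ≤ r⁻¹ := by linarith
    rw [mixedLpLq, ← ENNReal.ofReal_inv_of_pos h0, if_neg ENNReal.ofReal_ne_top,
      ENNReal.toReal_ofReal hr2]
    refine le_trans ?_ (lintegral_rpow_le_of_forall_dual hg hr1 (P := 1 - r)
      (by rw [one_div, inv_inv]) hgn)
    refine ENNReal.rpow_le_rpow (lintegral_mono fun x => ?_) (by positivity)
    exact ENNReal.rpow_le_rpow (hGg x) hr2

open scoped FourierTransform in
/-- Fourier inversion on the line with the angular frequency convention. -/
theorem eq_integral_of_integrable_fourier {g : ℝ → ℂ} (hc : Continuous g) (hi : Integrable g)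
    (hf : Integrable fun τ : ℝ => ∫ t : ℝ, Complex.exp (-(Complex.I * (τ * t))) * g t) (t : ℝ) :
    g t = (2 * π)⁻¹ • ∫ τ : ℝ, Complex.exp (Complex.I * (t * τ)) *
      ∫ t : ℝ, Complex.exp (-(Complex.I * (τ * t))) * g t := by
  set f : ℝ → ℂ := fun τ : ℝ => ∫ t : ℝ, Complex.exp (-(Complex.I * (τ * t))) * g t with hfdef
  have h2 : (2 * π) ≠ 0 := by positivity
  have h1 : 𝓕 g = fun w => f (2 * π * w) := by
    ext w
    rw [Real.fourier_real_eq_integral_exp_smul]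
    refine integral_congr_ae (ae_of_all _ fun v => ?_)
    simp only [smul_eq_mul]
    congr 2
    push_cast
    ring
  have h3 : Integrable (𝓕 g) := by
    rw [h1]
    exact hf.comp_mul_left' h2
  have h4 := congrFun (hc.fourierInv_fourier_eq hi h3) t
  rw [Real.fourierInv_eq', h1] at h4
  have h5 := Measure.integral_comp_mul_left
    (fun τ : ℝ => Complex.exp (Complex.I * (t * τ)) * f τ) (2 * π)
  rw [abs_of_pos (by positivity)] at h5
  rw [← h5, ← h4]
  refine integral_congr_ae (ae_of_all _ fun v => ?_)
  simp only [smul_eq_mul]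
  congr 2
  simp
  ring

theorem integrable_cexp_mul_schwartz (F : SchwartzMap (ℝ × ℝ) ℂ) (ξ τ : ℝ) :
    Integrable fun z : ℝ × ℝ =>
      Complex.exp (-(Complex.I * (ξ * z.1 + τ * z.2))) * F z := by
  have hF : Integrable (fun z => F z) := F.integrable
  refine hF.bdd_mul (c := 1) (by fun_prop) (ae_of_all _ fun z => le_of_eq ?_)
  have : -(Complex.I * (ξ * z.1 + τ * z.2)) = Complex.I * ((-(ξ * z.1 + τ * z.2) : ℝ) : ℂ) := by
    push_cast; ring
  rw [this, Complex.norm_exp_I_mul_ofReal]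

theorem FT2_eq_integral_prod (F : SchwartzMap (ℝ × ℝ) ℂ) (ξ τ : ℝ) :
    FT2 (fun x t => F (x, t)) ξ τ =
      ∫ z : ℝ × ℝ, Complex.exp (-(Complex.I * (ξ * z.1 + τ * z.2))) * F z := by
  have h := integrable_cexp_mul_schwartz F ξ τ
  rw [Measure.volume_eq_prod] at h ⊢
  rw [integral_prod _ h, FT2]

open scoped FourierTransform in
/-- The space-time Fourier transform of a Schwartz function is a Schwartz function. -/
theorem exists_schwartzMap_FT2_eq (F : SchwartzMap (ℝ × ℝ) ℂ) :
    ∃ h : SchwartzMap (ℝ × ℝ) ℂ, ∀ ξ τ, FT2 (fun x t => F (x, t)) ξ τ = h (ξ, τ) := by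
  have h2 : (2 * π)⁻¹ ≠ 0 := by positivity
  set L : (ℝ × ℝ) ≃L[ℝ] ℂ :=
    (ContinuousLinearEquiv.smulLeft (Units.mk0 (2 * π)⁻¹ h2)).trans
      Complex.equivRealProdCLM.symm with hL
  set F' : SchwartzMap ℂ ℂ :=
    SchwartzMap.compCLMOfContinuousLinearEquiv ℝ Complex.equivRealProdCLM F with hF'
  refine ⟨SchwartzMap.compCLMOfContinuousLinearEquiv ℝ L (𝓕 F'), fun ξ τ => ?_⟩
  have h3 : SchwartzMap.compCLMOfContinuousLinearEquiv ℝ L (𝓕 F') (ξ, τ) =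
    𝓕 (F' : ℂ → ℂ) (L (ξ, τ)) := rfl
  rw [h3, Real.fourier_eq', FT2_eq_integral_prod,
    ← Complex.volume_preserving_equiv_real_prod.symm.integral_comp']
  refine integral_congr_ae (ae_of_all _ fun z => ?_)
  have h4 : F' (Complex.measurableEquivRealProd.symm z) = F z := rfl
  have h5 : inner ℝ (Complex.measurableEquivRealProd.symm z) (L (ξ, τ)) =
      (2 * π)⁻¹ * (ξ * z.1 + τ * z.2) := by
    have h6 : L (ξ, τ) = ⟨(2 * π)⁻¹ * ξ, (2 * π)⁻¹ * τ⟩ := rfl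
    have h7 : Complex.measurableEquivRealProd.symm z = ⟨z.1, z.2⟩ := rfl
    rw [h6, h7, Complex.inner]
    simp only [Complex.mul_re, Complex.conj_re, Complex.conj_im]
    ring
  simp only [smul_eq_mul]
  rw [h4, h5]
  congr 2
  have : (π : ℂ) ≠ 0 := by exact_mod_cast pi_ne_zero
  push_cast
  field_simp

theorem SchwartzMap.exists_norm_le_div (F : SchwartzMap (ℝ × ℝ) ℂ) :
    ∃ C : ℝ, ∀ x t, ‖F (x, t)‖ ≤ C * (1 + x ^ 2)⁻¹ := by
  obtain ⟨C0, -, h0⟩ := F.decay 0 0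
  obtain ⟨C2, -, h2⟩ := F.decay 2 0
  refine ⟨C0 + C2, fun x t => ?_⟩
  rw [← div_eq_mul_inv, le_div_iff₀ (by positivity)]
  have h0 := h0 (x, t)
  have h2 := h2 (x, t)
  simp only [norm_iteratedFDeriv_zero, pow_zero, one_mul] at h0 h2
  have : x ^ 2 ≤ ‖(x, t)‖ ^ 2 := by
    rw [← sq_abs]
    gcongr
    exact norm_fst_le (x, t)
  nlinarith [norm_nonneg (F (x, t))]

/-- The partial Fourier transform in space is recovered from the space-time one. -/
theorem FT_eq_integral_FT2 (F : SchwartzMap (ℝ × ℝ) ℂ) (h : SchwartzMap (ℝ × ℝ) ℂ)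
    (hF : ∀ ξ τ, FT2 (fun x t => F (x, t)) ξ τ = h (ξ, τ)) (ξ t : ℝ)
    (hi : Integrable fun τ => h (ξ, τ)) :
    FT (fun y => F (y, t)) ξ =
      (2 * π)⁻¹ • ∫ τ : ℝ, Complex.exp (Complex.I * (t * τ)) * h (ξ, τ) := by
  have hg0 : ∀ t, FT (fun y => F (y, t)) ξ =
      ∫ x : ℝ, Complex.exp (-(Complex.I * ξ * x)) * F (x, t) := fun t => rfl
  have hnorm : ∀ x : ℝ, ‖Complex.exp (-(Complex.I * ξ * x))‖ = 1 := fun x => by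
    have : -(Complex.I * ξ * x) = Complex.I * ((-(ξ * x) : ℝ) : ℂ) := by push_cast; ring
    rw [this, Complex.norm_exp_I_mul_ofReal]
  have hFT2 : ∀ τ : ℝ, ∫ t : ℝ, Complex.exp (-(Complex.I * (τ * t))) * FT (fun y => F (y, t)) ξ =
      h (ξ, τ) := by
    intro τ
    rw [← hF, FT2_eq_integral_prod]
    have hint := integrable_cexp_mul_schwartz F ξ τ
    rw [Measure.volume_eq_prod] at hint ⊢
    rw [integral_prod_symm _ hint]
    refine integral_congr_ae (ae_of_all _ fun t => ?_)
    simp only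
    rw [hg0, ← integral_const_mul]
    refine integral_congr_ae (ae_of_all _ fun x => ?_)
    simp only
    rw [← mul_assoc, ← Complex.exp_add]
    congr 2
    ring
  have hc : Continuous fun t => FT (fun y => F (y, t)) ξ := by
    obtain ⟨C, hC⟩ := F.exists_norm_le_div
    simp only [hg0]
    refine continuous_of_dominated (bound := fun x => C * (1 + x ^ 2)⁻¹) (fun t => ?_) (fun t => ?_)
      (integrable_inv_one_add_sq.const_mul C) (ae_of_all _ fun x => ?_)
    · have : Continuous fun x => F (x, t) := F.continuous.comp (by fun_prop)
      fun_prop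
    · refine ae_of_all _ fun x => ?_
      rw [norm_mul, hnorm, one_mul]
      exact hC x t
    · have : Continuous fun t => F (x, t) := F.continuous.comp (by fun_prop)
      fun_prop
  have hgi : Integrable fun t => FT (fun y => F (y, t)) ξ := by
    have hint := integrable_cexp_mul_schwartz F ξ 0
    rw [Measure.volume_eq_prod] at hint
    refine hint.integral_prod_right.congr (ae_of_all _ fun t => ?_)
    simp only
    rw [hg0]
    refine integral_congr_ae (ae_of_all _ fun x => ?_)
    simp only
    congr 2
    push_cast
    ring
  have := eq_integral_of_integrable_fourier hc hgi (by simpa only [hFT2] using hi) t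
  simpa only [hFT2] using this

/-- The symbol `|ξ|^α 1_{|ξ| ≥ a}` of `D_x^α P^a`. -/
def symbolDPa (ν μ α : ℝ) (w : ℝ × ℝ) : ℝ := if aconst ν μ ≤ |w.1| then |w.1| ^ α else 0

@[fun_prop]
theorem measurable_symbolDPa (ν μ α : ℝ) : Measurable (symbolDPa ν μ α) :=
  Measurable.ite (measurableSet_le measurable_const (by fun_prop)) (by fun_prop) measurable_const

theorem abs_symbolDPa_le (ν μ : ℝ) {α : ℝ} (hα : α ≤ 1) (w : ℝ × ℝ) :
    |symbolDPa ν μ α w| ≤ ‖w‖ := by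
  unfold symbolDPa
  split_ifs with h
  · have ha : 1 ≤ aconst ν μ := by
      have := le_max_left 1 |2 * ν / (3 * μ)|
      unfold aconst
      linarith
    rw [abs_of_nonneg (by positivity)]
    calc |w.1| ^ α ≤ |w.1| ^ (1 : ℝ) := Real.rpow_le_rpow_of_exponent_le (ha.trans h) hα
      _ = |w.1| := Real.rpow_one _
      _ ≤ _ := norm_fst_le w
  · simp

theorem integrable_symbolDPa_mul (ν μ : ℝ) {α : ℝ} (hα : α ≤ 1) (h : SchwartzMap (ℝ × ℝ) ℂ) :
    Integrable fun w => (symbolDPa ν μ α w : ℂ) * h w := by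
  refine (h.integrable_pow_mul volume 1).mono' (by
    have := h.continuous.measurable
    fun_prop) (ae_of_all _ fun w => ?_)
  rw [norm_mul, Complex.norm_real, Real.norm_eq_abs, pow_one]
  gcongr
  exact abs_symbolDPa_le ν μ hα w

theorem integrable_mul_char2 {f : ℝ × ℝ → ℂ} (hf : Integrable f) (z : ℝ × ℝ) :
    Integrable fun w => f w * char2 z w := by
  refine hf.mul_bdd (c := 1) ?_ (ae_of_all _ fun w => (norm_char2 z w).le)
  have : Measurable fun w => char2 z w := measurable_char2.comp measurable_prodMk_left
  exact this.aestronglyMeasurable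

theorem DPa_eq_integral (ν μ : ℝ) {α : ℝ} (hα : α ≤ 1) (F h : SchwartzMap (ℝ × ℝ) ℂ)
    (hF : ∀ ξ τ, FT2 (fun x t => F (x, t)) ξ τ = h (ξ, τ)) (x t : ℝ) :
    DPa ν μ α (fun x t => F (x, t)) x t =
      ((2 * π)⁻¹ ^ 2 : ℝ) • ∫ w, (symbolDPa ν μ α w : ℂ) * h w * char2 (x, t) w := by
  have hi := integrable_mul_char2 (integrable_symbolDPa_mul ν μ hα h) (x, t)
  have hh : Integrable (fun w => h w) := h.integrable
  rw [Measure.volume_eq_prod] at hi hh ⊢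
  rw [integral_prod _ hi, DPa, pow_two, mul_smul]
  congr 1
  rw [← integral_smul]
  refine integral_congr_ae ?_
  filter_upwards [hh.prod_right_ae] with ξ hξ
  simp only [symbolDPa]
  split_ifs with hξa
  · rw [FT_eq_integral_FT2 F h hF ξ t hξ, mul_smul_comm, ← integral_const_mul]
    congr 1
    refine integral_congr_ae (ae_of_all _ fun τ => ?_)
    simp only [char2]
    push_cast
    rw [mul_add, Complex.exp_add]
    ring_nf
  · simp

theorem continuous_integral_mul_char2 {f : ℝ × ℝ → ℂ} (hf : Integrable f) :
    Continuous fun z => ∫ w, f w * char2 z w := by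
  refine continuous_of_dominated (bound := fun w => ‖f w‖)
    (fun z => (integrable_mul_char2 hf z).aestronglyMeasurable)
    (fun z => ae_of_all _ fun w => ?_) hf.norm (ae_of_all _ fun w => ?_)
  · rw [norm_mul, norm_char2, mul_one]
  · unfold char2
    fun_prop

/-- The truncations of the dual form converge to the untruncated pairing. -/
theorem norm_integral_pairing_le {ν μ α b P Q C : ℝ} (hP : 0 ≤ P) (hQ : 0 ≤ Q) (hα : α ≤ 1)
    (hb : 0 ≤ b)
    (H : ∀ R M N B e k n ψ X, IsDualDatum R M e k n → IsTest ν μ N B ψ → 0 ≤ X →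
      ∫⁻ w, ‖ψ w‖ₑ ^ 2 ≤ ENNReal.ofReal (X ^ 2) → ‖dualForm ν μ α b P Q e k n ψ‖ ≤ C * X)
    (h : SchwartzMap (ℝ × ℝ) ℂ) {X : ℝ} (hX : 0 ≤ X)
    (hhX : ∫⁻ w : ℝ × ℝ, ENNReal.ofReal ((1 + (w.2 - phase ν μ w.1) ^ 2) ^ b) * ‖h w‖ₑ ^ 2 ≤
      ENNReal.ofReal (X ^ 2)) {R M e k n} (hd : IsDualDatum R M e k n) :
    ‖∫ z, (∫ w, (symbolDPa ν μ α w : ℂ) * h w * char2 z w) * dualFun P Q e k n z‖ ≤ C * X := by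
  set Φ : ℝ × ℝ → ℂ := fun w => (symbolDPa ν μ α w : ℂ) * h w with hΦ
  have hΦi : Integrable Φ := integrable_symbolDPa_mul ν μ hα h
  have hhm := h.continuous.measurable
  set D := dualFun P Q e k n with hD
  have hDi : Integrable D := hd.integrable_dualFun hP hQ
  have hΨi : Integrable fun v : (ℝ × ℝ) × (ℝ × ℝ) => Φ v.2 * D v.1 * char2 v.1 v.2 := by
    have h1 : Integrable fun v : (ℝ × ℝ) × (ℝ × ℝ) => Φ v.2 * D v.1 := by
      rw [Measure.volume_eq_prod (ℝ × ℝ) (ℝ × ℝ)]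
      exact (hDi.mul_prod hΦi).congr (ae_of_all _ fun v => mul_comm _ _)
    exact h1.mul_bdd (c := 1) measurable_char2.aestronglyMeasurable
      (ae_of_all _ fun v => (norm_char2 _ _).le)
  have hmain : ∫ z, (∫ w, Φ w * char2 z w) * D z =
      ∫ v : (ℝ × ℝ) × (ℝ × ℝ), Φ v.2 * D v.1 * char2 v.1 v.2 := by
    rw [Measure.volume_eq_prod (ℝ × ℝ) (ℝ × ℝ)] at hΨi ⊢
    rw [integral_prod _ hΨi]
    refine integral_congr_ae (ae_of_all _ fun z => ?_)
    simp only
    rw [← integral_mul_const]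
    refine integral_congr_ae (ae_of_all _ fun w => ?_)
    simp only
    ring
  rw [hmain]
  set box : ℕ → Set (ℝ × ℝ) := fun N =>
    {w | aconst ν μ ≤ |w.1|} ∩ (Set.Icc (-(N : ℝ)) N ×ˢ Set.Icc (-(N : ℝ)) N) with hbox
  have hboxm : ∀ N, MeasurableSet (box N) := fun N =>
    (measurableSet_le measurable_const (by fun_prop)).inter
      (measurableSet_Icc.prod measurableSet_Icc)
  set ψ : ℕ → ℝ × ℝ → ℂ := fun N => (box N).indicator fun w =>
    (((1 + (w.2 - phase ν μ w.1) ^ 2) ^ (b / 2) : ℝ) : ℂ) * h w with hψ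
  have htest : ∀ N : ℕ, ∃ B, IsTest ν μ N B (ψ N) := by
    intro N
    have hcont : Continuous fun w : ℝ × ℝ =>
        (((1 + (w.2 - phase ν μ w.1) ^ 2) ^ (b / 2) : ℝ) : ℂ) * h w := by
      have h1 : Continuous fun w : ℝ × ℝ => phase ν μ w.1 :=
        (continuous_phase ν μ).comp continuous_fst
      have h2 : Continuous fun w : ℝ × ℝ => (1 + (w.2 - phase ν μ w.1) ^ 2) ^ (b / 2) :=
        Continuous.rpow_const (by fun_prop) fun w => Or.inr (by positivity)
      have := h.continuous
      fun_prop
    obtain ⟨B, hB⟩ := ((isCompact_Icc (a := -(N : ℝ)) (b := N)).prod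
      (isCompact_Icc (a := -(N : ℝ)) (b := N))).exists_bound_of_continuousOn hcont.continuousOn
    have hB0 : 0 ≤ B := (norm_nonneg _).trans (hB 0 ⟨by simp, by simp⟩)
    refine ⟨B, hcont.measurable.indicator (hboxm N), fun w => ?_, fun w hw => ?_⟩
    · by_cases hw : w ∈ box N
      · rw [hψ]
        simp only
        rw [Set.indicator_of_mem hw]
        exact hB w hw.2
      · rw [hψ]
        simp only
        rwa [Set.indicator_of_notMem hw, norm_zero]
    · have hw' : w ∈ box N := Set.mem_of_indicator_ne_zero hw
      exact ⟨hw'.1, abs_le.2 hw'.2.1, abs_le.2 hw'.2.2⟩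
  have hψwt : ∀ N w, ψ N w * (wt ν μ α b w : ℂ) = (box N).indicator Φ w := by
    intro N w
    by_cases hw : w ∈ box N
    · rw [hψ]
      simp only
      rw [Set.indicator_of_mem hw, Set.indicator_of_mem hw, hΦ]
      simp only [symbolDPa, if_pos hw.1.out, wt]
      have h1 : (1 + (w.2 - phase ν μ w.1) ^ 2) ^ (b / 2) *
          (1 + (w.2 - phase ν μ w.1) ^ 2) ^ (-(b / 2)) = 1 := by
        rw [← Real.rpow_add (by positivity), add_neg_cancel, Real.rpow_zero]
      have h2 : (((1 + (w.2 - phase ν μ w.1) ^ 2) ^ (b / 2) : ℝ) : ℂ) *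
          (((1 + (w.2 - phase ν μ w.1) ^ 2) ^ (-(b / 2)) : ℝ) : ℂ) = 1 := by
        rw [← Complex.ofReal_mul, h1, Complex.ofReal_one]
      rw [Complex.ofReal_mul]
      linear_combination ((|w.1| ^ α : ℝ) : ℂ) * h w * h2
    · rw [hψ]
      simp only
      rw [Set.indicator_of_notMem hw, Set.indicator_of_notMem hw, zero_mul]
  have hψX : ∀ N, ∫⁻ w, ‖ψ N w‖ₑ ^ 2 ≤ ENNReal.ofReal (X ^ 2) := by
    intro N
    refine le_trans (lintegral_mono fun w => ?_) hhX
    by_cases hw : w ∈ box N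
    · rw [hψ]
      simp only
      rw [Set.indicator_of_mem hw, enorm_mul, mul_pow]
      gcongr
      rw [← ofReal_norm, Complex.norm_real, Real.norm_of_nonneg (by positivity),
        ← ENNReal.ofReal_pow (by positivity), ← Real.rpow_natCast, ← Real.rpow_mul (by positivity)]
      norm_num
    · rw [hψ]
      simp only
      rw [Set.indicator_of_notMem hw]
      simp
  have hform : ∀ N, dualForm ν μ α b P Q e k n (ψ N) =
      ∫ v : (ℝ × ℝ) × (ℝ × ℝ), (box N).indicator Φ v.2 * D v.1 * char2 v.1 v.2 := by
    intro N
    rw [dualForm]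
    simp only [hψwt, hD]
  have hlim : Filter.Tendsto (fun N => dualForm ν μ α b P Q e k n (ψ N)) Filter.atTop
      (nhds (∫ v : (ℝ × ℝ) × (ℝ × ℝ), Φ v.2 * D v.1 * char2 v.1 v.2)) := by
    simp only [hform]
    refine tendsto_integral_of_dominated_convergence
      (fun v => ‖Φ v.2 * D v.1 * char2 v.1 v.2‖) (fun N => ?_) hΨi.norm
      (fun N => ae_of_all _ fun v => ?_) (ae_of_all _ fun v => ?_)
    · have h1 : Measurable ((box N).indicator Φ) := Measurable.indicator (by fun_prop) (hboxm N)
      have h2 : Measurable D := hd.measurable_dualFun P Q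
      fun_prop
    · rw [norm_mul, norm_mul, norm_mul, norm_mul]
      gcongr
      exact norm_indicator_le_norm_self _ _
    · refine tendsto_const_nhds.congr' ?_
      filter_upwards [Filter.eventually_ge_atTop ⌈|v.2.1|⌉₊,
        Filter.eventually_ge_atTop ⌈|v.2.2|⌉₊] with N h1 h2
      congr 2
      by_cases hv : aconst ν μ ≤ |v.2.1|
      · rw [Set.indicator_of_mem]
        exact ⟨hv, abs_le.1 (Nat.ceil_le.1 h1), abs_le.1 (Nat.ceil_le.1 h2)⟩
      · rw [Set.indicator_of_notMem fun hv' => hv hv'.1, hΦ]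
        simp [symbolDPa, hv]
  refine le_of_tendsto hlim.norm (Filter.Eventually.of_forall fun N => ?_)
  obtain ⟨B, hB⟩ := htest N
  exact H R M N B e k n (ψ N) X hd hB hX (hψX N)

/-- A dual bound implies the corresponding mixed-norm estimate. -/
theorem DualBound.mixedLpLq_le {ν μ α b r s : ℝ} (hr : r ∈ Set.Icc (0 : ℝ) 1)
    (hs : s ∈ Set.Icc (0 : ℝ) 1) (hα : α ≤ 1) (hb : 0 ≤ b)
    (H : DualBound ν μ α b (1 - r) (1 - s)) :
    ∃ C > (0 : ℝ), ∀ F : SchwartzMap (ℝ × ℝ) ℂ,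
      mixedLpLq (ENNReal.ofReal r)⁻¹ (ENNReal.ofReal s)⁻¹ (DPa ν μ α (fun x t => F (x, t))) ≤
        ENNReal.ofReal C * XNorm ν μ 0 b (fun x t => F (x, t)) := by
  obtain ⟨C, hC, H⟩ := H
  refine ⟨(2 * π)⁻¹ ^ 2 * (C + 1), by positivity, fun F => ?_⟩
  by_cases hXt : XNorm ν μ 0 b (fun x t => F (x, t)) = ∞
  · rw [hXt, ENNReal.mul_top (by simp; positivity)]
    exact le_top
  obtain ⟨h, hF⟩ := exists_schwartzMap_FT2_eq F
  set X := (XNorm ν μ 0 b (fun x t => F (x, t))).toReal with hX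
  have hX0 : 0 ≤ X := ENNReal.toReal_nonneg
  have hhX : ∫⁻ w : ℝ × ℝ, ENNReal.ofReal ((1 + (w.2 - phase ν μ w.1) ^ 2) ^ b) * ‖h w‖ₑ ^ 2 ≤
      ENNReal.ofReal (X ^ 2) := by
    have hhm := h.continuous.measurable
    rw [ENNReal.ofReal_pow hX0, hX, ENNReal.ofReal_toReal hXt, XNorm, ← ENNReal.rpow_natCast,
      ← ENNReal.rpow_mul, Measure.volume_eq_prod, lintegral_prod _ (by fun_prop)]
    norm_num [hF]
    rfl
  rw [← ENNReal.ofReal_toReal hXt, ← ENNReal.ofReal_mul (by positivity), ← hX]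
  have hG : ∀ z : ℝ × ℝ, DPa ν μ α (fun x t => F (x, t)) z.1 z.2 =
      ((2 * π)⁻¹ ^ 2 : ℝ) • ∫ w, (symbolDPa ν μ α w : ℂ) * h w * char2 z w := fun z =>
    DPa_eq_integral ν μ hα F h hF z.1 z.2
  refine mixedLpLq_le_of_pairing ?_ hr hs fun R M e k n hd => ?_
  · simp only [hG]
    exact Continuous.const_smul (M := ℝ)
      (continuous_integral_mul_char2 (integrable_symbolDPa_mul ν μ hα h)) _
  · simp only [hG, smul_mul_assoc]
    rw [integral_smul, norm_smul, Real.norm_of_nonneg (by positivity), mul_assoc]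
    gcongr
    calc _ ≤ C * X := norm_integral_pairing_le (by linarith [hr.2]) (by linarith [hs.2]) hα hb H h
          hX0 hhX hd
      _ ≤ (C + 1) * X := by gcongr; linarith

/-- **Lemma 2.3** (interpolation of the Bourgain-space Strichartz estimates with the
trivial `L²` bound): for every `θ ∈ [0,1]`, `α ∈ [-θ/4, θ]` and `b > θ/2` there is
`C > 0`, depending only on `ν, μ, θ, α, b`, such that
`‖D_x^α P^a F‖_{L^p_x L^q_t} ≤ C ‖F‖_{X_{0,b}}` for every Schwartz `F` on `ℝ²`,
where `1/p = 1/2 - α/5 - 3θ/10` and `1/q = 1/2 + 2α/5 - 2θ/5`. -/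
theorem benjamin_bourgain_strichartz_interp (ν μ : ℝ) (hμ : μ ≠ 0)
    (θ : ℝ) (hθ : θ ∈ Set.Icc (0 : ℝ) 1) (α : ℝ) (hα : α ∈ Set.Icc (-(θ / 4)) θ)
    (b : ℝ) (hb : θ / 2 < b) :
    ∃ C > (0 : ℝ), ∀ F : SchwartzMap (ℝ × ℝ) ℂ,
      mixedLpLq (ENNReal.ofReal (1 / 2 - α / 5 - 3 * θ / 10))⁻¹
          (ENNReal.ofReal (1 / 2 + 2 * α / 5 - 2 * θ / 5))⁻¹
          (DPa ν μ α (fun x t => F (x, t))) ≤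
        ENNReal.ofReal C * XNorm ν μ 0 b (fun x t => F (x, t)) := by
  have hdual := dualBound_of_mem_Icc (ν := ν) hμ hθ hα hb
  obtain ⟨h0, h1⟩ := hθ
  obtain ⟨h2, h3⟩ := hα
  exact hdual.mixedLpLq_le ⟨by linarith, by linarith⟩ ⟨by linarith, by linarith⟩ (by linarith)
    (by linarith)
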